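/- arXiv:2112.06112 — 2 statements merged into one kernel-verified Lean document; each statement's English description precedes it below -/
import Mathlib

section
/- Any two 3-regular simple graphs on at most 12 vertices that are cospectral (their adjacency matrices have the same characteristic polynomial) are isomorphic; that is, there are no non-isomorphic cospectral cubic graphs on at most 12 vertices. -/
open Matrix Polynomial

/-- The adjacency matrix over `ℝ` of a simple graph on `Fin n`. -/
noncomputable def adjMat {n : ℕ} (G : SimpleGraph (Fin n)) : Matrix (Fin n) (Fin n) ℝ :=
  letI : DecidableRel G.Adj := Classical.decRel G.Adj
  G.adjMatrix ℝ

/-- The chromatic index of a simple graph: the chromatic number of its line graph. -/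
noncomputable def chromaticIndex {V : Type*} (G : SimpleGraph V) : ℕ∞ :=
  G.lineGraph.chromaticNumber


namespace CubicSearch

/-! The definitions below are evaluated by the kernel. They use recursors and the arithmetic
functions on `ℕ` directly, because the kernel reduces these quickly. -/

/-- `k x`. Reducing the recursor turns `x` into a literal before it is passed on, so that the kernel
does not copy an unevaluated expression. -/
def force {α : Type*} (x : ℕ) (k : ℕ → α) : α :=
  Nat.rec (k 0) (fun y _ => k y.succ) x

/-- `if b then x else y`. -/
def pick {α : Type*} (b : Bool) (x y : α) : α := Bool.rec y x b

/-- All elements of the list satisfy `p`. -/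
def all {α : Type*} (l : List α) (p : α → Bool) : Bool :=
  List.rec true (fun a _ ih => pick (p a) ih false) l

/-- All natural numbers less than `n` satisfy `p`. -/
def allBelow (n : ℕ) (p : ℕ → Bool) : Bool :=
  Nat.rec true (fun i ih => pick (p i) ih false) n

/-- The element of `l` at a given position, or `d` beyond the end. -/
def nth {α : Type*} (d : α) (l : List α) : ℕ → α :=
  List.rec (fun _ => d) (fun a _ ih i => Nat.rec a (fun j _ => ih j) i) l

/-- Pass on the list `f 0, …, f (n - 1)`, followed by `l`, with all values evaluated. -/
def tabulate {α : Type*} (f : ℕ → ℕ) (n : ℕ) : (List ℕ → α) → List ℕ → α :=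
  Nat.rec (fun k l => k l) (fun i ih k l => force (f i) fun x => ih k (x :: l)) n

/-- The union of the bit sets `f 0, …, f (n - 1)`. -/
def union (f : ℕ → ℕ) (n : ℕ) : ℕ := Nat.rec 0 (fun i ih => (f i).lor ih) n

/-- The bit set `{0, …, n - 1}`. -/
def full (n : ℕ) : ℕ := Nat.pred (Nat.pow 2 n)

/-- The bit of `m` at position `i`, as a number. -/
def bitValue (m i : ℕ) : ℕ := (m.shiftRight i).land 1

/-- The bit of `m` at position `i`. -/
def bit (m i : ℕ) : Bool := Nat.beq (bitValue m i) 1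

/-- Remove the least element of a bit set. -/
def removeLeast (r : ℕ) : ℕ := force r fun r => r.land r.pred

/-- The bit set `r` has exactly three elements. -/
def isTriple (r : ℕ) : Bool :=
  force (removeLeast (removeLeast r)) fun s => pick (Nat.beq s 0) false (Nat.beq (removeLeast s) 0)

/-- Decode at most `k` edges from the base `16` digits of a number, two digits for each edge. -/
def edgeList (k : ℕ) : ℕ → List (ℕ × ℕ) :=
  Nat.rec (fun _ => []) (fun _ ih c => pick (Nat.beq c 0) []
    (force (c.mod 256) fun e => (e.div 16, e.mod 16) :: force (c.div 256) ih)) k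

/-- The position of the bit for the pair `(a, b)` in an adjacency mask. -/
def pairIndex (a b : ℕ) : ℕ := (Nat.mul 16 a).add b

/-- Add the edge `ab` to an adjacency mask. -/
def addEdge (m a b : ℕ) : ℕ := (m.lor (Nat.pow 2 (pairIndex a b))).lor (Nat.pow 2 (pairIndex b a))

/-- The adjacency mask of a list of edges. -/
def edgeMask (E : List (ℕ × ℕ)) : ℕ :=
  List.rec 0 (fun e _ ih => addEdge ih e.1 e.2) E

/-- The bit set of the neighbours of `v` in the graph on `n` vertices with adjacency mask `m`. -/
def neighborBits (n m v : ℕ) : ℕ := (m.shiftRight (pairIndex v 0)).land (full n)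

/-- The bit set of the vertices of degree three in the graph on `n` vertices with adjacency
mask `m`. -/
def cubicVertices (n m : ℕ) : ℕ :=
  union (fun v => pick (isTriple (neighborBits n m v)) (Nat.pow 2 v) 0) n

/-- The graph on `n` vertices with adjacency mask `m` is cubic. -/
def isCubicMask (n m : ℕ) : Bool := Nat.beq (cubicVertices n m) (full n)

/-- The relabelling of vertices encoded by the base `16` digits of `p`. -/
def relabel (p a : ℕ) : ℕ := (p.shiftRight (Nat.mul 4 a)).land 15

/-- The relabelling encoded by `p` maps `{0, …, n - 1}` onto itself. -/
def isPerm (n p : ℕ) : Bool := Nat.beq (union (fun a => Nat.pow 2 (relabel p a)) n) (full n)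

/-- The relabelling encoded by `p` sends every edge in `E` to an edge of the mask `m`. -/
def mapsEdges (p m : ℕ) (E : List (ℕ × ℕ)) : Bool :=
  all E fun e => bit m (pairIndex (relabel p e.1) (relabel p e.2))

/-- An entry `(c, v, L)` stands for the partial graph `edgeList 18 c`. Unless that graph is cubic,
`v` is a vertex of degree less than three, and the base `16 ^ 16` digits of `L` have the form
`w + 16 * j + 16 ^ 4 * p`, where `p` embeds the graph of the earlier entry `j` into the graph with
the additional edge `vw`. -/
abbrev Entry := ℕ × ℕ × ℕ

/-- The table entry with index `i`; every row of a table but the last has length `40`. -/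
def entry (T : List (List Entry)) (i : ℕ) : Entry :=
  nth (0, 0, 0) (nth [] T (i.div 40)) (i.mod 40)

/-- The edges of the table entry with index `i`. -/
def entryEdges (T : List (List Entry)) (i : ℕ) : List (ℕ × ℕ) := force (entry T i).1 (edgeList 18)

/-- One of the first twelve digits of a number certifies that the mask `m` with the additional edge
`vw` contains the graph of an entry before the entry `i`. -/
def hasCertificate (n : ℕ) (T : List (List Entry)) (i m v w : ℕ) : ℕ → Bool :=
  Nat.rec (fun _ => false) (fun _ ih L => pick (Nat.beq (L.land 15) w)
    (force ((L.shiftRight 4).land 4095) fun j => pick (Nat.ble i j) false <|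
      force ((L.shiftRight 16).land 281474976710655) fun p => pick (isPerm n p)
        (force (addEdge m v w) fun m' => mapsEdges p m' (entryEdges T j)) false)
    (force (L.shiftRight 64) ih)) 12

/-- The table entry with index `i` is cubic, or every possible additional edge at its vertex leads
to a graph containing an earlier entry. -/
def checkEntry (n : ℕ) (T : List (List Entry)) (i : ℕ) : Bool :=
  force (edgeMask (entryEdges T i)) fun m =>
    pick (isCubicMask n m) true <|
      force (entry T i).2.1 fun v => force (cubicVertices n m) fun s =>
        pick (Nat.ble n v) false <| pick (bit s v) false <| allBelow n fun w =>
          pick (Nat.beq w v) true <| pick (bit m (pairIndex v w)) true <| pick (bit s w) true <|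
            hasCertificate n T i m v w (entry T i).2.2

/-- All entries with index less than `N` pass the check. -/
def checkTable (n : ℕ) (T : List (List Entry)) (N : ℕ) : Bool := allBelow N (checkEntry n T)

/-- The sum of those entries of `R` whose bits in `m`, counted from a given position, are set. -/
def maskedSum (m : ℕ) (R : List ℕ) : ℕ → ℕ :=
  List.rec (fun _ => 0) (fun r _ ih s => (Nat.mul (bitValue m s) r).add (ih s.succ)) R

/-- The base in which the rows of a matrix are packed into single numbers. -/
abbrev base : ℕ := 1000000007

/-- The sum of the diagonal digits, counted from a given position, of packed rows `R`. -/
def diagonalSum (R : List ℕ) : ℕ → ℕ :=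
  List.rec (fun _ => 0) (fun r _ ih s => ((r.div (Nat.pow base s)).mod base).add (ih s.succ)) R

/-- The traces of the next `t` powers of the adjacency matrix with mask `m`, combined into a single
number, where the current power has the packed rows `R`. -/
def walkCode (n m t : ℕ) : List ℕ → ℕ :=
  Nat.rec (fun _ => 0) (fun _ ih R => tabulate (fun i => maskedSum m R (pairIndex i 0)) n
    (fun R' => (diagonalSum R' 0).add (Nat.mul 1000003 (ih R'))) []) t

/-- The traces of the first eight powers of the adjacency matrix with mask `m`, combined into a
single number. -/
def maskCode (n m : ℕ) : ℕ := tabulate (Nat.pow base) n (walkCode n m 8) []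

/-- The list has no repeated entries. -/
def distinct (l : List ℕ) : Bool :=
  List.rec true (fun x xs ih => pick (all xs fun y => pick (Nat.beq y x) false true) ih false) l

/-- Pass on the list of codes of the cubic entries with index less than `N`, followed by `l`. -/
def tabulateCodes {α : Type*} (n : ℕ) (T : List (List Entry)) (N : ℕ) :
    (List ℕ → α) → List ℕ → α :=
  Nat.rec (fun k l => k l) (fun i ih k l => force (edgeMask (entryEdges T i)) fun m =>
    pick (isCubicMask n m) (force (maskCode n m) fun x => ih k (x :: l)) (ih k l)) N

/-- The cubic entries with index less than `N` have different codes. -/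
def checkCodes (n : ℕ) (T : List (List Entry)) (N : ℕ) : Bool := tabulateCodes n T N distinct []


section Evaluation

variable {α : Type*}

@[simp] theorem force_eq (x : ℕ) (k : ℕ → α) : force x k = k x := by cases x <;> rfl

@[simp] theorem pick_eq (b : Bool) (x y : α) : pick b x y = if b then x else y := by
  cases b <;> rfl

theorem all_iff {l : List α} {p : α → Bool} : all l p = true ↔ ∀ a ∈ l, p a = true := by
  induction l with
  | nil => simp [all]
  | cons a l ih =>
    change pick (p a) (all l p) false = true ↔ _
    simp [ih]

theorem allBelow_iff {n : ℕ} {p : ℕ → Bool} : allBelow n p = true ↔ ∀ i < n, p i = true := by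
  induction n with
  | zero => simp [allBelow]
  | succ n ih =>
    change pick (p n) (allBelow n p) false = true ↔ _
    simp only [pick_eq, Nat.lt_succ_iff_lt_or_eq, or_imp, forall_and, forall_eq, ← ih]
    simp [and_comm]

theorem tabulate_eq (f : ℕ → ℕ) (n : ℕ) (k : List ℕ → α) (l : List ℕ) :
    tabulate f n k l = k ((List.range n).map f ++ l) := by
  induction n generalizing k l with
  | zero => rfl
  | succ n ih =>
    change force (f n) (fun x => tabulate f n k (x :: l)) = _
    simp [ih, List.range_succ]

theorem testBit_union (f : ℕ → ℕ) (n k : ℕ) :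
    (union f n).testBit k = true ↔ ∃ i < n, (f i).testBit k = true := by
  induction n with
  | zero => simp [union]
  | succ n ih =>
    change (f n ||| union f n).testBit k = true ↔ _
    simp only [Nat.testBit_or, Bool.or_eq_true, ih, Nat.lt_succ_iff_lt_or_eq]
    grind

theorem full_eq (n : ℕ) : full n = 2 ^ n - 1 := rfl

theorem testBit_full (n k : ℕ) : (full n).testBit k = decide (k < n) := by
  rw [full_eq, Nat.testBit_two_pow_sub_one]

theorem bitValue_eq (m i : ℕ) : bitValue m i = (m.testBit i).toNat := by
  change (m >>> i) &&& 1 = _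
  rw [Nat.testBit_eq_decide_div_mod_eq, Nat.and_one_is_mod, Nat.shiftRight_eq_div_pow]
  rcases Nat.mod_two_eq_zero_or_one (m / 2 ^ i) with h | h <;> simp [h]

theorem bit_eq (m i : ℕ) : bit m i = m.testBit i := by
  rw [bit, bitValue_eq]
  cases m.testBit i <;> rfl

end Evaluation

section BitSets

theorem bitIndices_removeLeast (r : ℕ) : (removeLeast r).bitIndices = r.bitIndices.tail := by
  rw [removeLeast, force_eq]
  change (r &&& (r - 1)).bitIndices = _
  induction r using Nat.binaryRec' with
  | zero => simp
  | bit b r h ih =>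
    cases b with
    | false =>
      have hr : r ≠ 0 := fun h0 => by simpa using h h0
      have : Nat.bit false r &&& (Nat.bit false r - 1) = 2 * (r &&& (r - 1)) := by
        have : Nat.bit false r - 1 = Nat.bit true (r - 1) := by
          simp [Nat.bit_val]; omega
        rw [this, Nat.land_bit]
        simp [Nat.bit_val]
      rw [this, Nat.bitIndices_two_mul, ih, Nat.bit_false_apply, Nat.bitIndices_two_mul,
        List.map_tail]
    | true =>
      have : Nat.bit true r &&& (Nat.bit true r - 1) = 2 * r := by
        have : Nat.bit true r - 1 = Nat.bit false r := by simp [Nat.bit_val]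
        rw [this, Nat.land_bit]
        simp [Nat.bit_val]
      rw [this, Nat.bitIndices_two_mul, Nat.bit_true_apply, Nat.bitIndices_two_mul_add_one]
      rfl

theorem bitIndices_eq_nil {r : ℕ} : r.bitIndices = [] ↔ r = 0 :=
  ⟨fun h => by simpa [h] using (Nat.sum_map_two_pow_bitIndices r).symm, fun h => by simp [h]⟩

theorem isTriple_iff (r : ℕ) : isTriple r = true ↔ r.bitIndices.length = 3 := by
  have h : isTriple r = true ↔
      removeLeast (removeLeast r) ≠ 0 ∧ removeLeast (removeLeast (removeLeast r)) = 0 := by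
    simp [isTriple]
  rw [h, ← bitIndices_eq_nil, ne_eq, ← bitIndices_eq_nil]
  simp only [bitIndices_removeLeast]
  rcases r.bitIndices with _ | ⟨a, _ | ⟨b, _ | ⟨c, _ | ⟨d, l⟩⟩⟩⟩ <;> simp

theorem isTriple_iff_card {n r : ℕ} (h : ∀ k, r.testBit k = true → k < n) :
    isTriple r = true ↔ ((Finset.range n).filter fun k => r.testBit k = true).card = 3 := by
  have : ((Finset.range n).filter fun k => r.testBit k = true) = r.bitIndices.toFinset := by
    ext k
    simpa using h k
  rw [isTriple_iff, this, List.toFinset_card_of_nodup Nat.bitIndices_nodup]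

end BitSets

section Masks

/-- The neighbours of `v` in the graph on `n` vertices with adjacency mask `m`. -/
def neighbors (n m v : ℕ) : Finset ℕ :=
  (Finset.range n).filter fun w => m.testBit (pairIndex v w) = true

theorem mem_neighbors {n m v w : ℕ} :
    w ∈ neighbors n m v ↔ w < n ∧ m.testBit (pairIndex v w) = true := by
  simp [neighbors]

theorem pairIndex_eq (a b : ℕ) : pairIndex a b = 16 * a + b := rfl

theorem pairIndex_inj {a b c d : ℕ} (hb : b < 16) (hd : d < 16)
    (h : pairIndex a b = pairIndex c d) : a = c ∧ b = d := by
  rw [pairIndex_eq, pairIndex_eq] at h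
  omega

theorem testBit_neighborBits (n m v w : ℕ) :
    (neighborBits n m v).testBit w = true ↔ w ∈ neighbors n m v := by
  change ((m >>> pairIndex v 0) &&& full n).testBit w = true ↔ _
  rw [Nat.testBit_and, testBit_full, Nat.testBit_shiftRight, mem_neighbors]
  simp [pairIndex_eq, and_comm]

theorem isTriple_neighborBits (n m v : ℕ) :
    isTriple (neighborBits n m v) = true ↔ (neighbors n m v).card = 3 := by
  rw [isTriple_iff_card (n := n) fun k hk =>
    (mem_neighbors.mp ((testBit_neighborBits n m v k).mp hk)).1]
  simp only [testBit_neighborBits]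
  rw [Finset.filter_mem_eq_inter, neighbors, Finset.inter_eq_right.mpr (Finset.filter_subset _ _)]

theorem testBit_cubicVertices (n m v : ℕ) :
    (cubicVertices n m).testBit v = true ↔ v < n ∧ (neighbors n m v).card = 3 := by
  rw [cubicVertices, testBit_union]
  simp only [pick_eq, isTriple_neighborBits]
  constructor
  · rintro ⟨i, hi, h⟩
    split_ifs at h with h3
    · obtain rfl : i = v := by
        change (2 ^ i).testBit v = true at h
        simpa [Nat.testBit_two_pow] using h
      exact ⟨hi, h3⟩
    · simp at h
  · rintro ⟨hv, h⟩
    refine ⟨v, hv, ?_⟩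
    rw [if_pos h]
    exact Nat.testBit_two_pow_self

theorem isCubicMask_iff (n m : ℕ) :
    isCubicMask n m = true ↔ ∀ v < n, (neighbors n m v).card = 3 := by
  rw [isCubicMask, Nat.beq_eq]
  constructor
  · intro h v hv
    have : (full n).testBit v = true := by simp [testBit_full, hv]
    rw [← h, testBit_cubicVertices] at this
    exact this.2
  · intro h
    refine Nat.eq_of_testBit_eq fun v => ?_
    rw [Bool.eq_iff_iff, testBit_cubicVertices, testBit_full]
    simpa using h v

theorem testBit_addEdge {m a b i : ℕ} : (addEdge m a b).testBit i = true ↔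
    m.testBit i = true ∨ i = pairIndex a b ∨ i = pairIndex b a := by
  change ((m ||| 2 ^ pairIndex a b) ||| 2 ^ pairIndex b a).testBit i = true ↔ _
  simp only [Nat.testBit_or, Nat.testBit_two_pow, Bool.or_eq_true, decide_eq_true_eq, or_assoc,
    eq_comm (a := i)]

theorem testBit_edgeMask {E : List (ℕ × ℕ)} {i : ℕ} : (edgeMask E).testBit i = true ↔
    ∃ e ∈ E, i = pairIndex e.1 e.2 ∨ i = pairIndex e.2 e.1 := by
  induction E with
  | nil => simp [edgeMask]
  | cons e E ih =>
    change (addEdge (edgeMask E) e.1 e.2).testBit i = true ↔ _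
    rw [testBit_addEdge, ih]
    simp only [List.mem_cons, exists_eq_or_imp]
    grind

theorem edgeList_lt (k c : ℕ) : ∀ e ∈ edgeList k c, e.1 < 16 ∧ e.2 < 16 := by
  induction k generalizing c with
  | zero => simp [edgeList]
  | succ k ih =>
    change ∀ e ∈ pick (Nat.beq c 0) [] (force (c % 256) fun e =>
      (e / 16, e % 16) :: force (c / 256) (edgeList k)), _
    simp only [pick_eq, force_eq]
    split_ifs
    · simp
    · intro e he
      rcases List.mem_cons.mp he with rfl | he
      · simp only; omega
      · exact ih _ e he

theorem entryEdges_lt (T : List (List Entry)) (i : ℕ) :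
    ∀ e ∈ entryEdges T i, e.1 < 16 ∧ e.2 < 16 := by
  rw [entryEdges, force_eq]
  exact edgeList_lt _ _

theorem relabel_lt (p a : ℕ) : relabel p a < 16 :=
  Nat.lt_succ_of_le Nat.and_le_right

theorem relabel_of_isPerm {n p : ℕ} (h : isPerm n p = true) :
    Set.InjOn (relabel p) (Set.Iio n) ∧ ∀ a < n, relabel p a < n := by
  rw [isPerm, Nat.beq_eq] at h
  have hbit (b : ℕ) : (∃ a < n, relabel p a = b) ↔ b < n := by
    have := testBit_union (fun a => Nat.pow 2 (relabel p a)) n b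
    rw [h, testBit_full, decide_eq_true_eq] at this
    rw [this]
    change _ ↔ ∃ i < n, (2 ^ relabel p i).testBit b = true
    simp [Nat.testBit_two_pow]
  have himage : (Finset.range n).image (relabel p) = Finset.range n := by
    ext b
    simpa using hbit b
  refine ⟨?_, fun a ha => (hbit _).mp ⟨a, ha, rfl⟩⟩
  have := Finset.card_image_iff.mp (congrArg Finset.card himage)
  simpa using this

end Masks

section Embeddings

variable {n : ℕ} {G : SimpleGraph (Fin n)} {E : List (ℕ × ℕ)} {f : ℕ → Fin n}

/-- `f` embeds the graph on `{0, …, n - 1}` with edges `E` into `G`. -/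
def IsEmbedding (G : SimpleGraph (Fin n)) (E : List (ℕ × ℕ)) (f : ℕ → Fin n) : Prop :=
  Set.InjOn f (Set.Iio n) ∧ ∀ e ∈ E, G.Adj (f e.1) (f e.2)

theorem exists_lt_apply_eq (hf : Set.InjOn f (Set.Iio n)) (x : Fin n) : ∃ w < n, f w = x := by
  have hinj : Function.Injective fun i : Fin n => f i := fun i j h => Fin.ext (hf i.2 j.2 h)
  obtain ⟨w, hw⟩ := Finite.injective_iff_surjective.mp hinj x
  exact ⟨w, w.2, hw⟩

theorem testBit_edgeMask_pairIndex (hE : ∀ e ∈ E, e.1 < 16 ∧ e.2 < 16) {a b : ℕ} (hb : b < 16) :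
    (edgeMask E).testBit (pairIndex a b) = true ↔ (a, b) ∈ E ∨ (b, a) ∈ E := by
  rw [testBit_edgeMask]
  constructor
  · rintro ⟨⟨c, d⟩, he, h | h⟩
    · obtain ⟨rfl, rfl⟩ := pairIndex_inj hb (hE _ he).2 h
      exact .inl he
    · obtain ⟨rfl, rfl⟩ := pairIndex_inj hb (hE _ he).1 h
      exact .inr he
  · rintro (h | h)
    · exact ⟨_, h, .inl rfl⟩
    · exact ⟨_, h, .inr rfl⟩

theorem IsEmbedding.adj (h : IsEmbedding G E f) (hE : ∀ e ∈ E, e.1 < 16 ∧ e.2 < 16) {a b : ℕ}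
    (hb : b < 16) (hab : (edgeMask E).testBit (pairIndex a b) = true) : G.Adj (f a) (f b) := by
  rcases (testBit_edgeMask_pairIndex hE hb).mp hab with he | he
  · exact h.2 _ he
  · exact (h.2 _ he).symm

theorem IsEmbedding.image_subset (h : IsEmbedding G E f) (hE : ∀ e ∈ E, e.1 < 16 ∧ e.2 < 16)
    (hn : n ≤ 16) (v : ℕ) : f '' neighbors n (edgeMask E) v ⊆ G.neighborSet (f v) := by
  rintro _ ⟨w, hw, rfl⟩
  obtain ⟨hwn, hvw⟩ := mem_neighbors.mp hw
  exact h.adj hE (hwn.trans_le hn) hvw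

theorem IsEmbedding.ncard_image (h : IsEmbedding G E f) (m v : ℕ) :
    (f '' neighbors n m v).ncard = (neighbors n m v).card := by
  rw [Set.InjOn.ncard_image (h.1.mono fun w hw => (mem_neighbors.mp hw).1),
    Set.ncard_coe_finset]

theorem IsEmbedding.image_eq (h : IsEmbedding G E f) (hE : ∀ e ∈ E, e.1 < 16 ∧ e.2 < 16)
    (hn : n ≤ 16) (hG : ∀ v, (G.neighborSet v).ncard = 3) {v : ℕ}
    (hv : (neighbors n (edgeMask E) v).card = 3) :
    f '' neighbors n (edgeMask E) v = G.neighborSet (f v) :=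
  Set.eq_of_subset_of_ncard_le (h.image_subset hE hn v) (by rw [h.ncard_image, hv, hG])

theorem IsEmbedding.testBit_of_adj (h : IsEmbedding G E f) (hE : ∀ e ∈ E, e.1 < 16 ∧ e.2 < 16)
    (hn : n ≤ 16) (hG : ∀ v, (G.neighborSet v).ncard = 3) {v w : ℕ}
    (hv : (neighbors n (edgeMask E) v).card = 3) (hw : w < n) (hvw : G.Adj (f v) (f w)) :
    (edgeMask E).testBit (pairIndex v w) = true := by
  have : f w ∈ f '' neighbors n (edgeMask E) v := by rwa [h.image_eq hE hn hG hv]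
  obtain ⟨u, hu, huw⟩ := this
  obtain ⟨hun, huv⟩ := mem_neighbors.mp hu
  rwa [h.1 hun hw huw] at huv

theorem IsEmbedding.exists_new_edge (h : IsEmbedding G E f)
    (hE : ∀ e ∈ E, e.1 < 16 ∧ e.2 < 16) (hn : n ≤ 16) (hG : ∀ v, (G.neighborSet v).ncard = 3)
    {v : ℕ} (hvn : v < n) (hv : (neighbors n (edgeMask E) v).card ≠ 3) :
    ∃ w < n, G.Adj (f v) (f w) ∧ (edgeMask E).testBit (pairIndex v w) = false ∧
      (neighbors n (edgeMask E) w).card ≠ 3 := by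
  have hsub := h.image_subset hE hn v
  have hne : f '' neighbors n (edgeMask E) v ≠ G.neighborSet (f v) := fun heq => hv <| by
    rw [← h.ncard_image, heq, hG]
  obtain ⟨x, hx, hx'⟩ := Set.exists_of_ssubset (hsub.ssubset_of_ne hne)
  obtain ⟨w, hw, rfl⟩ := exists_lt_apply_eq h.1 x
  have hbit : (edgeMask E).testBit (pairIndex v w) = false := by
    rw [← Bool.not_eq_true]
    exact fun hvw => hx' ⟨w, mem_neighbors.mpr ⟨hw, hvw⟩, rfl⟩
  refine ⟨w, hw, hx, hbit, fun hw3 => ?_⟩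
  have := h.testBit_of_adj hE hn hG hw3 hvn (G.adj_symm hx)
  rw [testBit_edgeMask_pairIndex hE (by omega), or_comm,
    ← testBit_edgeMask_pairIndex hE (by omega), hbit] at this
  exact Bool.false_ne_true this

theorem IsEmbedding.adj_addEdge (h : IsEmbedding G E f) (hE : ∀ e ∈ E, e.1 < 16 ∧ e.2 < 16)
    {v w a b : ℕ} (hv : v < 16) (hw : w < 16) (hvw : G.Adj (f v) (f w)) (hb : b < 16)
    (hab : (addEdge (edgeMask E) v w).testBit (pairIndex a b) = true) : G.Adj (f a) (f b) := by
  rcases testBit_addEdge.mp hab with hab | hab | hab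
  · exact h.adj hE hb hab
  · obtain ⟨rfl, rfl⟩ := pairIndex_inj hb hw hab
    exact hvw
  · obtain ⟨rfl, rfl⟩ := pairIndex_inj hb hv hab
    exact hvw.symm

theorem exists_of_hasCertificate {T : List (List Entry)} {i m v w L : ℕ}
    (h : hasCertificate n T i m v w L = true) : ∃ j < i, ∃ p, isPerm n p = true ∧
      mapsEdges p (addEdge m v w) (entryEdges T j) = true := by
  have aux (t : ℕ) : ∀ L, Nat.rec (motive := fun _ => ℕ → Bool) (fun _ => false)
      (fun _ ih L => pick (Nat.beq (L.land 15) w)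
        (force ((L.shiftRight 4).land 4095) fun j => pick (Nat.ble i j) false <|
          force ((L.shiftRight 16).land 281474976710655) fun p => pick (isPerm n p)
            (force (addEdge m v w) fun m' => mapsEdges p m' (entryEdges T j)) false)
        (force (L.shiftRight 64) ih)) t L = true →
      ∃ j < i, ∃ p, isPerm n p = true ∧
        mapsEdges p (addEdge m v w) (entryEdges T j) = true := by
    induction t with
    | zero => simp
    | succ t ih =>
      intro L hL
      simp only [pick_eq, force_eq] at hL ih
      split_ifs at hL with _ hij hp
      · refine ⟨_, ?_, _, hp, hL⟩
        rwa [Nat.ble_eq, not_le] at hij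
      · exact ih _ hL
  exact aux 12 L h

theorem IsEmbedding.exists_earlier {T : List (List Entry)} {i : ℕ}
    (hi : checkEntry n T i = true) (h : IsEmbedding G (entryEdges T i) f) (hn : n ≤ 16)
    (hG : ∀ v, (G.neighborSet v).ncard = 3) :
    isCubicMask n (edgeMask (entryEdges T i)) = true ∨
      ∃ j < i, ∃ g, IsEmbedding G (entryEdges T j) g := by
  refine or_iff_not_imp_left.mpr fun hcubic => ?_
  have hE := entryEdges_lt T i
  simp only [checkEntry, force_eq, pick_eq, bit_eq, testBit_cubicVertices, if_neg hcubic] at hi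
  split_ifs at hi with hv hv3
  rw [Nat.ble_eq, not_le] at hv
  obtain ⟨w, hw, hadj, hbit, hw3⟩ := h.exists_new_edge hE hn hG hv fun h3 => hv3 ⟨hv, h3⟩
  have hcert := allBelow_iff.mp hi w hw
  rw [if_neg, if_neg (by simp [hbit]), if_neg fun h3 => hw3 h3.2] at hcert
  · obtain ⟨j, hj, p, hp, hmaps⟩ := exists_of_hasCertificate hcert
    obtain ⟨hinj, hlt⟩ := relabel_of_isPerm hp
    refine ⟨j, hj, f ∘ relabel p, h.1.comp hinj hlt, fun e he => ?_⟩
    refine h.adj_addEdge hE (by omega) (by omega) hadj (relabel_lt _ _) ?_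
    rw [← bit_eq]
    exact all_iff.mp hmaps e he
  · rw [Nat.beq_eq]
    rintro rfl
    exact G.irrefl hadj

theorem IsEmbedding.exists_cubic {T : List (List Entry)} {N i : ℕ}
    (hT : checkTable n T N = true) (hi : i < N) (h : IsEmbedding G (entryEdges T i) f)
    (hn : n ≤ 16) (hG : ∀ v, (G.neighborSet v).ncard = 3) :
    ∃ j < N, isCubicMask n (edgeMask (entryEdges T j)) = true ∧
      ∃ g, IsEmbedding G (entryEdges T j) g := by
  induction i using Nat.strong_induction_on generalizing f with
  | h i ih =>
    rcases h.exists_earlier (allBelow_iff.mp hT i hi) hn hG with hc | ⟨j, hj, g, hg⟩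
    · exact ⟨i, hi, hc, f, h⟩
    · exact ih j hj (hj.trans hi) hg

theorem exists_embedding_of_code_eq_zero [NeZero n] (G : SimpleGraph (Fin n))
    {T : List (List Entry)} {i : ℕ} (hi : (entry T i).1 = 0) :
    ∃ f, IsEmbedding G (entryEdges T i) f := by
  have : entryEdges T i = [] := by rw [entryEdges, hi]; rfl
  refine ⟨Fin.ofNat n, fun a ha b hb hab => ?_, by simp [this]⟩
  simpa [Fin.ext_iff, Nat.mod_eq_of_lt ha, Nat.mod_eq_of_lt hb] using hab

theorem IsEmbedding.adj_iff (h : IsEmbedding G E f) (hE : ∀ e ∈ E, e.1 < 16 ∧ e.2 < 16)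
    (hn : n ≤ 16) (hG : ∀ v, (G.neighborSet v).ncard = 3)
    (hc : isCubicMask n (edgeMask E) = true) {a b : ℕ} (ha : a < n) (hb : b < n) :
    G.Adj (f a) (f b) ↔ (edgeMask E).testBit (pairIndex a b) = true :=
  ⟨h.testBit_of_adj hE hn hG ((isCubicMask_iff n _).mp hc a ha) hb, h.adj hE (by omega)⟩

/-- The permutation of `Fin n` given by an embedding. -/
noncomputable def IsEmbedding.equiv (h : IsEmbedding G E f) : Fin n ≃ Fin n :=
  Equiv.ofBijective (fun i => f i) <| Finite.injective_iff_bijective.mp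
    fun i j hij => Fin.ext (h.1 i.2 j.2 hij)

theorem IsEmbedding.equiv_apply (h : IsEmbedding G E f) (i : Fin n) : h.equiv i = f i := rfl

theorem IsEmbedding.nonempty_iso {H : SimpleGraph (Fin n)} {g : ℕ → Fin n}
    (h : IsEmbedding G E f) (h' : IsEmbedding H E g) (hE : ∀ e ∈ E, e.1 < 16 ∧ e.2 < 16)
    (hn : n ≤ 16) (hG : ∀ v, (G.neighborSet v).ncard = 3)
    (hH : ∀ v, (H.neighborSet v).ncard = 3) (hc : isCubicMask n (edgeMask E) = true) :
    Nonempty (G ≃g H) := by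
  refine ⟨⟨h.equiv.symm.trans h'.equiv, fun {x y} => ?_⟩⟩
  obtain ⟨a, rfl⟩ := h.equiv.surjective x
  obtain ⟨b, rfl⟩ := h.equiv.surjective y
  simp only [Equiv.trans_apply, Equiv.symm_apply_apply]
  simp only [equiv_apply]
  rw [h.adj_iff hE hn hG hc a.2 b.2, h'.adj_iff hE hn hH hc a.2 b.2]

end Embeddings

section Spectrum

theorem trace_pow_eq_sum_eigenvalues {ι : Type*} [Fintype ι] [DecidableEq ι] {A : Matrix ι ι ℝ}
    (hA : A.IsHermitian) (k : ℕ) : (A ^ k).trace = ∑ i, hA.eigenvalues i ^ k := by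
  conv_lhs => rw [hA.spectral_theorem, ← map_pow, Unitary.conjStarAlgAut_apply,
    Matrix.trace_mul_cycle]
  simp [Matrix.diagonal_pow, Matrix.trace]

theorem trace_pow_eq_of_charpoly_eq {ι : Type*} [Fintype ι] [DecidableEq ι]
    {A B : Matrix ι ι ℝ} (hA : A.IsHermitian) (hB : B.IsHermitian)
    (h : A.charpoly = B.charpoly) (k : ℕ) : (A ^ k).trace = (B ^ k).trace := by
  rw [trace_pow_eq_sum_eigenvalues hA, trace_pow_eq_sum_eigenvalues hB,
    (hA.eigenvalues_eq_eigenvalues_iff hB).mpr h]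

theorem adjMat_apply {n : ℕ} (G : SimpleGraph (Fin n)) [DecidableRel G.Adj] (i j : Fin n) :
    adjMat G i j = if G.Adj i j then 1 else 0 := by
  rw [adjMat, @SimpleGraph.adjMatrix_apply]
  congr

theorem isHermitian_adjMat {n : ℕ} (G : SimpleGraph (Fin n)) : (adjMat G).IsHermitian := by
  classical
  ext i j
  simp [adjMat_apply, G.adj_comm]

/-- The adjacency matrix of the graph on `n` vertices with adjacency mask `m`. -/
def maskMatrix (n m : ℕ) : Matrix (Fin n) (Fin n) ℕ :=
  Matrix.of fun i j => bitValue m (pairIndex i j)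

theorem IsEmbedding.trace_pow {n : ℕ} {G : SimpleGraph (Fin n)} {E : List (ℕ × ℕ)} {f : ℕ → Fin n}
    (h : IsEmbedding G E f) (hE : ∀ e ∈ E, e.1 < 16 ∧ e.2 < 16)
    (hn : n ≤ 16) (hG : ∀ v, (G.neighborSet v).ncard = 3)
    (hc : isCubicMask n (edgeMask E) = true) (k : ℕ) :
    (adjMat G ^ k).trace = ((maskMatrix n (edgeMask E) ^ k).trace : ℕ) := by
  have hmap : (adjMat G).reindex h.equiv.symm h.equiv.symm =
      (maskMatrix n (edgeMask E)).map (Nat.castRingHom ℝ) := by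
    classical
    ext i j
    simp only [Matrix.reindex_apply, Equiv.symm_symm, Matrix.submatrix_apply, Matrix.map_apply,
      adjMat_apply, equiv_apply, h.adj_iff hE hn hG hc i.2 j.2]
    cases h : (edgeMask E).testBit (pairIndex i j) <;> simp [maskMatrix, bitValue_eq, h]
  have hpow : (adjMat G ^ k).reindex h.equiv.symm h.equiv.symm =
      (maskMatrix n (edgeMask E) ^ k).map (Nat.castRingHom ℝ) := by
    have h1 := map_pow (Matrix.reindexAlgEquiv ℝ ℝ h.equiv.symm) (adjMat G) k
    have h2 := map_pow (Nat.castRingHom ℝ).mapMatrix (maskMatrix n (edgeMask E)) k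
    simp only [Matrix.coe_reindexAlgEquiv, RingHom.mapMatrix_apply] at h1 h2
    rw [h1, h2, hmap]
  have htrace := congrArg Matrix.trace hpow
  rw [Matrix.trace, Matrix.trace] at htrace
  simp only [Matrix.diag_apply, Matrix.reindex_apply, Equiv.symm_symm, Matrix.submatrix_apply,
    Matrix.map_apply] at htrace
  rw [h.equiv.sum_comp fun i => (adjMat G ^ k) i i] at htrace
  rw [Matrix.trace, Matrix.trace]
  simpa using htrace

end Spectrum

section Codes

theorem maskedSum_ofFn (m s n : ℕ) (R : Fin n → ℕ) :
    maskedSum m (List.ofFn R) s = ∑ i : Fin n, bitValue m (s + i) * R i := by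
  induction n generalizing s with
  | zero => simp [maskedSum]
  | succ n ih =>
    rw [List.ofFn_succ, Fin.sum_univ_succ]
    change bitValue m s * R 0 + maskedSum m (List.ofFn fun i => R i.succ) (s + 1) = _
    rw [ih]
    simp [add_assoc, add_comm 1]

theorem diagonalSum_ofFn (s n : ℕ) (R : Fin n → ℕ) :
    diagonalSum (List.ofFn R) s = ∑ i, R i / base ^ (s + i) % base := by
  induction n generalizing s with
  | zero => simp [diagonalSum]
  | succ n ih =>
    rw [List.ofFn_succ, Fin.sum_univ_succ]
    change R 0 / base ^ s % base + diagonalSum (List.ofFn fun i => R i.succ) (s + 1) = _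
    rw [ih]
    simp [add_assoc, add_comm 1]

theorem sum_mul_pow_div_mod {b n : ℕ} (d : Fin n → ℕ) (hd : ∀ i, d i < b) (i : Fin n) :
    (∑ j, d j * b ^ (j : ℕ)) / b ^ (i : ℕ) % b = d i := by
  have hb : 0 < b := (Nat.zero_le _).trans_lt (hd i)
  induction n with
  | zero => exact i.elim0
  | succ n ih =>
    have hsum : ∑ j, d j * b ^ (j : ℕ) = d 0 + b * ∑ j : Fin n, d j.succ * b ^ (j : ℕ) := by
      rw [Fin.sum_univ_succ, Finset.mul_sum]
      simp [pow_succ, mul_left_comm, mul_comm]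
    rw [hsum]
    cases i using Fin.cases with
    | zero => simp [Nat.mod_eq_of_lt (hd 0)]
    | succ i =>
      rw [Fin.val_succ, pow_succ', ← Nat.div_div_eq_div_mul, Nat.add_mul_div_left _ _ hb,
        Nat.div_eq_of_lt (hd 0), zero_add]
      exact ih (fun j => d j.succ) (fun j => hd _) i

theorem maskMatrix_pow_le (n m k : ℕ) (i j : Fin n) : (maskMatrix n m ^ k) i j ≤ n ^ k := by
  induction k generalizing i j with
  | zero => rw [pow_zero, Matrix.one_apply, pow_zero]; split_ifs <;> simp
  | succ k ih =>
    rw [pow_succ', Matrix.mul_apply, pow_succ']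
    calc ∑ l, maskMatrix n m i l * (maskMatrix n m ^ k) l j ≤ ∑ _l : Fin n, n ^ k := by
          refine Finset.sum_le_sum fun l _ => ?_
          have : maskMatrix n m i l ≤ 1 := by
            simpa [maskMatrix, bitValue_eq] using Bool.toNat_le _
          simpa using Nat.mul_le_mul this (ih l j)
      _ = n * n ^ k := by simp

/-- The rows of a matrix, packed into single numbers. -/
def packedRows {n : ℕ} (M : Matrix (Fin n) (Fin n) ℕ) : List ℕ :=
  List.ofFn fun i => ∑ j, M i j * base ^ (j : ℕ)

theorem map_range_eq_ofFn (f : ℕ → ℕ) (n : ℕ) :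
    (List.range n).map f = List.ofFn fun i : Fin n => f i := by
  apply List.ext_getElem <;> simp

theorem diagonalSum_packedRows {n : ℕ} {M : Matrix (Fin n) (Fin n) ℕ}
    (hM : ∀ i j, M i j < base) : diagonalSum (packedRows M) 0 = M.trace := by
  rw [packedRows, diagonalSum_ofFn, Matrix.trace]
  refine Finset.sum_congr rfl fun i _ => ?_
  rw [zero_add, sum_mul_pow_div_mod (M i) (hM i), Matrix.diag_apply]

theorem walkCode_succ (n m t : ℕ) (M : Matrix (Fin n) (Fin n) ℕ) :
    walkCode n m (t + 1) (packedRows M) = diagonalSum (packedRows (maskMatrix n m * M)) 0 +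
      1000003 * walkCode n m t (packedRows (maskMatrix n m * M)) := by
  change tabulate (fun i => maskedSum m (packedRows M) (pairIndex i 0)) n
    (fun R => diagonalSum R 0 + 1000003 * walkCode n m t R) [] = _
  rw [tabulate_eq, List.append_nil, map_range_eq_ofFn]
  have : (List.ofFn fun i : Fin n => maskedSum m (packedRows M) (pairIndex i 0)) =
      packedRows (maskMatrix n m * M) := by
    rw [packedRows, packedRows]
    congr 1
    funext i
    rw [maskedSum_ofFn]
    simp only [Matrix.mul_apply, Finset.sum_mul, Finset.mul_sum]
    rw [Finset.sum_comm]
    simp [maskMatrix, pairIndex_eq, mul_assoc]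
  rw [this]

theorem maskCode_eq {n m m' : ℕ} (hn : n ≤ 12)
    (h : ∀ k, (maskMatrix n m ^ k).trace = (maskMatrix n m' ^ k).trace) :
    maskCode n m = maskCode n m' := by
  have hlt (m k : ℕ) (hk : k ≤ 8) (i j : Fin n) : (maskMatrix n m ^ k) i j < base :=
    calc (maskMatrix n m ^ k) i j ≤ n ^ k := maskMatrix_pow_le n m k i j
      _ ≤ 12 ^ k := Nat.pow_le_pow_left hn k
      _ ≤ 12 ^ 8 := Nat.pow_le_pow_right (by norm_num) hk
      _ < base := by norm_num [base]
  have hwalk (t : ℕ) : ∀ k, k + t ≤ 8 → walkCode n m t (packedRows (maskMatrix n m ^ k)) =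
      walkCode n m' t (packedRows (maskMatrix n m' ^ k)) := by
    induction t with
    | zero => exact fun _ _ => rfl
    | succ t ih =>
      intro k hk
      rw [walkCode_succ, walkCode_succ, ← pow_succ', ← pow_succ',
        diagonalSum_packedRows (hlt m _ (by omega)), diagonalSum_packedRows (hlt m' _ (by omega)),
        h, ih _ (by omega)]
  have hcode (m : ℕ) : maskCode n m = walkCode n m 8 (packedRows (maskMatrix n m ^ 0)) := by
    rw [maskCode, tabulate_eq, List.append_nil, map_range_eq_ofFn, packedRows]
    congr 2
    funext i
    rw [pow_zero]
    simp [Matrix.one_apply]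
  rw [hcode, hcode, hwalk 8 0 (by norm_num)]

theorem distinct_iff (l : List ℕ) : distinct l = true ↔ l.Nodup := by
  induction l with
  | nil => simp [distinct]
  | cons x l ih =>
    change pick (all l fun y => pick (Nat.beq y x) false true) (distinct l) false = true ↔ _
    have hx : (all l fun y => pick (Nat.beq y x) false true) = true ↔ x ∉ l := by
      simp only [all_iff, pick_eq, Nat.beq_eq]
      grind
    rw [pick_eq, List.nodup_cons, ← hx, ← ih]
    simp

theorem tabulateCodes_eq {α : Type*} (n : ℕ) (T : List (List Entry)) (N : ℕ) (k : List ℕ → α)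
    (l : List ℕ) : tabulateCodes n T N k l = k ((((List.range N).filter fun i =>
      isCubicMask n (edgeMask (entryEdges T i))).map fun i =>
        maskCode n (edgeMask (entryEdges T i))) ++ l) := by
  induction N generalizing l with
  | zero => rfl
  | succ N ih =>
    change force (edgeMask (entryEdges T N)) (fun m => pick (isCubicMask n m)
      (force (maskCode n m) fun x => tabulateCodes n T N k (x :: l))
      (tabulateCodes n T N k l)) = _
    rw [force_eq, force_eq, pick_eq, ih, ih, List.range_succ, List.filter_append]
    split_ifs with hc <;> simp [hc]

theorem eq_of_maskCode_eq {n : ℕ} {T : List (List Entry)} {N i j : ℕ}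
    (hT : checkCodes n T N = true) (hi : i < N) (hj : j < N)
    (hci : isCubicMask n (edgeMask (entryEdges T i)) = true)
    (hcj : isCubicMask n (edgeMask (entryEdges T j)) = true)
    (h : maskCode n (edgeMask (entryEdges T i)) = maskCode n (edgeMask (entryEdges T j))) :
    i = j := by
  rw [checkCodes, tabulateCodes_eq, distinct_iff, List.append_nil] at hT
  exact List.inj_on_of_nodup_map hT (by simp [hi, hci]) (by simp [hj, hcj]) h

/-- Cospectral cubic graphs are isomorphic if there is a suitable table of partial graphs. -/
theorem nonempty_iso_of_table {n : ℕ} [NeZero n] (hn : n ≤ 12) {T : List (List Entry)} {N i : ℕ}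
    (hT : checkTable n T N = true) (hT' : checkCodes n T N = true) (hi : i < N)
    (hi' : (entry T i).1 = 0) {G H : SimpleGraph (Fin n)}
    (hG : ∀ v, (G.neighborSet v).ncard = 3) (hH : ∀ v, (H.neighborSet v).ncard = 3)
    (hcospec : (adjMat G).charpoly = (adjMat H).charpoly) : Nonempty (G ≃g H) := by
  have hn' : n ≤ 16 := hn.trans (by norm_num)
  obtain ⟨f, hf⟩ := exists_embedding_of_code_eq_zero G hi'
  obtain ⟨g, hg⟩ := exists_embedding_of_code_eq_zero H hi'
  obtain ⟨a, ha, hca, f, hf⟩ := hf.exists_cubic hT hi hn' hG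
  obtain ⟨b, hb, hcb, g, hg⟩ := hg.exists_cubic hT hi hn' hH
  obtain rfl : a = b := eq_of_maskCode_eq hT' ha hb hca hcb <| maskCode_eq hn fun k => by
    have := trace_pow_eq_of_charpoly_eq (isHermitian_adjMat G) (isHermitian_adjMat H) hcospec k
    rw [hf.trace_pow (entryEdges_lt T a) hn' hG hca, hg.trace_pow (entryEdges_lt T b) hn' hH hcb]
      at this
    exact_mod_cast this
  exact hf.nonempty_iso hg (entryEdges_lt T a) hn' hG hH hca

theorem even_of_ncard_neighborSet_eq_three {n : ℕ} {G : SimpleGraph (Fin n)}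
    (hG : ∀ v, (G.neighborSet v).ncard = 3) : Even n := by
  classical
  have h := G.sum_degrees_eq_twice_card_edges
  have hdeg (v : Fin n) : G.degree v = 3 := by
    rw [← hG v, ← SimpleGraph.card_neighborSet_eq_degree, Set.ncard_eq_toFinset_card',
      Set.toFinset_card]
  simp only [hdeg, Finset.sum_const, Finset.card_univ, Fintype.card_fin, smul_eq_mul] at h
  grind

end Codes

/-- Partial cubic graphs on two vertices. -/
def twoTable : List (List Entry) := [
  [(1, 0, 0), (0, 1, 1048576)]]

/-- Partial cubic graphs on four vertices. -/
def fourTable : List (List Entry) := [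
  [(1108153078563, 0, 0), (4346483491, 2, 839909376), (16978451, 3, 839909394),
   (70163, 0, 15493593949817130083456909346), (274, 1, 839909427),
   (1, 1, 10851319392792764411542503490), (0, 1, 183780469424527319762183498281092424114124095568)]]

/-- Partial cubic graphs on six vertices. -/
def sixTable : List (List Entry) := [
  [(285894834987845, 3, 0), (1116776699205, 3, 361617162242), (217304261520073541, 2, 0),
   (848844771562821, 3, 361617162274), (145246667482145605, 2, 0),
   (567369794852165, 3, 361617162306), (4419841430853, 0, 6670659245443169393481530474578),
   (17265071429, 1, 123051943919948167927130372567586967376819039240208),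
   (37110806706903004485, 0, 0), (217318559483901253, 0, 361617162370),
   (1145777370117445, 3, 361617162384), (4475692856645, 2, 6670659247509204729671770636448),
   (17516803397, 1, 118565814517530272993602997493306713155222815899760),
   (68425029, 5, 123051943952615275151540465061841817121344904495216),
   (37110806702591391045, 0, 0), (144964092994860357, 2, 361617162465),
   (566266006156613, 3, 3828063611683539537547729305841),
   (3316052735301, 0, 6670659249261645416654045380817),
   (17517851973, 0, 123051943979837864505215542140387525241508246913233),
   (68433221, 5, 123051943984942100009034261366286426164499398590672),
   (267333, 5, 2269907718569381119797771092196974340815144186573854649920555524882640),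
   (1044, 4, 123051943996851982848741709909465290488014357659970),
   (20, 4, 1405320543633004545609179858097181886912163423066102963550827496603984),
   (0, 1, 34412558215030104730326070168932791135127276927732591258446704799699800769390237848830304)]]

/-- Partial cubic graphs on eight vertices. -/
def eightTable : List (List Entry) := [
  [(622625501755034763323066199, 0, 0), (2432130866230617698551639, 2, 130103989239811),
   (9556860518489703925591, 0, 130103989239827),
   (112127552750413498199, 0, 2399990350200897811467789329760290),
   (437998253200721751, 6, 130103989239858),
   (5652688973154135, 6, 2399994375924448977249226097426496),
   (22080817284951, 6, 44272093404406419005546631117076252393674658888679504),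
   (18982137650100008535895, 2, 0), (74148975195703363415, 2, 130103989239923),
   (289644434358224727, 6, 2399990350202668698898865446715522),
   (1131483718174551, 0, 44272093404429217924069506262874161264200469951021202),
   (2432112419486530801125207, 6, 0), (9500439138619260946263, 3, 130103989239990),
   (2432112419486535129646935, 3, 0), (9500439138619277854551, 3, 130103989240022),
   (37111090385231562583, 2, 2399994992479642246738193564041411),
   (622620779388551893677918039, 0, 0), (2432112419486531104163671, 2, 130103989240070),
   (9500439138619581941591, 3, 130103989240082),
   (37111090385233790807, 6, 2399994992480767498126689595031842),
   (144965196817319767, 4, 44272093404483663102837684148285408355357538298888434),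
   (568533764753239, 0, 43149934178575973723825157045354541320441083701756227),
   (5583811331927, 0, 795969473852203892593441981159762107574297438922585077444760382269817170),
   (86253193047, 5, 14683033564156653540738002123809209414032169208076262545365462615102313800451295556567826784),
   (28704653500729506674007, 0, 0), (370454603511635391831, 0, 130103989240198),
   (2432130866230608855840087, 6, 0), (9501520286259732559191, 0, 130103989240230),
   (14279227001350506427735, 0, 130103989240242),
   (56787320520442131799, 0, 2399994992483774317410704503603634),
   (1447088299313476951, 3, 42027227023402312590367917890879727562729028553015760),
   (622625501755038066118313559, 0, 0), (2446556292733299494045271, 0, 130103989240307),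
   (2432389193284690558404183, 0, 41108323238406),
   (9815187572562563778135, 0, 2399994992484954909031421914907155),
   (370454606823273350743, 2, 2394850191052291687902628501520928),
   (38340576459835655767, 2, 2399994992485840352746681073140195),
   (1447088312416552535, 2, 44272093404570775388764304235779589208527578546045504),
   (5652688720377175, 4, 44272093404581664424510919068042416334300937928966736),
   (622616057022072326844728919, 0, 0)],
  [(2432093972742474556655191, 6, 130103989240434),
   (14242333513216207242839, 0, 2094421855051208016609270295429762),
   (55634115286000813655, 3, 2399994992487611240072615887372898),
   (293883064872158807, 3, 42027227023473091320742813586952443194113936700998304),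
   (1147980722156887, 4, 44272093404614331531735329160537279926571446094004834),
   (22080815314263, 4, 775265501029899033337809450342960685823265275149504920144943078098076352),
   (86253184855, 5, 14683161734814849765935496903733803598534522819338973062217076757171190197518141553443537616),
   (336926551, 7, 14683045174683168895839031959950120543884746038929506322057612902755104099539805997093749472),
   (9815187588015907559015, 2, 0), (370454622276617131623, 2, 130103989240576),
   (2512688017729392407369319, 0, 0), (94836378500134057956967, 2, 130103989240608),
   (9815187571518938175079, 2, 130103989240627),
   (370454605779647747687, 2, 2399994992490507378997608489943872),
   (1447088368302577255, 5, 44272093404645977791858976437643782536931264271876944),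
   (6073333751573879893476967, 2, 95821844513520), (28704653500734019946087, 5, 130103989240688),
   (112127552737494124135, 5, 2399994992491964671776133781521280),
   (437998253166249575, 3, 43149934178760747049063226631028988790331471922594656),
   (5652688938681959, 6, 816675976643383639250155853539499306991468255710058207532550590605296544),
   (622625501755035858522031719, 0, 0), (2432130866230608822486631, 3, 130103989240773),
   (9556860518480827860583, 0, 1767601042411785406840101386847187),
   (934528363215609081521194599, 0, 0), (3655482112344616997439079, 5, 130103989240816),
   (28704653500729473320551, 3, 2091704346980563201684244574241792),
   (112127552741537433191, 2, 2399994992494639449670119429506016),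
   (92671718621445572199, 0, 1318922175471345058074189891830818),
   (437998252897814119, 5, 26317460155266829887936340032631953486738722590295088),
   (5652688670246503, 6, 711778319213682418195529512697390399733353391370158079410838802608948288),
   (22080816367207, 4, 595469614238709604346929237491187612003576103615159242292080099474932816),
   (1710930675513191, 3, 795571393394611717085409462827614793633797104260720965146788920970970208),
   (6683322955623, 6, 816271577444983317703874389575030187707326614211147723557955730985190514),
   (86253188967, 6, 15057552883770793316308777929199506586464196053440804904751406042129225045751135506344707200),
   (336926567, 7, 15065012732274328627101371903803517543553374956063753257514638758227111686233812941780681872),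
   (1316119, 7, 277900434340365293927843498483554410223748100965766308080470288975179368128622329123474753826850934101845869728),
   (5141, 1, 15065012732326435067155042395745097985361984139743475986198892951265443093002983266363507888),
   (21, 1, 235929409667817472837304691130276253857103399101010856792292757052482879417961376376959308851836247037961176256),
   (0, 5, 4351779906260737547951542253655054293890279816225492816537145562059576777543539989394068143774108605336551678782073756786108728528)]]

/-- Partial cubic graphs on ten vertices. -/
def tenTable : List (List Entry) := [
  [(239860672744021091433115440760, 9, 0), (936955955892874964441126520, 9, 42914300449259521),
   (61404332227210428806603020523128, 1, 0),
   (239860729449605390622396077688, 9, 42914300449259553),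
   (61404323708042630792907231680120, 1, 0),
   (239860639705979299243313682040, 9, 42914300449259585),
   (936955974416462862155863672, 2, 791629117489770250539433080313086033),
   (3659984275064308055299704, 4, 14602979731630358060411144776830777457285005974273261665),
   (15719506865575448170499764828853880, 0, 0),
   (61404323693654098357819743491704, 9, 42914300449259650),
   (239860658374012244243341989496, 1, 42914300449259666),
   (936955697643244162474661496, 9, 791610102440626567299027367338442913),
   (3659983193918922509670008, 4, 14602979731630385283000477060303977446805910067550879857),
   (14296813593166164153976, 6, 2343015407557775246063512731837370182119856592445767873),
   (15719506863143429431821897594988920, 0, 0),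
   (61404323684154025159859375597944, 9, 42914300449259746),
   (239860648873939046282974095736, 1, 459377896427237128285413305406718194),
   (936955659663824399543724408, 4, 791629117489774087462199235067248850),
   (3659983193918922510723448, 1, 6941643477563491551071630407005498739238009230918156562),
   (14296809351245791057528, 6, 14602979731630423394625593597015766003914011961877070034),
   (55846928098305332856, 6, 43221005583977263329528101415035792860525533186992971815327601504671498545),
   (218152062884009592, 5, 6941627383561734787116616768616244517768225491022512449),
   (852156797703800, 5, 128050316381079970246814779289164828731433630730165800066030236301334151505),
   (3328737491064, 5, 3405074821598376038920193512015709728912656261180473642986442795784867552592295871241366012257),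
   (61404326111505660443082900264792, 9, 0),
   (239860648873861902287730267992, 1, 42914300449259913),
   (61404326125875746434267884247145, 9, 0),
   (239860649132188677084907264105, 9, 42914300449259937),
   (936955660672612019862919000, 6, 791629117489777334089157384780906897),
   (3659984202706542829918040, 4, 127015119752062197695831568355951041),
   (15719507484545449073429222518118505, 0, 0),
   (61404326111505660443082901379177, 9, 42914300449260004),
   (239860658373935100248150464617, 1, 42914300449260020),
   (239860658576921642824248023145, 9, 42914300449260033),
   (936955697566100167283136617, 9, 791629117489779012742868092350104065),
   (3659984202706542831032425, 6, 791629117489777832151247374938800673),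
   (14296813291822432933720, 6, 14602979731630515951429396092277832764137687484021604913),
   (55846926921466664792, 2, 10006615542290324954313406175793848835599135769951732289),
   (218152062884009816, 2, 184555102020633426292836457947086218627996726314120123860489269718045164113),
   (852156797704024, 5, 3404437266808010580799884704364511144715860985626459551636258707982055425735795244967854604897)],
  [(61404323688913281189071368574825, 4, 0),
   (239860639409817504644810233705, 4, 42914300449260166),
   (936955622694599627518793577, 9, 42914300449260180),
   (3659982901150779794995287, 9, 791629117489781705967500663511319204),
   (14296808207620234491991, 2, 14602979731630559507323192570420299473906921532661170868),
   (61404323688913209131477330646873, 6, 0),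
   (239860639409817223169833523033, 4, 42914300449260246),
   (61404323688913209131477331564905, 6, 0),
   (239860639409817223169834441065, 6, 42914300449260276),
   (936955622694598528007165785, 9, 791629117489783476854933930061595364),
   (15719506864361781537658196645533545, 0, 0),
   (61404323688913209131477331498857, 4, 42914300449260329),
   (239860639409817223169833326167, 6, 42914300449260345),
   (936955622694598528007165527, 6, 376245764947811073826035129983697732),
   (3659982901150775500027991, 5, 14602979731630592174679586382493655680506475472336454420),
   (14296808207620217714775, 2, 14602979731630619397019770655589872274487301187759506117),
   (55846907061017720919, 2, 184555102020635234098136249311146301336672283352325440875226296051290866548),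
   (218151993644365911, 1, 184554914038194706157185753891188526561782921306614117107245514026319348610),
   (239860639465229794459976619865, 4, 0), (936955622911053884609288025, 6, 42914300449260452),
   (61404323703098827381753996790103, 6, 0),
   (239860639465229794459976550743, 4, 42914300449260486),
   (61404323703098827381754013767255, 6, 0),
   (239860639465229794459976816215, 4, 42914300449260518),
   (936955622911053884609284439, 5, 791629117489787904073511620353983444),
   (3659982901996304236755031, 9, 14602234365795634061112262765644812948411617254875071492),
   (61404323703098826537329084553577, 4, 0),
   (239860639465229791161442851177, 6, 42914300449260580),
   (61404323703098826537329083635545, 4, 0),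
   (239860639465229791161441933145, 4, 42914300449260614),
   (936955622911053871724386137, 9, 791629117489789084665132337765286996),
   (15719506867993299593556241064482665, 0, 0),
   (61404323703098826537329066661737, 9, 42914300449260660),
   (239860639465229791161441666647, 6, 42914300449260681),
   (239860639465229791161441667415, 9, 20132166122865814),
   (936955622911053871724381527, 4, 791629117489791206040700814363722902),
   (3659982901996304186423383, 5, 14602979731630706509300829567006616083649743633362453684),
   (14296808210923064342615, 2, 14602979731630679286965518142740309092830312916342277316),
   (61404323703100128656024690644841, 2, 0), (15719506867993318256473096887817815, 0, 0)],
  [(61404323703098903381153071846999, 9, 42914300449260786),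
   (239860639465234877562596447831, 6, 791629117489792386632321531775026434),
   (936955622911073740478895703, 4, 791629117489793272044511872559351058),
   (15719506867993281146812167406114665, 0, 0),
   (61404323703098759265965047175017, 6, 42914300449260850),
   (239860639465229528382675965527, 9, 791629117489794102165748720195339554),
   (936955622911052845244831319, 4, 791629117489794452667657787244807462),
   (3659982901996381798749783, 4, 3875510985532507009099251057643877416840533220443293026),
   (14296808210923366405719, 5, 3875510985532458008438414442505140129743100795165869266),
   (55846907073919400023, 5, 71490559304967133598893013803138917689612821043762716118033308428897617106),
   (218151980759464023, 1, 269377429822961342031258857054286063151051297623397150388202700116228834708),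
   (852156277536855, 1, 3404437266808106919818130151439108778324032058595774380546580697797091845987343540102680806818),
   (3328737491031, 8, 62800782707039055030195763494421695024502361724983713732214951381178687579467765637367052433099351128095010588081),
   (13002880824, 7, 1158524458721541913213365913870307659972118097579756007198600524371153964471640677280372864569981599879898737712168159523272059258305),
   (239860639391226943359786965369, 6, 41702781190473172),
   (936955622622000043506817401, 2, 791629117489797053658569989858264548),
   (3659982900904575863642489, 1, 42914300449261046),
   (14296808809195669838201, 1, 791548146926678085444052074529555970),
   (55846948998137534841, 1, 14602234365795813730201997021153532807377993961632171538),
   (61404326106746400773340847954297, 2, 0),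
   (239860648854478147816586238329, 2, 42914300449261110),
   (936955659587805264909719929, 4, 42914300449261126),
   (3659983045264950234208633, 4, 791547989089324552297592921655346770),
   (14296809054381964548473, 1, 14602234365795840952791350696230611353086114399853217378),
   (61404323693617200084546181683577, 4, 0),
   (239860639428192187830259702137, 6, 42914300449261188),
   (61404323693617127745477167044985, 4, 0),
   (239860639428191905255771363705, 6, 42914300449261220),
   (936955622766375811040172409, 2, 791629117489800300285529153172670132),
   (61404323693617133094652775782777, 2, 41685189004494294),
   (239860639428191926150988585337, 4, 42914300449261270),
   (936955622766396706257394041, 4, 791547989089327208628739535830779618),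
   (3659982901431237135063417, 5, 14601483176790248619093976509251665835099393505130186434),
   (14296808209957034416505, 1, 14602979731630934158458341925649451110957975079549404932),
   (55846912709455534457, 1, 269363572831625984856990691514914739555938703390588296412575253181045409554),
   (218152144524040569, 7, 4968880881698769241873017481905942723797592603445501046520848929034813807088291924050179000097),
   (239860648854478710766555453529, 2, 0), (936955659587827259671140441, 2, 42914300449261382),
   (61404323684172467118806907050073, 6, 0),
   (239860639391298719478578763865, 2, 42914300449261414)],
  [(61404323684172544244110201346137, 6, 0),
   (239860639391304068662811842649, 2, 42914300449261446),
   (936955622622281518214109273, 5, 791629117489805022652012022817884018),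
   (3659983045864188600211545, 1, 14601483176790324842344166799467483420345633371036059554),
   (61404323688894761544082514335833, 6, 0),
   (239860639409745182077311604825, 2, 42914300449261510),
   (61404323688894910726975517186137, 2, 0),
   (239860639409750812732192020569, 2, 42914300449261542),
   (936955622694339112252037209, 4, 791629117489806793539443098934839250),
   (3659983117921782638139481, 1, 14601483176790357509451391209559977656748633823191762946),
   (61404323693617277209840867432537, 6, 0),
   (239860639428197556801606604889, 2, 42914300449261606),
   (61404323693617127745477182838873, 6, 0), (15719506865566003221643822224726105, 0, 0),
   (61404323693617205152251124471897, 2, 42914300449261654),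
   (239860639428192207625997867097, 4, 791629117489808859574779354404620354),
   (936955622766396706289965145, 5, 14601483176790395621076486354667887915887907616054052978),
   (3659983189979376676067417, 1, 14602979731631026374979777499973055569987950792514996354),
   (14296809653620330551385, 1, 269377429822966144018682792054410811412026374619383042693326493669485709458),
   (55846948997868116057, 7, 269349822765176881668418960335875109569097284416305782806216848390392645793),
   (61404323693617128308427102705753, 6, 0),
   (239860639447576263372120348761, 1, 42914300449261766),
   (61404328534282725037959746771033, 6, 0),
   (239860663299360465866646444121, 1, 42914300449261798),
   (936955716013426990962530393, 2, 791629117489811515905925968580053201),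
   (61404323698616416911410177071193, 1, 42617432057120214),
   (239860663336330797833775568985, 2, 42914300449261841),
   (936955716234385998748407897, 6, 791629117489812327562665211784595745),
   (3659983266540570307811417, 4, 14602979731631124716583817651189002646462019192502618369),
   (61404329804636279261865784531033, 1, 0), (15719506863148170101216231657199705, 0, 0),
   (61404326116468056140672872634457, 1, 42914300449261922),
   (239860663336330797838121719897, 4, 791629117489813213006380749858802033),
   (936955716234386003094558809, 6, 791629117489814098450096287901550977),
   (15719507484536004412803656048859225, 0, 0),
   (61404326116431085808701465319513, 1, 42914300449261990),
   (239860648892309229111478736985, 2, 791629117489815057680456141064177105),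
   (936955716013426991030491225, 4, 791629117489814467384977762108312001),
   (3659983266540570375772249, 4, 14602979731631157383691042061281498967347099973837654481),
   (14296809634924103030873, 5, 269377429822968253124865881979147563342471485893938230756086085209473157297)],
  [(55846912709454551129, 7, 269349823258830357970963862907102513161548633687332495416469051639273097714),
   (218152144523057241, 7, 4968627246848285473541286188071082813170054060184730541362339600147623976657426622858826615297),
   (852156814547033, 9, 4969136507177870704077777369441148538126674361828937506541023156269891365479614054740411812369),
   (239860658595513347614701996376, 6, 0), (936955974484579754963323224, 1, 42914300449262134),
   (61404323693654093854168559602008, 6, 0),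
   (239860639484541809113577245016, 1, 42914300449262166),
   (61404328543745904747772746615128, 1, 0),
   (239860672762540175679646288216, 6, 42914300449262193),
   (936955752978972732419426648, 2, 791629117489818894603555452400700001),
   (3659984275346886838667608, 9, 14601109011319520556124122956265128276828648088808721041),
   (61404323684209360888429269178473, 6, 0), (15719506865575448026667151241205865, 0, 0),
   (61404323708042703133075757815913, 1, 42914300449262278),
   (239860639484541809113577248873, 4, 791629117489820370343081349164829361),
   (936955752978972732419430505, 2, 14601109011319547778707677055243327950258849255351388897),
   (3659984275346886838671465, 9, 14602979731631249259930110556829282906527888833218874097),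
   (14296813575573776713560, 9, 269377429822970060930165673343207667829576789260082917899663776168152140545),
   (15719506865575447954609557220186215, 0, 0),
   (61404323708042631075481736796263, 1, 42914300449262374),
   (239860639484546595339266250855, 2, 42914300449262390),
   (936955752983758958108432487, 2, 626023228321066918970339220595411777),
   (3659984280133112527673447, 9, 7992693061215822552843265526896370907475090263891774289),
   (61404328595692157018346647742313, 1, 0),
   (239860724708792446253547415401, 6, 42914300449262449),
   (15719506863143429432104472049903465, 0, 0),
   (61404323693875747799654915925865, 4, 42914300449262481),
   (239860639706195754599933568873, 6, 418354370283141305390842665409448865),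
   (936955974632918218775750505, 2, 7993441338636192545280306387389795214295178752979635121),
   (15719506865575429435807889473693545, 0, 0),
   (61404328543727390732330689128297, 2, 42914300449262545),
   (239860672744026160237588801385, 6, 522017497426969986199455580719942625),
   (61404323708043928406847831697257, 1, 0),
   (239860672763842293271430195049, 1, 42914300449262594),
   (15719506863157596315380298871760745, 0, 0),
   (61404323684209365674654959167337, 6, 42914300449262626),
   (239860648929279561078557665129, 1, 433325322959099803742298106250660914),
   (936955752983758958109419369, 4, 14602979731631375164405871461898125562124632403504794689),
   (3659984280133112528660329, 9, 14602979731631314594144559534851628196000794010704677969),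
   (3659983410092808430114919, 9, 14602979731631402386995225136975200012645116786143399010)],
  [(14296813594269970815079, 9, 269377429822972270469976529454836603361625941331618535990869784206890765425),
   (55846928102617073496, 7, 203784952927958862119746542444888353041416839224718286981876632961748569217),
   (14296809632725079513191, 9, 142372418515006488536478928417881380119824250321403933940863854179634056337),
   (55846912627832341848, 7, 203784952927958862119746542444888363930452580694749124930307288719214775442),
   (218152062900847960, 7, 3759168872735005078461741381607250939944040969955546602669927686436216867203662679802802867377),
   (852156495706456, 5, 4969136507177958011256757800181731392008173284092261803742605902814136276473984086302301097153),
   (3328737556824, 5, 91664389415238777739186179938166250566444362591344667050794193442651041941406814144894116609289844486496250236113),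
   (13002881081, 8, 1342246371072248759245067791585255212213423474984501493963857046575612519472989741532142653535630982475389896978856771908084745374945),
   (50792504, 3, 1690909532215788844242958487608753141395777179218671025539382008980291539387195482602923958494694040330519147901731146194542359743729),
   (936955622621716369776343433, 2, 775121925169574672719849462779940100),
   (3659983045299040162445705, 1, 42914300449262866),
   (14296809088471892785545, 1, 791629117489831253922084829243903266),
   (55846946799383771529, 5, 14602976803989642822062604829199444960236051969231293745),
   (239860639391154021549879097737, 5, 41984259925282052),
   (936955622625639427264248201, 1, 42914300449262933),
   (3659982905106909574494601, 1, 791627929067394738995385725761883492),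
   (14296813011529380690313, 2, 14602951964527633009067174484718813583675664499452415345),
   (61404326106986280499495618247049, 5, 0),
   (239860649132188673791222118793, 1, 42914300449262997),
   (936955955892871670773873033, 4, 775770733878163203841528424586808737),
   (3659984203003420350118281, 2, 791629117489833928699975250811555249),
   (239860649150711421657741293961, 5, 42001851289439489),
   (936955660820970284230670729, 5, 791629117489834463654641214102441217),
   (3659983050081915743271305, 4, 791629117489834814143691063743745474),
   (14296813871347473611145, 4, 14602886196953996674578821436651125205187079578410028529),
   (55846929207197727113, 3, 269377025423774868207599794922127518589569304831727531239052913360743960065),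
   (218152149591816585, 6, 4969127561187825567088298683054160164673858176314690898918212619050245078825906434855231557137),
   (61404323684136731915642198325641, 2, 0),
   (239860648856645802065796823433, 1, 42914300449263154),
   (61404323684431879820821551151497, 2, 0),
   (239860649151793707245149649289, 1, 42914300449263186),
   (936955661903255871639026057, 5, 791629117489837119986700277437697601),
   (3659985433350394606025097, 4, 14412116563516969509348331322386044245661174487162293873),
   (61404323693857011980788967176585, 1, 41773148860910852),
   (239860658576925867212565674377, 2, 42914300449263249),
   (936955697642682320893278601, 4, 791629117489838300576912590499745441),
   (3659983198424785872255369, 5, 14129666945750833919091889688729121825660754408293862657),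
   (14296818099029526739337, 6, 14602979731631586820038096285332270866078677032280002241),
   (15719507483322356154363789647051145, 0, 0),
   (61404326106728026083562659281289, 4, 42914300449263330)],
  [(239860653596300740727908366729, 1, 791629117489839813210475358125624578),
   (936955679191711664105355657, 6, 790329874659808430609412551471009537),
   (3659983121859133779245449, 2, 14602979731631636501258758557970321552396210194771938561),
   (14296813590971471657353, 5, 14602979731631614723187275617908658715831470718251437857),
   (55846945699335272841, 5, 269377429822976187381368870717200886906968461070988469357772123540253839153),
   (218152149054945673, 3, 4960988487603547393137774111352758477226246623507097994397962617491606997818992347860059557697),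
   (852156834412937, 7, 91664389415240958582988736168667912356868204354259544563915050982878047046881563547702340026704148460430126223185),
   (239860640002500254769690929289, 1, 0), (936956270937418388533110921, 1, 42914300449263474),
   (61404323759989743546744481212553, 1, 0),
   (239860724709657433168079710345, 2, 42914300449263505),
   (61404323684431879820830157793417, 2, 0),
   (239860649151793707253756291209, 1, 42914300449263538),
   (936955975497905133308045449, 4, 791629117489843022944803864494215105),
   (3659985433350403212667017, 5, 14602979731631673932324028045869064704200078615853928401),
   (61404323684135721969127596189833, 5, 42019443760499970),
   (239860648855635855551194687625, 1, 42914300449263602),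
   (936955660893309357036890249, 5, 43021798830882517319987131132678145),
   (3659984423403880003889289, 4, 5497100813896551924403974296276646418559994267608027153),
   (14296818099025013598345, 7, 269377429822977888474412973075943517119858609270987218448625703828005589025),
   (239860640002500255869185779849, 2, 0), (936956270937419488027961481, 1, 42914300449263682),
   (61404323760026637033792371910793, 1, 0),
   (239860724746550920215970408585, 2, 42914300449263713),
   (61404323684468773307878048491657, 1, 0),
   (239860649188687194301646989449, 2, 42914300449263745),
   (936956012391392181198743689, 4, 791629117489846859867571196080951441),
   (3659985433349303684262025, 7, 14602979731631744711056347601069468923041191755228647585),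
   (61404323684136731916750299818121, 2, 0),
   (239860648856645803173898315913, 1, 42914300449263810),
   (61404323689135799560725588306057, 2, 0),
   (239860653855713447149186803849, 2, 42914300449263841),
   (936955680350001053450070153, 4, 791629117489849221050812630903558353),
   (61404323684135721969140699195529, 4, 41755560969833730),
   (239860648855635855564297693321, 1, 42914300449263890),
   (936955679340053443849447561, 1, 791629117489850143376789195399368994),
   (3659983126367200424192137, 7, 14602979731631804600752925686239041133298073041681977521),
   (14296818099038116604041, 5, 226758778803507460301486086985918367787518180372284614991093174309806412097),
   (15719506864357058954440690150893705, 0, 0),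
   (61404323688894909882546327611529, 4, 42914300449263970)],
  [(239860653614823768969926109321, 1, 776093985089497467893896449744703858),
   (15719506863148151581570134685739145, 0, 0),
   (61404326116449536494575901173897, 2, 42914300449264017),
   (239860663317811151741150259337, 4, 251324849065827467691897143958704545),
   (936955716161483979832649865, 5, 791629117489852762825674783137468801),
   (15719507483327078520846659325749385, 0, 0),
   (61404326106746400770042364389513, 5, 42914300449264082),
   (239860648892308944337968261257, 1, 791629117489853703596044390876844482),
   (936955716013142217520015497, 4, 791629117489853113313812183618949617),
   (936955659736161273898297481, 1, 584521408242114206498729834706899394),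
   (3659983266255796865296521, 4, 14602979731631870275249741427362493401525248023476572689),
   (14296813872446481852553, 7, 226758778803507447742662280855863578295012162528024507725623688767361520161),
   (55846945699368757385, 6, 269377429822980198449468322832641747191585765215554285770930085670691017265),
   (61404327325356909365139955148937, 1, 27712333077877314),
   (239860663299364407676029528201, 5, 780313998581141279817781487342719569),
   (15719507794021014161806357189716105, 0, 0),
   (61404327320394586867541148788873, 5, 42914300449264242),
   (239860658337041910077223168137, 1, 791629117489856655088113584670051586),
   (936955716013142217484494985, 6, 791629117489856064792863977147208337),
   (936955716017368800345614473, 5, 765648643196980414126189474549928609),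
   (3659983265692846876354697, 6, 14602979731631951943017802452593727562869498281040876193),
   (14296813309496492910729, 7, 269377429822981711230507295862511723607091048953923210755222241827592606401),
   (55846945699333236873, 4, 101403611861333994765960751379628162864239467424472345866586660118837859025),
   (239860653595291919000797800585, 2, 194459534500693339138446134655455972),
   (936955696629634010704341129, 5, 13153593668909828994149858807037851467703352583238193905),
   (3659983266240386252236937, 6, 13153593668909883779117302393170687609066657394147201793),
   (14296809634911218133129, 6, 242640976059946876617533316086814966296519832104250942883930782416597160721),
   (55846930288755697801, 7, 269377429822981711230507295862511723607178669047914928543312848271694631713),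
   (218152131638159497, 7, 4969136507178198511473581263877097360622772600816072234938252026619063399016081883592979911473),
   (852156832376969, 3, 91100739195374625579237938649152991912675130437740859655723894446477336743417808675967297239626198196330348680001),
   (3328737634441, 9, 91664389415241644233802509468621867729081490289928108745715866944834045390420315609910318563629793174766391137105),
   (3659983409511098077309065, 3, 267721010699743545763170920663100785157566188647955051144970048823711765345),
   (15719507795239366196429538672928905, 0, 0),
   (61404327334783048089515364608137, 1, 42914300449264519),
   (239860672725503132051438987401, 5, 542455675859195589366868327334417297),
   (936955752833996682608142473, 3, 11068884731875011699344922996556139342774706580485641073),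
   (3659983409507799542425737, 4, 269377429822984027481306208983866812327283343586744316212304724205646713713),
   (14296810193411804391561, 2, 269377429822983625747015822037814552246868062362962136389360879708806450433),
   (55846914844272257161, 3, 4938580967533025711327760231694694876409384423577727674643550039269570307510942900141017797585),
   (218152011110443145, 6, 3396926802024380535384807346503784943002731515572939971916133813234858783164723042355442488161)],
  [(852156293408905, 6, 62662239354068380944416365513798243109921296384325221226544606625775396576437086723200826920963707662181378560865),
   (3328736585865, 9, 91514084983444922148013877333172617963643504917211051941104919901958647158505735192640660333166915373761133810689),
   (13002893449, 9, 1688136904829314887642586098174568474558912555796765027703279336302928621608384394902325980224747998750901097427176193747610006197265),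
   (50792552, 8, 1690909532215861343934209549018708755709193645364943616378417789114353571349404720858096554051528232272212185610360738074495553639457),
   (198408, 8, 21374001071780159095315483683621251372963304447072829121581718466473712661648914257436014001704878852341757454668285587909946120344059159341373023327281),
   (1800, 0, 1170294639572714804594535153686149675541693344381023650884089024614027292036405185441480403125474678938645130193761027207483315196993),
   (8, 0, 24862367771845284713192485778888437280860102875345381017743637158335651454424352442987023528280981945443776415658836442513593685288436848285273645126737),
   (0, 0, 518777261499267885112456788236127034732042617016645402497812669833599926242350226474021705434888156406660600169724927463733823963579348856279141119672963612939459275789409)]]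

set_option maxRecDepth 100000 in
/-- Partial cubic graphs on twelve vertices. -/
def twelveTable : List (List Entry) := [
  [(350158661266534541165933172300873358547883, 0, 0),
   (1367807270572400551429426454300286556827, 10, 13445626791503855627),
   (5342997150673439654021197087110494362, 9, 13445626791503855643),
   (20871082619818123648520301121525368, 10, 206905045213888287547834310824154890281),
   (81527667697460594080469238568568, 1, 13445626791503855673),
   (318467456813434409434470569592, 1, 248028036333484122937577354042163593289),
   (1244013651039959099845793400, 1, 4575309709348515595998196747962233035025334169635461791833),
   (1367833232056693225567569106781931796634, 9, 0),
   (5343098562721457912373316823366921080, 9, 13445626791503855738),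
   (20871478761877473584943024068520824, 1, 13445626791503855754),
   (81529216369288315540568089717624, 1, 246781885087435765782537114814325457049),
   (318473539295327602706396638072, 11, 4538529816370945597607765621736181395777877720416635584673),
   (1367833171209464414612557834940178799275, 9, 0),
   (5343098325036970369580304042735073451, 10, 13445626791503855817),
   (1367833171130236252098293497346634848939, 10, 0),
   (5343098324727485359758958974010292395, 9, 13445626791503855850),
   (20871477833422444120907817894181035, 1, 248028036333484125593976054650749583609),
   (350165307406513465745297691336174506384043, 0, 0),
   (1367833232056693225567569106781931665579, 10, 13445626791503855897),
   (5343098563040633237745414161541200043, 1, 13445626791503855914),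
   (20871479390537808778385430967580843, 9, 236064984371593969826753728785501126961),
   (81529216369288315540568089721003, 6, 4354630351467038967272535816885974504610611621993657663745),
   (318473501442532482580344100472, 11, 4575309709348515682788892581492266602354717872133032116406),
   (1244037262872373448071861880, 11, 83721097993494841442750214360008446685076369003349789152760569581850359497057),
   (4859963568481326126749304, 0, 1556897217293463932538769246235392813829682809450079298413838883109033684607515576316579965567345),
   (1355414179545073047712305012980545690, 10, 0),
   (5294586638847941592626191456955256, 9, 13445626791503856026),
   (1713432409469495171749942485125021005978, 10, 0),
   (6693095349490215514648212832519613304, 9, 13445626791503856058),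
   (1714761637465280087622846292185301350554, 9, 0),
   (6698287646348750342276743328848833400, 10, 13445626791503856089),
   (26186183131496839615055545801010040, 0, 248028036333484130611490442699747623369),
   (102289780313113964095695127735160, 1, 4552322276235527404359942234681214480322700345295732998560),
   (1713427217172636636922313954628691785883, 10, 0),
   (6693278287946121286197158732400130203, 0, 13445626791503856154),
   (1714808469709991965139376442554713676443, 10, 0),
   (6750495126375068457984370094470896283, 10, 13445626791503856176),
   (26369121587402611164001445681526939, 9, 248028036333484132382377873775864578592),
   (438637367616477388655764042808892348471963, 0, 0),
   (1714808489992401568791046866501964962459, 0, 13445626791503856233)],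
  [(6750515408784672109654794041722182299, 10, 13445626791503856240),
   (6693278367174283800461496325944080539, 9, 13445626791503856266),
   (26369200815565125428339039225477275, 9, 248028036333484133562969494493275882128),
   (103005009861126643301787546384539, 1, 4575309709348515797125014018173638689390270554023731593728),
   (402363319770025950397607603064, 11, 4552322276235527469694156683501399468832399834347463508480),
   (438637367596115750889598108047351553235883, 0, 0),
   (1713427217175117357703306535607796800427, 1, 13445626791503856346),
   (6693075070189992979163812271272532907, 9, 134628381089525325404317786980955980513),
   (26145621421670652460231037302643627, 0, 248028036333484135616322693167278916289),
   (103007490581907635882766651399083, 0, 4552322276235527496916746037176476547365425817204217807553),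
   (402373010085576702667057232043, 11, 4575309709348515834896356746397808135754842579723448550080),
   (1571769570646783994793192312, 11, 84399567266310505673377487167220215138068299830233465660386937723743415370432),
   (6139724885338999979660920, 6, 1556897217293463984413625224553048366401625670795494999029672175274606583197881421093679685173632),
   (24260290022809427924600, 4, 1410882478511022191666323769530181264794640268467855258388295894264754228991672467568210014634368),
   (6693075624787130579014178672722143864, 11, 0),
   (26144829140045509816858348505098872, 1, 13445626791503856491),
   (1713427359945505428227629741316380457131, 1, 0),
   (6693076259851650513115738316816939179, 11, 13445626791503856513),
   (1713427339028031304641857757729329343096, 11, 0),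
   (6693075545558968064749841083473160824, 1, 13445626791503856555),
   (26144829140045509816858352800066168, 10, 248028036333484138598930626615983473585),
   (102128238828302772722103126420088, 4, 4575309709348515895466618058324854635636641141232824746945),
   (1713427318745621700990187336028664789163, 4, 11986465734915588945),
   (6693075463850084769492919328925448363, 11, 13445626791503856612),
   (26144826040354709181584054346741931, 11, 247695734167513853081930992817630348273),
   (102128226720135582740562712291960, 10, 4575309709348515917243443390018867940333149095318328968145),
   (398938432923057705945934686840, 9, 12029511493053705228637234634424942930577451695527510796225700396344764531729),
   (88827094442670122339000718368048865123243, 0, 0),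
   (346980838301744685320823127893677218731, 1, 13445626791503856699),
   (1355395089277847710986400266628668331, 4, 220778962960418294441239606449176314945),
   (88827120404154415013138861008354261235883, 0, 0),
   (346980939713792703579175235453683660971, 1, 13445626791503856747),
   (1355394295757002748356153311054428331, 4, 248028036333484142728384706287438005329),
   (5294512067491592621040626041518251, 9, 248028036333484142140705488768217384065),
   (5294512067491592621042825064773803, 11, 92508367719499124893070503779189982353),
   (20681687763639033675996098885803, 4, 4575309709348515971689868248615070456738261934755523462289),
   (80787842826714975296859761272, 10, 84399567266310508190358892481411103046750152728114499811849502072282328400721),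
   (1559680312450637703315810936, 0, 12029511493053706333512880867835338436587125564306174268989668667076088169665),
   (80789051752534589926034467448, 4, 74363866799004546518652417730547050522377657492244178946957492212381955196113),
   (1560889238270252332490517112, 0, 67974948082312307925636839758515295011222717585458127087322473327200744506593)],
  [(6210634245839213818374776, 0, 1556897217293464036295265895599452914599036736871005348944660714890246480523655075819924336149745),
   (24260290022809428978296, 6, 1298764018372357961296001885761275641102777191160951417017155724589114807652577778926806965158736),
   (94766757901599331960, 6, 26410973215913110801651943734400766176454632537389204403983132427418699275740845677919665903853889204157910906831696),
   (2533037533051573880, 5, 1410883116078106093931037712583314287696212766061109323991677382679545964584359613325696438371616),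
   (9894677863487096, 5, 26055058651469473693726183265599688679971265357232922343768082302157276912686234977081563227714909076750273945339184),
   (38651085404280, 5, 480985900151536104483167927010657183091308416574942013009089426422804459472600086884456797132769878979228753858411346346327155509626176),
   (344312037487756146261478987052280805547, 11, 0),
   (1344968896436547446333902293173893291, 11, 13445626791503856997),
   (5253784751705263462241805832710520, 10, 13445626791503857019),
   (20522596686348685399382054037880, 10, 120422156344035825319126618369227228549),
   (80166393306049552341336156536, 4, 4207510779540702727351633023124227488620159303766672147861),
   (344312037487756146261406085033312745626, 11, 0),
   (1344968896436547446333617519662299290, 5, 13445626791503857083),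
   (344312037487756146261406085037843585707, 11, 0),
   (1344968896436547446333617519914949291, 11, 13445626791503857109),
   (5253784751705263462240693437167770, 10, 248028036333484149519403118252038030789),
   (88143881596865573442919957768528062880683, 0, 0),
   (344312037487756146261406085037843585963, 5, 13445626791503857162),
   (1344968896436547446333617519679076507, 11, 13445626791503857178),
   (5253784751705263462240693437167771, 11, 241381902692812572458175967077854086693),
   (20522596686348685399377708738936, 9, 4575309709348516107802815016990455848599481313249767458293),
   (80166393306049552341319182712, 4, 4207510779540702787241329601209397061421077456357350704553),
   (313149973851756063833352568, 4, 74901000034216796692291605808941766093393884504396205844713394490848702367317),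
   (1223242085358422124358008, 6, 74900997203422396741908055003556926823368549775033662172293515858222777370212),
   (1344968896436547446333657244321356715, 4, 0),
   (5253784751705263462281535056157611, 5, 13445626791503857284),
   (344312037487756146261406930626743409323, 5, 0),
   (1344968896436547446334749054852438699, 4, 13445626791503857317),
   (344312037487756146261406948218929453739, 5, 0),
   (1344968896436547446334766647038483115, 4, 13445626791503857349),
   (5253784751705263462245246657141419, 11, 248028036333484153835941231500073109172),
   (20522596686348685399537246313131, 9, 4575309709348516140469922240212125907704823707744693389028),
   (344312037487756146261407212101720119963, 5, 0),
   (1344968896436547446335030529829149339, 4, 13445626791503857413),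
   (344312037487756146261407229693906164379, 4, 0),
   (1344968896436547446335048122015193755, 5, 13445626791503857444),
   (5253784751705263462246346168769179, 11, 248028036333484155606828662576190064404),
   (88143881596865573442920246279279695591578, 0, 0),
   (344312037487756146261407212028688038042, 5, 13445626791503857499),
   (1344968896436547446335030456797067418, 4, 13445626791503857509)],
  [(5253784751705263462246273136687258, 4, 248028036333484156891169711620187228021),
   (20522596686348685399399789721754, 9, 4575309709348516200359618819485717917916114773816602789620),
   (80166393306049552341942368410, 10, 4575309709348516173137029464622218403435412978167322773396),
   (344312037487756146261406929453931195256, 11, 0),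
   (88143881596865573442920174221681362696363, 0, 0),
   (344312037487756146261406945951169083563, 4, 13445626791503857611),
   (1344968896436547446333620882621754232, 10, 248028036333484158668988178811975632820),
   (5253784751705263462240706573790072, 5, 228089616396710420870578978087123290090),
   (88143881596865573442994033255569987103608, 0, 0),
   (344312037487756146261695442404571245432, 5, 13445626791503857675),
   (1344968896436547446334747821893905272, 10, 112197619442714455906899911581520365589),
   (5253784751705263462245113210235768, 4, 248028036333484160126280960635030210549),
   (20522596686348685399395209472888, 4, 4575309709348516282007448460574175414379408086494180542453),
   (80166393306049552341388651384, 9, 4207510779540702907020722757379736207022193186285523306565),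
   (313149973851756063835712376, 9, 77614874537561517085298913098323317465176910888731347226868986306891556587604),
   (1223242085358422124358520, 6, 84399567266310514109825206960032150354797460842059529005061897341844795164772),
   (4778289395931336423288, 6, 1556897217293464140038193159506015024118212840124470715687708585109041983281212220976684086593652),
   (18665192995873634168, 1, 1416097290609224463614352270753420116090404603662149126754205001842046869221051919298459146913924),
   (72910966041884536, 1, 26074297893959569853102323794853567839882603352769133375217183760471130254626710828806576370658464358960264324843668),
   (853372003956600, 0, 480985636998789242484832903374387698746184834532609691143032194974154316691170559605425292663811649675012458446227501857067023115225249),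
   (2052385568438754865429648850963291270008, 10, 0),
   (8017131126713886193084565824076344184, 4, 13445626791503857866),
   (2052385568438754865429648855365884472184, 4, 0),
   (8017131126713886193084565841524714360, 4, 13445626791503857898),
   (31316918463726117941736585318460280, 5, 248028036333484163963203727966616946900),
   (122331712748930148209908537453432, 9, 240052668834143644106514816345551407364),
   (2052385568438754865429648850963560888474, 4, 13292838510248659130),
   (8017131126713886193084565841542609050, 5, 13445626791503857956),
   (31316918463726117941736585319643290, 5, 248028036333484165143363003145570486580),
   (122331712748930148209908538636442, 9, 248028036333484164461265817956774840644),
   (477858252925508391444955229048, 9, 4575309709348516379688426186820288170500882131919796439380),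
   (1866633819156003162265709432, 1, 4454242655156215954500421407446258455727280589526063384932),
   (7291538358897289713118072, 1, 83975523970763703578096887585031017935676759446287713330011079152935938034036),
   (28482575378019828591480, 6, 1546467583646582862128757286548594300653931750899147955097662026175129364217392396595951211383169),
   (2052385548156964231797621117140856371354, 9, 0),
   (8017131047488141530459457488831470200, 10, 13445626791503858089),
   (31316918154250552853357255815747960, 5, 13445626791503858106),
   (122331711540041222083426780530296, 5, 246781885087435809169279176179190860233),
   (477858248203286023763385861752, 4, 4544659915451329632549303366523848103003784511424331516373),
   (2052385548156964231797621117153741269368, 10, 0)],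
  [(8017131047488141530459457488881805688, 5, 13445626791503858170),
   (2052385548156964231797621117153759033498, 5, 0),
   (8017131047488141530459457488882858138, 5, 13445626791503858202),
   (31316918154250552853357255815948664, 9, 248028036333484169571013926374320638469),
   (525410700328182843340191005991357765023898, 0, 0),
   (2052385548156964231797621117153759099034, 5, 13445626791503858249),
   (8017131047488141530459457488882923674, 10, 13445626791503858261),
   (31316918154250552853357255815948920, 10, 248028036333484170733140788894390815333),
   (122331711540041222083426780531064, 6, 4575309709348516477689747860050565653339632673207056599605),
   (477858248203286023763385862520, 4, 4454242655156216052501743080676535935558797515448264952453),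
   (1866633782044086030325726072, 4, 83975523970763705385902187376395078018385767305254262475081129028629891648149),
   (7291538356641087306021752, 1, 83834175935981968068456623397612404327667045009652889975273149447418227460772),
   (8017131127954244084009175374722919032, 9, 0),
   (31316918468571265953160841525881464, 4, 13445626791503858377),
   (2052385568756286485506348895929050495130, 4, 0),
   (8017131127954244084009175430608877722, 9, 13445626791503858404),
   (2052385568756286485506348891475119077530, 9, 0),
   (8017131127954244084009175357544102042, 4, 13445626791503858441),
   (31316918468571265953160841526933658, 5, 248028036333484173389489949632197823252),
   (122331712767856507629534537214584, 10, 4575309709348516537239162071214796762307876545412153215780),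
   (2052385568756286485506348892574428060280, 9, 0),
   (8017131127954244084009175361636424312, 4, 13445626791503858505),
   (2052385568756286485506348892574629656730, 4, 0),
   (8017131127954244084009175361838020762, 4, 13445626791503858537),
   (31316918468571265953160841257179768, 10, 248028036333484175750673191067020430164),
   (525410705601609340289625316499053583366298, 0, 0),
   (2052385568756286485506348892578924558490, 4, 13445626791503858585),
   (8017131127954244084009175361837955226, 10, 13445626791503858596),
   (8017131127954244084009175361636424056, 4, 329731831277226937),
   (31316918468571265953160841257179512, 10, 248028036333484176931264811784431733700),
   (122331712767856507629534536160888, 5, 4575309709348516570246551662545827723038273548474588531588),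
   (477858252999439482927869286008, 6, 4575309709348516543023546925518208672637608002334093216740),
   (2052385568756286485506348891462014953848, 10, 0),
   (525410705601609340289625316214275844962458, 0, 0),
   (2052385568756286485506348891462016006298, 5, 13445626791503858714),
   (8017131127954244084009175357273500024, 9, 248028036333484179015746892113611066373),
   (31316918468571265953160841256331640, 4, 241381902692812601087522769475078196277),
   (525410705601609340289625316214280123152538, 0, 0),
   (2052385568756286485506348891462032783514, 9, 13445626791503858773),
   (8017131127954244084009175357273565560, 10, 248028036333484180165140665276708883525)],
  [(31316918468571265953160841239357816, 4, 248028036333484180491486418010375195721),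
   (122331712767856507629534536165752, 4, 4452710182999376535162403288428836254354466724922862341253),
   (477858252999439482927869290872, 6, 4452710182999376486161742451813697514078996752556637555860),
   (1866633800779060480186989432, 6, 82138005180189921264726552405095278773362604646829259748292795865880054467748),
   (7291538644871463457733496, 1, 84286490779601291134016036910182452019129613026351693851587267473236841991348),
   (28482573121817421495160, 1, 1556897217293464267763228237698980766827152389841416467381682428841713365276772614066968118430916),
   (111260060070389955448, 11, 28527291733816534523062084142128959443981924204139296653043352994154963473579258189216564287746836453494447892597969),
   (2052385527874554628145954639422459443354, 4, 13293102393040307541),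
   (8017130968259979016195136474198014106, 9, 13445626791503858932),
   (31316917844765543032012251870230682, 5, 248028036333484183129352806105086954756),
   (122331710331115402468797858868088, 10, 13445626791503858969),
   (477858243480919540893742689144, 10, 247612657734631960936566134783565892900),
   (1866633763597341956616186744, 5, 4575309709348516717247288021145195587091270664367624949044),
   (2052385527874554628145954639409556715674, 4, 0),
   (8017130968259979016195135361783658650, 4, 13445626791503859034),
   (31316917844765543032012247506967416, 9, 13445626791503859050),
   (122331710331115402468798060125048, 9, 240052668834143665062016084079602044276),
   (477858243480919540893742422904, 5, 4552322276235528411595748320659066386513878283533249678724),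
   (2052385527874554628145953512358598633848, 10, 0),
   (8017130968259979016195130907902568824, 4, 13445626791503859114),
   (2052385527874554628145953513522569246874, 4, 0),
   (8017130968259979016195130976656521370, 10, 13445626791503859140),
   (31316917844765543032012230377564536, 9, 248028036333484186984740331956137364916),
   (122331710331115402468798110591352, 5, 240052668834143667128051420335071825380),
   (525410695135885984805364099163805545232538, 0, 0),
   (2052385527874554628145953512358633109658, 5, 13445626791503859210),
   (8017130968259979016195135310278523034, 4, 13445626791503859221),
   (8017130968259979016195130907937044634, 4, 13445626791503859242),
   (31316917844765543032012247591909530, 4, 248028036333484188460479857852901494325),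
   (122331710331115402468797842155896, 9, 248028036333484189050775668211607145973),
   (477858243480919540893742754168, 9, 4428190146194401308832872040237200741312647756317054733908),
   (1866633763597341956616182648, 6, 83975523970763711512353481113795503854231834470772624948628934836588427349604),
   (7291538139052117018031992, 11, 1546467632880490661806958685534338610422257160361380939607210987397494210917016684741049434771060),
   (2052385527714550878068319521466235975834, 9, 0),
   (8017130967634964367454373130745378970, 5, 13445626791503859353),
   (31316917842324079560368645043091610, 10, 13445626791503859365),
   (122331710321578435782690019699576, 10, 248028036333484191098346246269735800501),
   (477858243443665764776132963192, 4, 4575309709348516853360234789520580979819811266880852725445),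
   (2052385527714550878068318112991840794795, 9, 0),
   (8017130967634964367454367628892272811, 5, 13445626791503859433)],
  [(2052385527714550878068318112992126868139, 9, 0),
   (8017130967634964367454367629178346155, 9, 13445626791503859461),
   (31316917842324079560368623551477931, 10, 248028036333484192869251691469484330741),
   (122331710321578435782690021800107, 4, 247695734405140365109091250870579892005),
   (525410695094925024785489436644436266752683, 0, 0),
   (2052385527714550878068319255389003094699, 4, 13445626791503859525),
   (8017130967634964367454372095944333995, 9, 13445626791503859541),
   (31316917842324079560368714300299947, 4, 248028036333484194344973203242616885093),
   (122331710321578435782690576308907, 10, 248028036333484194566352146250763079476),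
   (477858243443665764776135063723, 10, 4575309709348516918355080720737532035368243929642416738100),
   (1866633763451819393656777592, 11, 84399567266310525659669412638411768274674316541552816637040985556732561329876),
   (8017130967634964367454372031233620123, 10, 0),
   (31316917842324079560368640747993243, 5, 13445626791503859642),
   (2052385527714550878068319239995823528603, 5, 0),
   (8017130967634964367454372031503047323, 10, 13445626791503859669),
   (2052385527714550878068319239991259199643, 10, 0),
   (8017130967634964367454372031216908443, 5, 13445626791503859706),
   (31316917842324079560368640748058779, 9, 248028036333484196724621202874780618757),
   (122331710321578435782690002925723, 6, 4575309709348516967696356226201953066866888662412721917973),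
   (2052385527714550878068318114078451604123, 10, 0),
   (8017130967634964367454367633118951579, 9, 13445626791503859770),
   (2052385527714550878068318114078468381339, 9, 0),
   (8017130967634964367454367633119017115, 9, 13445626791503859802),
   (31316917842324079560368623566878875, 5, 248028036333484199085804444309603225673),
   (525410695094925024785489437207386203396763, 0, 0),
   (2052385527714550878068318114091352357019, 9, 13445626791503859850),
   (8017130967634964367454367633170397339, 5, 13445626791503859866),
   (8017130967634964367454367633456536219, 9, 13445626791503859877),
   (31316917842324079560368623568189595, 9, 248028036333484200561543970206367355045),
   (122331710321578435782689935816859, 6, 4575309709348517027436821005925913364207393175207268061301),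
   (477858243443665764776132966555, 4, 82138005180189929098549518167672872345171906074724944877243129189473757171925),
   (1866633763451819393656769400, 11, 83975523970763715529698591761271192926917780153079747880454500168747554181349),
   (2052385527714550878068318112991857506475, 9, 0),
   (8017130967634964367454367628908984491, 5, 13445626791503859977),
   (2052385527714550878068318112996152408235, 9, 0),
   (525410695094925024785489436925915504876203, 0, 0),
   (2052385527714550878068318112991857440939, 9, 13445626791503860026),
   (8017130967634964367454367628908918955, 5, 248028036333484202627579306461837136201),
   (31316917842324079560368623550429355, 6, 4575309709348517054808642157962199720869485794429204697365),
   (2052385527714550878068319238878861686955, 9, 0)],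
  [(525410695094925024785489725156287125747883, 0, 0),
   (2052385527714550878068319238891746588843, 9, 13445626791503860102),
   (8017130967634964367454372026937735339, 5, 248028036333484204675167898643597365622),
   (2052385527714550878068319238891764349099, 9, 0),
   (8017130967634964367454372026955495595, 9, 13445626791503860149),
   (31316917842324079560368640730298539, 10, 1822468917319861124571228778501611830049816843206660198821),
   (122331710321578435782690020751531, 4, 4575309709348517119653674743428580786944957135441995239781),
   (122331710321578435782690003974315, 4, 4575309709348517125438474981084534665821965174155462578661),
   (477858243443665764776134015147, 4, 84399567266310529375736627420439769005086372935554895567239125093770735915493),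
   (1866633763451819393656780971, 11, 84286490779601299670874397036068291265920140376844237593583747678388213518580),
   (7291538138483669506471800, 11, 1556897217293464425240469600449006551420550361782856987075652101463373002681083772875596803084532),
   (28482570855706759018360, 1, 1556897217293464319753734957219170783236214556624776940033176745310012458861036343104057258283556),
   (8017130967949285080554175681098574712, 9, 0),
   (31316917843551894845914821786495864, 9, 13445626791503860292),
   (2052385527795016980621868973257428531355, 4, 0),
   (8017130967949285080554193273536346267, 9, 13445626791503860324),
   (2052385527795016980621867829765335644315, 9, 0),
   (8017130967949285080554171283303790747, 4, 13445626791503860361),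
   (31316917843551894845914822038223003, 5, 248028036333484208807238571154536927892),
   (122331710326374589241854773586808, 11, 4575309709348517190581306559416646647404871435929458315940),
   (2052385527795016980621868111175618357880, 9, 0),
   (8017130967949285080554172318121421432, 4, 13445626791503860425),
   (2052385527795016980621868957864013949560, 9, 0),
   (8017130967949285080554177880121764472, 9, 13445626791503860452),
   (31316917843551894845914757344225912, 6, 248028036333484211168421812589359534804),
   (122331710326374589241854772603512, 11, 4567647238951695965611136639709411759341511845174439842564),
   (2052385527795016980621868957846817372315, 9, 0),
   (8017130967949285080554177862925187227, 4, 13445626791503860521),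
   (525410695115524347039198164403364496570523, 0, 0),
   (2052385527795016980621868957864248899739, 5, 13445626791503860548),
   (2052385527795016980621869536207365109915, 4, 0),
   (8017130967949285080554177880356714651, 9, 248028036333484213160670172549991109460),
   (31316917843551894845914757345212571, 6, 4575309709348517261360038878971847051918860454248185860980),
   (122331710326374589241854773590171, 11, 4575309709348517195004977329388846675970538712671340991364),
   (477858243462400739225995209336, 11, 84399567266310532081167475372099178282773881182549355965552253566832304198548),
   (2052385527795016980621869536207365175450, 4, 0),
   (8017130967949285080554193273519569050, 11, 13445626791503860660),
   (2052385527795016980621868113434772076698, 11, 0),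
   (8017130967949285080554172378251884698, 11, 13445626791503860692),
   (31316917843551894845914817474689178, 6, 248028036333484215042238068068365374436)],
  [(525410695115524347039198236460953987938458, 0, 0),
   (2052385527795016980621868957859702339738, 6, 13445626791503860740),
   (8017130967949285080554175616639465626, 11, 13445626791503860758),
   (31316917843551894845914748737452186, 4, 248028036333484216807360897119006233638),
   (122331710326374589241854755764378, 9, 2613717287762275350453797684658037427528082627779303052340),
   (2052385527795016980621867829700643560091, 6, 0),
   (525410695115524347039198164403364496636058, 0, 0),
   (2052385527795016980621867829700642568346, 11, 13445626791503860838),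
   (8017130967949285080554171209768138906, 9, 248028036333484217698569214682540807286),
   (31316917843551894845914731289147546, 4, 248028036333484218578248328195123188870),
   (525410695115524347039198163558939567364763, 0, 0),
   (2052385527795016980621867826402108676763, 9, 13445626791503860902),
   (8017130967949285080554171196883237018, 11, 248028036333484219431458367319673214022),
   (31316917843551894845914731238815898, 4, 248028036333484219764604550938010588313),
   (122331710326374589241854420220058, 4, 2613717287762275426677047874948253246330813976510039332054),
   (477858243462400739225995212954, 5, 45953011802260356507292873740034043611236905086287826782038470103816708560100),
   (1866633763525002887601543800, 10, 48214573888380955077108310967623772409821973295042906392965607971014870832372),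
   (8017130967949285080554175663918708907, 4, 0),
   (31316917843551894845914804606630059, 9, 13445626791503861012),
   (2052385527795016980621867826393534593195, 9, 0),
   (8017130967949285080554171197152721067, 4, 13445626791503861049),
   (2052385527795016980621868111235765663915, 4, 0),
   (8017130967949285080554172378268727467, 9, 13445626791503861076),
   (31316917843551894845914735887153323, 5, 248028036333484222679190114584119743812),
   (122331710326374589241854790367403, 6, 4567647238951696177947333598375012971979588440518854448500),
   (2052385527795016980621867847421947059115, 4, 0),
   (8017130967949285080554193337961716651, 5, 13445626791503861140),
   (2052385527795016980621867829829761014699, 4, 0),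
   (8017130967949285080554175745775672235, 4, 13445626791503861173),
   (31316917843551894845914886463593387, 9, 248028036333484223785994759006692840900),
   (525410695115524347039198163556736265919403, 0, 0),
   (2052385527795016980621867826462506654635, 9, 13445626791503861220),
   (8017130967949285080554171197405305771, 5, 13445626791503861241),
   (31316917843551894845914736139738027, 5, 141274514730197000417755969552859010564),
   (122331710326374589241855042952107, 6, 4575309709348517468145379828651687596997164337289803863572),
   (477858243462400739225996261547, 11, 84399567266310536198577935600793417435295892587719205257379406792336818050596),
   (2052385527795016980621868125529906518955, 4, 0),
   (8017130967949285080554189970944465835, 6, 13445626791503861316),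
   (2052385527795016980621867826462743763883, 6, 0),
   (8017130967949285080554171279246793643, 4, 13445626791503861350)],
  [(31316917843551894845914817981225899, 5, 248028036333484227051068460053283477108),
   (525410695115524347039198163556723618126763, 0, 0),
   (2052385527795016980621868111223370455979, 4, 13445626791503861397),
   (8017130967949285080554172310038944683, 6, 13445626791503861413),
   (31316917843551894845914749261749163, 4, 248028036333484228820873618814497003189),
   (122331710326374589241855280061355, 9, 4207031524380175401917556007969896979310736106437852796612),
   (2052385527795016980621867829700626782891, 6, 0),
   (525410695115524347039198236460941087120043, 0, 0),
   (2052385527795016980621868111175603493547, 6, 13445626791503861493),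
   (8017130967949285080554175616641440427, 4, 248028036333484230297695417026164561637),
   (525410695115524347039198164403347317627563, 0, 0),
   (2052385527795016980621867829700895218347, 6, 13445626791503861541),
   (8017130967949285080554175616909875883, 4, 227648252569857508197155175690862073653),
   (31316917843551894845914748504545963, 9, 248028036333484231478287037743575865109),
   (525410695115524347039198163558935272397483, 0, 0),
   (2052385527795016980621867826402360335019, 9, 13445626791503861605),
   (8017130967949285080554171196885211819, 6, 248028036333484232412923577874032629461),
   (31316917843551894845914735619644075, 4, 248028036333484231828775175144057345925),
   (31316917843551894845914731324676779, 4, 248028036333484231828775175144057345942),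
   (122331710326374589241854522858155, 4, 4575309709348517598920146864542802828265293651167321003941),
   (477858243462400739225997187755, 11, 84399567266310537303347841028849231870374866671857409745883887098180397963188),
   (1866633763525002887601551531, 10, 84399567266310538810220535706620957419633143622328617299610523351701557090244),
   (8017130967949285080554175612111592091, 5, 7320737139435509718),
   (2052385527795016980621867830800138410651, 6, 0),
   (8017130967949285080554171214065080987, 5, 248028036333484234774129337285517252566),
   (31316917843551894845914752799513243, 4, 4575309709348517647900843300746856820300545062821375776773),
   (122331710326374589241854503123098, 11, 4575309709348517664234396912951903052375066483310722029525),
   (477858243462400739225994164378, 11, 84258219635928002001840559292049610473045385792839411330535651249131961194532),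
   (1866633763525002887601539704, 10, 84399567266310538923208366943581211343816434066099176234817016729449884816645),
   (7291538138769542529693560, 10, 1556897217293464595802499742680926695110065362584515286013955966334963052230363312705380021180484),
   (28482570854607247390584, 1, 889401905141922632840490264287280414804439914738118192000026898455363744767709202747607577794644),
   (111260042461006280568, 1, 16406569322822746110231369266221564444214311682961468315705606869839606978981597051440448466317135175427020857284708),
   (434609609649960824, 3, 529784670153242669735793578251115643125229270666177779112412374807282693251771326367120675628692187643799220205687679319140146529441905),
   (1697796934088568, 0, 529784670153242786994047700203182359415822419892822418624454896212408525223404410868906871675258822185784300109047401936172907807905921),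
   (8947073824632, 0, 8872623803158206353436776691146380718094676038021995381800041961232226311956207468860102839880749295789472277679898090787146532087499012518829842023585937),
   (150980802424, 8, 163670931012778386445503410602125437683378263551664311011047671411284424037853070226591375428187893312124938639479791011033238119623657168853222191063574662723388177384478880),
   (438637367514906884312477379317066182978443, 0, 0),
   (1713479160426112309631479567615519124363, 10, 13445626791503861952),
   (6693277970414501209497967061216291723, 5, 13445626791503861978),
   (47137991489921844978931759814568843, 0, 241381902455186201899096010303455893733)],
  [(407319763108396322157292851587979, 9, 4523408393890684200187099709587387561222878779963660572912),
   (1591092824642173133427411807115, 4, 4575309709348517746262332904781063934988596354471893276928),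
   (350162622887467098896127077876869181967258, 0, 0),
   (1367822745654168355062996415604557843354, 4, 13445626791503862058),
   (5343057600211595136964829804306860954, 5, 248028036333484240701641060474719115540),
   (26145617071931645349601563185482650, 0, 240135745504633980800024378349330635076),
   (184132779257507206949081539382170, 0, 4454242462240944891761427801303412596165050845377864931668),
   (1591092824642173133556277808026, 9, 4575309687425993190041974004384208122306030292190467463520),
   (6215206346258488802954210187, 9, 84399567266310541528205587107131203850673959785082673645931991006759655971184),
   (25506149831587428458589067, 1, 4429722727963864774783201422849515594445756053812799609216),
   (118707619680215789759371, 1, 82166274301867250634120501479177429462189331532601433019442427581044003969424),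
   (648457608474659416971, 9, 1515700192259905845465852024657300809452203766714664329965713923026226879517160002248328865716640),
   (353684398099497490648047393421346311067, 1, 0),
   (13402031178559027184672785989578099611, 0, 13445626791503862209),
   (52635955265985351720879927153232795, 5, 248028036333484243487039796574662236336),
   (346980838301744685376451876355356330907, 1, 13369594531082803381),
   (1381559397666558421462040682466741147, 0, 13445626791503862261),
   (52331401881642548558233622186396571, 1, 248028029995237287934299187223748155904),
   (205609200257755568689186381335451, 4, 4575309709348517820784250096994681018099220183142163093984),
   (2785104221238864449713868475291, 10, 248028036333466111075562736187637504544),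
   (10879313364214314312546225051, 10, 4575309709348517848006839445599233066099022318322697968176),
   (42497317828962289854286747, 4, 84399567266310542833720148563134187269719145777796881596535129898813624490560),
   (166005147769512810613659, 9, 1515178715524902030649141923299512365259899079100174616030041178861047261730216973578707620928080),
   (1374531234080226900520308019655262899099, 4, 0),
   (13401766396473046666809589928190053275, 0, 13445626791503862388),
   (109486438623887937771519325386607515, 10, 13445626791503862400),
   (427681400874562256936494552353691, 10, 248028036333484247084232524084676926096),
   (1670630472166258816158400023451, 5, 4575309709348517887811901012920217802943131833664374315680),
   (1713427237216742783011549525666534296475, 4, 0),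
   (6693075145377901496138865403572554651, 10, 13445626791503862468),
   (1713427237216742783011549520100256680859, 4, 0),
   (6693075145377901496138865313378241435, 10, 13445626791503862500),
   (26144824786632427719292443200883611, 5, 248028036333484248375504609261525146356),
   (102131627381168630606579005688731, 0, 248028036333484249260515979261125860100),
   (1373144870295804319548174918234766085019, 5, 13368275112632064180),
   (5363847149592985623235058343292210075, 10, 13445626791503862564),
   (20952527928097600090761946871663515, 5, 248028036333484250145959694799184337716),
   (183340493958289576639961554783131, 0, 248028036333484249463862509610388691780),
   (719579362910278486842749258651, 0, 4575309709348517947709572958504727894733669869161328679764),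
   (6525900281899448500853705627, 9, 81685690066975273404198846756143591649313377524046909950602794523152761232224)],
  [(26715075651202057633303451, 1, 82138005180189946172266238419444550962764641830176076077166503644846978505584),
   (1728111155179032317164783809774966512283, 0, 0),
   (26699320574339999847910772616125455003, 5, 13445626791503862672),
   (1367879901883671948842424511131464473243, 5, 0),
   (5421206204133179116022274344111282843, 5, 13445626791503862704),
   (104294220993515624407046102989904539, 4, 248028036333484252120193656224564124608),
   (407399300755920407840079693453979, 10, 4575309709348517989561485646053142083377209221947365596112),
   (1728111155179032317164784090150431595163, 0, 0),
   (26699320574339999847911052991590537883, 5, 13445626791503862768),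
   (1367879901883671948842424791506929556123, 0, 0),
   (5421206204133179116022554719576365723, 0, 13445626791503862805),
   (104294220993515624407326478454987419, 4, 248028036333484253891081087300681079840),
   (350163952135824521578165915036995864468123, 0, 0),
   (1367827938030564537414710627663646268059, 5, 13445626791503862852),
   (5369242351025767688308390876293077659, 0, 13445626791503862869),
   (13396574178842674353443989706374879899, 5, 7644925536922246240),
   (52330367886104196693162635171699355, 4, 248028036333484255957116423556150860896),
   (407399300755920407857671879498395, 10, 2601433356638228271462777671022705112641416369181817838720),
   (1591403518577814093254179396251, 9, 4575309709348518054898518538600343889515579578621053181072),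
   (350162622907828736662293012637254614027163, 0, 0),
   (1713479180787750075797414627123965496219, 4, 13445626791503862960),
   (12067346183057758480541589965124438939, 5, 246601149714614969796238801554260368576),
   (47138071027569369064615586019445659, 10, 248028036333484257728003854288670760144),
   (351525081603508275432019413466667083664283, 0, 0),
   (1373196813866811612334038612317313731483, 0, 13445626791503863034),
   (12067346183057758480540182590240885659, 4, 248028036333484258115385480180168400128),
   (47138071027569369064632082988829595, 5, 248028036333484258883987742442040597728),
   (184133089951442847908719292353435, 10, 4575309709348518103899179375215482632963889531665320844576),
   (1591403518577814093194030779291, 9, 4575309709348518062036472876440711105636384380383598222640),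
   (6216419994444586301774138267, 9, 84399567266310546650320603204585232065416394867340434005608172505125803597120),
   (24283056912524190348250011, 1, 84399567266310547755090508632641046349431291672851714407077511176225702616400),
   (104540520231606854126491, 1, 1515178715524902121430139885759808779280158257308674750267584873435886938964222760529766760324448),
   (648457608474659425179, 6, 27950113908674046359738876204343259722468763974784739781769008682293702234499775110166937950307272898865351077469552),
   (2533037533104138379, 11, 527122907246886855126327059075513903313945755531776582775642863576302819768163070108064335935663440990144904861168563432666519539096960),
   (345646417294808552172142756909017426074, 9, 0),
   (1350181317557845906922432644175849320, 10, 13445626791503863209),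
   (5274145782609576945130417319274344, 1, 248028036333484261952303921006751389881),
   (345646539703558856586014417088579856538, 9, 13293102537678919857),
   (1350182510009709287388528891052648602, 10, 13445626791503863249),
   (5274150429725426903861440980674408, 10, 248028036333484262819269190179093487073)],
  [(20602150116114948844355543852904, 4, 4575309709348518176378658915377637639455444076859256479169),
   (80508599871378682284036810600, 0, 246781885087435904797200454289506442761),
   (1280437357114344690492860264, 0, 4538529816370948161975682737928442194783582665697058102801),
   (42497317828964415593736040, 4, 83721097993433181221319441579395049076017042071820724844640820160948543168032),
   (1376163562419304573350782325963319144, 10, 13292838655139911865),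
   (5375641705906199518905851094722408, 10, 247363422335746549158651419056443235905),
   (183344847371371890375354765502312, 0, 13445626791503863377),
   (723932775992592222235959977832, 0, 248028036333484265198827118093588766305),
   (10879313364213183894064424808, 0, 4552322276235529887060091289848244043691244900464481803889),
   (352297749253679016307231271388084398234, 9, 0),
   (1376163083022183657450122153859704680, 10, 13445626791503863449),
   (5376429959385511847647175694313320, 0, 13445626791503863466),
   (21873824021470855725101354805096, 0, 246781885087435908043827411262387527353),
   (1591414417819185301154103519080, 1, 4536997320827094033150334788735615252737396282284101869248),
   (3429538566674300238964542999122166704538, 0, 0),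
   (26714897464915604330796924804484589978, 10, 13445626791503863520),
   (353679002661302631275320385204551969178, 10, 0),
   (1433583778299924955811514230260656538, 0, 13445626791503863562),
   (104355782515009082907707169980311962, 1, 248028036333484267855266351098811653904),
   (407639775449254230108231132735593, 9, 248028036333484268739989490696491507488),
   (352297749570591666364288621762260199529, 10, 13292838655139911865),
   (1381558683373875917683557848249231465, 0, 13445626791503863625),
   (1433604060709528607481938177511942554, 10, 13445626791503863632),
   (5600015862146596122976321005906025, 10, 248028036333484269902854943280571883344),
   (21877852167301170365265638549609, 1, 248028036333484270216449592533634260793),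
   (1595442563649499941318387263593, 1, 4330110422810199102606920079638126634828958323753117294464),
   (6232197514255859145774950248, 6, 83975523970763739131601116815190866228947711036634095119228180016906972503952),
   (42497317828957771279329128, 4, 1544381668255958496008644961574949896944943152697563674373374449210001741584648997406091201552288),
   (352375939291146714159517021455159617642, 1, 0),
   (12093572370208250696142414023391406186, 0, 13445626791503863745),
   (130520408144007840008150480868305002, 9, 13445626791503863760),
   (712986680637149294888072637802602, 9, 248028036333484272116464232125717094368),
   (2785104221238936786527807039594, 4, 4575309709348518350262948411977192479422430670783847145456),
   (366997447244780788761534618090498189978, 0, 0),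
   (26715080323842325298160010658729978522, 1, 13445626791503863824),
   (352349977806854040021450087945768299162, 1, 0),
   (12067610885915576558075480514000087706, 1, 13445626791503863856),
   (104558923851333701941216971476986522, 9, 248028036333484273297055852843129380928),
   (712986680637149370607044892584602, 4, 248028036333484274182499568381186875472),
   (1373196875428333105792976407377524320922, 0, 13441300286500116657)],
  [(12067407744579251939477977650451475098, 4, 13445626791503863920),
   (47240517071125979429878648306952858, 4, 248028036333484275067943283919245353088),
   (509845344312530773104181343971994, 9, 248028036333484274532987705781669339280),
   (2785104221239012505500061821594, 9, 4575309709348518386673826286515345788681722386348341534880),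
   (10879313364214892599609616490, 10, 84399567266310553172229306271346545930027420279027182974557356985979119935664),
   (5348270579970285194913687352582563688, 9, 0),
   (20891685052699727394638426638346088, 1, 13445626791503864025),
   (345651650077258131788847504136683087720, 9, 0),
   (1350201761213980378152192398451238760, 1, 13445626791503864057),
   (345651711718007787761972525845270980713, 1, 0),
   (1350202792419312939058955045917124713, 1, 13445626791503864089),
   (5274229657887941168199043148113768, 6, 248028036333484278166996288302451007745),
   (81932799353113539668546818893672, 0, 4563049745024445843672515584220152606123288187696227295537),
   (348310065504008756231314270362741204840, 9, 0),
   (1360586196474725004880578204021778280, 1, 13445626791503864153),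
   (348310167709577619507707786594558371688, 9, 0),
   (1360587386136382594243662667302266728, 9, 13445626791503864177),
   (5314794477095244509046937650685800, 4, 248028036333484279937883719378567962977),
   (122497618560416880516441321465704, 0, 4563049745024445876339622808630245100341244444074673447313),
   (352297851696932367126203034993285621608, 9, 0),
   (1376164276711987076913081374176143208, 1, 13445626791503864249),
   (352298054838268691745089064010221316201, 1, 0),
   (90188223869789056985606577035157053073513, 0, 0),
   (352297750284884348868139441410416273513, 9, 13445626791503864289),
   (1376164276711987077201607527563225193, 4, 248028036333484281413623245275332092401),
   (5375641705906199520318779404543848, 6, 4575309709348518529932702760230438912130398611775228486145),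
   (183344847371371891788283075323752, 0, 4575309709348518496244748435057531026895165263392363520529),
   (803160938506857972757813749608, 0, 84399567266310555482202744893645067163836622006398439546057963568653642244641),
   (10879313364214596822374246248, 10, 84173410842016042755474398469163094542890609285247069243979934411664353403440),
   (348310065583236918745578326481308444520, 9, 0),
   (1360586193684519213849917592709064552, 4, 13445626791503864409),
   (348310166995284937003930446217564874600, 9, 0),
   (1360586589825331785171605560428816232, 9, 13445626791503864436),
   (5314791686889453478386326337972072, 1, 248028036333484284660250202248213176932),
   (1369157166264033940830407432046733125480, 9, 0),
   (5348270181039266832561338773550098280, 1, 13445626791503864489),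
   (1369157267758100327394054268512869508968, 1, 0),
   (5348270659198447709177743471149803368, 1, 13445626791503864521),
   (20891682262493936363977815325632360, 4, 248028036333484286135989728144977306289),
   (525749653527875997536222224854072096941928, 0, 0)],
  [(2053709584093265615375868068091110582120, 9, 13445626791503864564),
   (8022303459325515632576232350818199400, 1, 13445626791503864580),
   (8022303063184703061254544383098447720, 1, 13445626791503864601),
   (31337123208374546632310649737930600, 1, 248028036333484287316581348862388609828),
   (122494828354625849855830008751976, 0, 4575309709348518633378542304195731810308977593058126209681),
   (352297749570591666364288903237219346280, 9, 0),
   (1381558683373875917683839323208378216, 0, 13445626791503864665),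
   (3075937937314517656478826994451194013544, 9, 0),
   (13396635026071485308455527565280110440, 0, 13445626791503864697),
   (52330687588960044780032262928033640, 1, 248028036333484289382616685117858390880),
   (353704984428004909065204941970778842984, 0, 13292961802589706425),
   (13422617507066445601830334539010631528, 1, 13445626791503864736),
   (52453096339264458364306491268884328, 9, 248028036333484290120486448066239472560),
   (204894907575251790487827122972520, 4, 4575309709348518682379203140810870552226207787984500106128),
   (351525081664355504242974426426258984757353, 0, 0),
   (1373144850333407056754414147209666193513, 1, 13445626791503864809),
   (5369242670728623536396682181191624809, 0, 248028036333484291448575918749263206577),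
   (1373144972742157361168213749795190696041, 1, 0),
   (88486838016951066946079445016833071474793, 0, 0),
   (345651732000417391413570892198484338793, 9, 13445626791503864865),
   (5369365079478927950196284766716127337, 0, 248028036333484292038947831732033823793),
   (20974082341714562306031489582065769, 4, 248028036333484292924391547270092301313),
   (52453096339264458581056525594749033, 4, 248028036333466159184671280422148121680),
   (204894907575251791909504265185385, 4, 4575309709348518736824381848161006576020625619782028239952),
   (800370732715827312146501035880, 6, 84399567266310559198246972242560079544501521287220602366717552181166287627072),
   (3137347416042415111465035624, 10, 84173410842071582250328216522000836943589258403728773046277273211598902666369),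
   (42497317828964424217225064, 10, 1552725367613878826159236608387593357340987476302707263352373128620935885652804151644177958970512),
   (166005147769392282167144, 5, 28719684516483117074627859727151988226139829814209170712419201158230529722920323203531015736026780314850756754744480),
   (648457608474406905704, 11, 28517672332727209853640441832118851886224255883818645379439461273510591409308871811797119926420439967200072586831024),
   (3075937856264107404386410480672040249498, 10, 0),
   (12067325979876317343135206725846001818, 10, 13445626791503865040),
   (47137992108891864621621901272835944, 9, 13445626791503865066),
   (407320382078415964847434309855080, 9, 234735756375647226718623324005626553584),
   (1591095242493812362694064891752, 4, 4552322276235530458734467717024862693151110926067488597248),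
   (345651629953304853165705755367897000090, 9, 0),
   (1350201679505097082678538106905847656, 10, 13445626791503865129),
   (345651629953304853165705473892920289434, 9, 0),
   (1350201679505097082678537007394219880, 9, 13445626791503865162),
   (5274225310566785479213043959752552, 4, 248028036333484297370056869034094241113),
   (20605854245917253385144612972392, 0, 248028036333484298255433030577742161257)],
  [(352297769932229432530224508047531206504, 9, 13291431275842836666),
   (1376163163797771220821189489040320360, 4, 13445626791503865226),
   (5375637358585043831332780216182632, 4, 246781885087435940510096980991198373273),
   (21001995058488575073112332724072, 0, 248028036333484299436092205289564022132),
   (85760154722789948416729835368, 0, 4552322276235530518624164295110032265951709323428220642676),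
   (6531992208525610823185885032, 1, 83692828440403321343176448622812124851250984205470503226091265643016998626752),
   (1367827938347786672481589307640098810010, 9, 0),
   (5343077884171041689381208232969135976, 10, 13445626791503865321),
   (1367827938268558509967324970046554859674, 10, 0),
   (5343077883861556679559863164244354920, 10, 13445626791503865353),
   (20871397986289910213883411473917800, 1, 248028036333484300911831731186328151577),
   (81532001734376707649511185999720, 0, 4575309709348518889609918444416346455037905769877277382833),
   (345625749598650593634244517200279333018, 10, 0),
   (1350100584369728881383767645313591144, 9, 13445626791503865418),
   (345625769881060197285914941147530619034, 10, 0),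
   (1350100663597891395648105238857541480, 10, 13445626791503865449),
   (5273831036354588637193277915293544, 1, 248028036333484303273014972621150758489),
   (1367828039841543574035414799037510412442, 1, 13291424756352032154),
   (5343078441568075395813550559741831322, 9, 13445626791503865489),
   (5343078359859192100340176652284225384, 10, 13445626791503865513),
   (20871400162375294514896681873991528, 10, 248028036333484304140011944085499684529),
   (81534177819761008662781586073448, 0, 4575309709348518943821729610324576326115997536803926058625),
   (318492882108441440097765189480, 4, 4552322276235530616625485968340309748716258557005816407601),
   (438637367616477388655764260113071607343258, 0, 0),
   (1713427339028031304642075058657651288218, 1, 13445626791503865588),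
   (6693075624787130579231479605339056282, 10, 245183631118771631791534969485630908161),
   (26144826659324728825125213510789274, 9, 248028036333484306113813559959539951377),
   (438637393577961681329902402764406462637928, 0, 0),
   (1713427318663912817694931261902454024040, 9, 13445626791503865652),
   (6693075543078247283758106797393078120, 1, 248028036333484307078340216575212857124),
   (26144826340149403452180109156968296, 10, 248028036333484306501195185520322291540),
   (102128229137987221973145365276520, 10, 4575309709348518976383168160264076543537779546613640865633),
   (398958984661991157966208264040, 0, 4575309709348519003946039881097718540813391017719407584993),
   (1580232051384089723589388136, 0, 83975523970763751886671843120926179034725588577959210434921106001919515567841),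
   (32807002277364379965482856, 5, 1543860187045000237111782895091581395835319666426504198952998717451497479738209694600310381619088),
   (5342996752985202033592787100374624410, 10, 0),
   (20871081066348445443721824610838376, 9, 13445626791503865786),
   (1369157165947430775783171426741282891930, 9, 0),
   (5348270179482151467903013385708136296, 10, 13445626791503865817),
   (1369151973650572240955542896244953671834, 9, 0)],
  [(5348249897072547816232589438456850280, 9, 13445626791503865850),
   (20892472987003714349028362923173736, 0, 248028036333484310061416791746265753609),
   (81611222605483259175892042671976, 5, 4575309709348519058389972437201824342022524806472441800640),
   (2053709583776662450328632060530768045928, 10, 0),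
   (8022505966818387102044464262988523368, 0, 13445626791503865914),
   (2055090755501292013996286658385342326938, 10, 0),
   (8079641992521569724423785553611679898, 0, 13445626791503865946),
   (31561101533287381736030412318795624, 9, 248028036333484312422600033181088360512),
   (1709434340571510704418917501421830498458, 10, 0),
   (6677477892857463689136396489929025384, 9, 13445626791503865994),
   (1709439532868369239246546031918159718554, 10, 0),
   (6677498175267067340806820437180311400, 10, 13445626791503866025),
   (26084769845538541977558850444224360, 0, 248028036333484313898339559077852489881),
   (525749653446825587284129807495876636534938, 0, 0),
   (2055090755501292013996286658385359104154, 0, 13445626791503866073),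
   (8027698263676921929672994759317809000, 10, 13445626791503866089),
   (8022505966818387102044464262988588904, 0, 13445626791503866106),
   (31561101533287381736030412318861160, 0, 248028036333484315078931179795263793417),
   (123285552864403834906368798123880, 5, 4575309709348519145503504520208119349048159059200233711808),
   (481584190876577480103037527912, 4, 83975523970763754497946165041785376931948787943596120188889174912049515341856),
   (1709439533185281889303603383391846295400, 9, 0),
   (437615191267436378745849562341252371277978, 0, 0),
   (1709491557726852301647978799976451369114, 0, 13445626791503866201),
   (6677701397370516803312417187408013160, 10, 248028036333484317126519771977024022848),
   (26084771083478581262939129638315880, 5, 248028036333484317440046867222794086777),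
   (525749653527955225698736489473140600760168, 0, 0),
   (2055090836630930428602968635649323329384, 0, 13445626791503866265),
   (8079723122159984331105762817592682344, 10, 74983466780079974416061592687644518816),
   (31561418445937438793381886006290280, 5, 248028036333484318602259297873788152192),
   (123286790804443120286647992215400, 5, 4575309709348519205391954946809614107065897146258589493632),
   (481589026579855938619736352616, 4, 84399567266310567841371907546231384739883288879595102425387306449753946270000),
   (1881216727673008950452184936, 1, 83975523970763755703149698236028083653777236976150977221823896141234844281136),
   (346960088761655629728095157821127485594, 9, 0),
   (1355312846725217303625371710238779240, 9, 13445626791503866378),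
   (5294190807520380092286608260753256, 4, 13445626791503866394),
   (20680432841876484735494597928808, 4, 246781885087435962055894059083954661929),
   (1350120549866682475996836820377102490, 9, 0),
   (5273908397916728421862643829598056, 10, 13445626791503866441),
   (348310085944874684911511960966817867930, 9, 0),
   (1360586273222166737935593597526632296, 10, 13445626791503866473)],
  [(348304893648016150083883430470488647834, 10, 0),
   (1360565990812563086265169650275346280, 10, 13445626791503866505),
   (5315663506162120207438266595043176, 0, 248028036333484322162480904099731614361),
   (20764310570945782060305746519912, 4, 4575309709348519281615205137337456386097331394065854376528),
   (348310085944874684911513086866723858280, 9, 0),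
   (1360586273222166737935599099597973352, 4, 13445626791503866569),
   (348310085944874684911513088022104467610, 4, 0),
   (1360586273222166737935600254978582682, 9, 13445626791503866596),
   (5314790129774088820060938496010088, 10, 248028036333484324505217401460844669652),
   (89166052773892134421474446430821027375258, 0, 0),
   (348304893648016150083884839000751958170, 9, 13445626791503866644),
   (1360565990812563086265175152346687336, 10, 13445626791503866665),
   (5314710901611574555723344952059752, 4, 248028036333484325704187563202181409593),
   (20764310570945782060331734558568, 0, 4575309709348519314283558512993597240163619429372770200244),
   (81110588167756961173170841448, 5, 84399567266310570252200140825391916981494876673320466821272563269653853383216),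
   (348310187356922703169864080703073380200, 9, 0),
   (1360586669362979309257281565246383976, 5, 13445626791503866745),
   (348310187356922703169865206602980222824, 5, 0),
   (1360586669362979309257285963292895080, 5, 13445626791503866777),
   (5314791677199137926786277606713192, 4, 248028036333484327751844358433725754245),
   (348310187356922703169864079603561817960, 9, 0),
   (1360586669362979309257281569759586152, 4, 13445626791503866825),
   (348310187356922703169865207758343268200, 9, 0),
   (1360586669362979309257288222680704872, 4, 13445626791503866857),
   (5314791677199137926786282119915368, 5, 248028036333484329227583884330489883604),
   (89167407963372212011485204378511808620698, 0, 0),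
   (348310187356922703169864079603562670234, 9, 13445626791503866901),
   (1360586669362979309257285967806949530, 4, 13445626791503866917),
   (1360586669362979309257281569760438426, 4, 13445626791503866937),
   (5314791677199137926786282120767642, 4, 248028036333484330408175505047901187141),
   (20760904989059132526508914534248, 10, 4575309709348519428278151431507982503862101453927890299828),
   (346960190173703647986447277557383063400, 9, 0),
   (1355313242866029874947060781983360872, 4, 13445626791503867001),
   (346960190173703647986447278712763672730, 9, 0),
   (1355313242866029874947061937363970202, 4, 13445626791503867033),
   (5294192354945429199011960692828008, 10, 248028036333484332474210841303370968196),
   (346960190173703647986446151657477073050, 9, 0),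
   (1355313242866029874947055279912019816, 10, 13445626791503867081),
   (346960190173703647986446150557965445274, 9, 0),
   (1355313242866029874947055275617052520, 9, 13445626791503867114)],
  [(5294192354945429199011934704789352, 4, 248028036333484333378101300915138997497),
   (346960190173703647986447560187723606170, 4, 6372957439434826953),
   (1355313242866029874947061937347192986, 10, 13445626791503867156),
   (1355313242866029874947059682471667560, 9, 13445626791503867178),
   (5294192354945429199011960692762472, 9, 248028036333484334853840826811903126836),
   (20680438886505582808640471459688, 5, 4575309709348519461285541022839013465786183454691301534980),
   (345630962177918732113543753127442409320, 9, 0),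
   (1350120946007495047318530285654140776, 5, 13445626791503867241),
   (345630962177918732113543753127443261594, 9, 0),
   (1350120946007495047318530285654993050, 9, 13445626791503867269),
   (5273909945341777528588008928339816, 10, 248028036333484336901429418993663356277),
   (88481526317547195421067128743031218858138, 0, 0),
   (345630962177918732113543471652465698664, 10, 13445626791503867321),
   (1350120946007495047318529186142513000, 5, 13445626791503867337),
   (5273909945341777528588004633372520, 5, 248028036333484338100400229777491897817),
   (20601210723991318471046927509352, 4, 4575309709348519542953309083864244699947568290096318786405),
   (89166078735376427095612589083302655846248, 0, 0),
   (348304995060064168342236676106651002728, 10, 13445626791503867397),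
   (1360566386953375657586862016041609064, 9, 245167609461428772738196074435764563477),
   (89166078735376427095612300852926504986778, 0, 0),
   (348304995060064168342235550206744160104, 9, 13445626791503867450),
   (1360566386953375657586857617995097960, 5, 180200184159436614849552009786144337481),
   (5314712449036623662448684062762856, 4, 248028036333484339557760565607838789205),
   (89166078735376427095612300571451545053338, 0, 0),
   (348304995060064168342235549107233450138, 10, 13445626791503867509),
   (1360566386953375657586857613700130664, 9, 248028036333484341347026537694999424101),
   (5314712449036623662448679767795560, 4, 248028036333484340756798930398959644309),
   (5314712449036623662448662587926376, 4, 248028036333484340756798930398959644329),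
   (20760595504049311181440189753192, 4, 4575309709348519608287523532684429688457267779160931053237),
   (81116632796855034319044372328, 0, 84399567266310571959594800283682073377153457881638834499051838552266549243380),
   (316866717091678798382393192, 1, 84399567266310575876483295731857881683255200628550438915431763469339685038580),
   (2075060451548739102955150493734479226728, 0, 0),
   (437615217249203081023639375135050911344488, 0, 0),
   (2053787590401847790519877622387600680808, 0, 13445626791503867653),
   (8105704888862262120918556616150378344, 9, 248028036333484343320896356644587319056),
   (31662909722118211409838111781840744, 10, 4522839694402110952757503105573219548603401884290851876640),
   (123683241102024263319684436748136, 4, 4575309709348519678725961512122699481430672313494118870752),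
   (483137660554782278592534964072, 4, 84399567266310576579518690095166127270975229149758193298269868123247943364320),
   (1888470282590696725500421992, 1, 84399567266310576673697982696980550038890333894267543266229255469096506502880),
   (7381707270333729657612136, 1, 1556897217293465294144307237269737057000593068456471195570837193149124649493630929076372210986720)],
  [(128152352645954609375080, 6, 28479193756008482304971082358011184973476251528451313271172387895948905451434353296267015261222428183294746446278512),
   (500595127523261048680, 11, 28517672332727215766052557261197960276156841570030127532170065660773587560577144618432295728841171712327845834665856),
   (2533037533103155048, 11, 526058201577025504366611092819115068879660733444633823863600549743945031670970736124473859276312601488024401511770519062509033248337808),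
   (9894677863688040, 8, 529784670153242838061164050156536144889896342107485119043952903755516984442200959080573772330958225176249198527995570434120038937079712),
   (1355374013347399096902182474103818923, 9, 13440315118981355701),
   (5294432839329078573156142798244523, 9, 248028031262959317497356854256542429121),
   (21006342379644262929857463880363, 0, 13445626791503867861),
   (90107475878477805161860991659, 0, 248028036333484347821883896506086338533),
   (10879313364213467568317041323, 1, 4569179610267801998285131533782572449125238229991792062448),
   (1367817573959731764744946522656965561003, 1, 0),
   (5343037401379893006885832692182190763, 1, 13445626791503867929),
   (20871244186771047194413396906379947, 5, 13445626791503867937),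
   (81528297604574403103177566751403, 5, 248028036333484349297605407729471467569),
   (319431027453457069795017657003, 0, 4569179820721161005027130664741181752121401598562314235969),
   (345625668310555853999033301808097954475, 9, 0),
   (1350100269937799605534609168963111595, 1, 13445626791503868009),
   (345625750233715113623541642983379733163, 1, 0),
   (1350101380371294680418604929415547563, 9, 13445626791503868033),
   (5273833517075369845385175740615339, 5, 248028036333484351068528867602598998129),
   (345625750233715113623541644143073266347, 1, 13441370649892362421),
   (1350100586850449662591959607615785643, 9, 13445626791503868085),
   (5273833517075369845385240217488043, 9, 248028031262959322219723337126187643073),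
   (20600912176075663458536094599851, 8, 4575309709348519820283438124429092435510594198322105299105),
   (318502572423993034588843313835, 0, 4563049838559124751731581943863792955846801463968231600353),
   (1280437357114339145942731435, 0, 84286490779601349385520141298579943693535783309817192458782545100946260635889),
   (42497317828958871043607211, 4, 1554811260624958578367242530442826932349746059497764850584866811958575364243459059911620803178752),
   (6750474685509139778001730787779123883, 5, 0),
   (104334706584560413482695486377401003, 0, 13445626791503868197),
   (1729450747486124699041273392963082885803, 0, 0),
   (28038912881432381724400355804241828523, 5, 13445626791503868224),
   (1367885134666121528459128691011181189803, 0, 0),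
   (5426438986582758732726454223827999403, 0, 13445626791503868261),
   (109527003443095241111225982706621099, 4, 248028036333484354536516753459994702192),
   (488769413863860912085559792999083, 1, 4575309709348519878812005234830508153848911079057980207488),
   (347038034696826983086830936854253640363, 5, 0),
   (1438755792748856131841101181364050603, 0, 13445626791503868325),
   (5681859793243706366684194499304107, 1, 13445626791503868341),
   (489562934708878738153698170084011, 1, 248028029995237400090503155377821987264),
   (368321482943707169732658970166804716203, 0, 0),
   (28039116022768706269284362735036504747, 1, 13445626791503868384)],
  [(347053835011148515766198057202319202987, 0, 0),
   (6771468090210052302823449770550991531, 1, 13445626791503868416),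
   (125328111285472938304414469149268651, 5, 248028036333484357414208828958684754448),
   (1728105922317354575033887050828647865003, 0, 0),
   (26694087712662257717014013669806807723, 5, 13445626791503868464),
   (347032842399968448259202984701040630443, 0, 0),
   (1433563495890321304213149028151040683, 5, 13445626791503868496),
   (104335500105405431309341967870696107, 1, 248028036333484358963735331150287090272),
   (345708806701042067213927708137089505963, 0, 5451705712293064629),
   (5426439780103603750553100705321294507, 1, 13445626791503868544),
   (1350486746153764062156661086883519147, 1, 13445626791503868565),
   (21258750368848189252854026603174571, 1, 248028036333484360439474857047051219616),
   (489562934708878738732041286294187, 4, 4575309709348519933257183942180662313836466139850418959024),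
   (1912355213706557573232218184363, 9, 84399567266310582172439323757811676403062813271923156555549236460155695346368),
   (10879313364213470987163376299, 8, 84399565540900323648002024398829966990348800284343794280045754697999894786768),
   (368321482943707169751321885862934518443, 0, 0),
   (28039116022768706287947278431166306987, 1, 13445626791503868656),
   (347053835011148515784860972898449005227, 0, 0),
   (6771468090210052321486365466680793771, 1, 13445626791503868688),
   (125328111285472956967330165279070891, 5, 248028036333484362431723217007682794272),
   (1713484414363720500431944594757970991787, 0, 13445592774543022257),
   (6693360213586101691913963402057915051, 5, 13445626791503868737),
   (47220234661522327394928100656192171, 0, 248028036333484363981249718924411417425),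
   (489562934708878738153633693211307, 9, 4575309709348520025813987739605399349755671953723974759264),
   (1367885134666121528459128690946704317099, 9, 3146134284600029104),
   (5426438986582758732726454159351126699, 5, 247866424771352237658597432797378392960),
   (21197030391029702150598045335198379, 1, 248028036333484365235155438276431131536),
   (345646498345218804264558695635168697003, 5, 0),
   (88480186664392874228235410854301882030763, 0, 0),
   (345724403874027275348483722413634919083, 0, 13445626791503868869),
   (1350485952632919044330014540913351339, 9, 248028036333484366342432960634107737008),
   (5275338852163140867799453075675819, 1, 248028036333484366711367842108298769317),
   (83041993628313239268956746455723, 1, 4414397686326812293073909508159463573859563937980354671600),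
   (1912355213706557573167741311659, 4, 84399567266310583302164386675632739713720725213835666151527611987284989064192),
   (7470137553541240520438356651, 8, 84399567266310582398414986231732184097486182853281300431143501123045801931792),
   (42497317828958871043611307, 8, 1556897217293465397778651146237868522318701239657914286070183146849209117530886149113094309229600),
   (166005147769370590014123, 10, 28719684516483125582272046018285971200648663284869476025802267676157824344753861678858595510401345491584679890990128),
   (10680759136772903112356027454458600091, 5, 0),
   (41721719715649992918902999651883675, 5, 13445626791503869009),
   (1712098010255262890500115398925633624731, 1, 0)],
  [(6687883962993115740899216173528947355, 5, 13445626791503869041),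
   (1712098009461742045482289608903568824987, 5, 0),
   (6687883169472270723073426151464147611, 5, 13445626791503869073),
   (26124546730441858362887563412937371, 9, 248028036333484369589059917606988821665),
   (163062437767720220235081766836891, 0, 4575309709348520130620956756324971133292850012752647828657),
   (1712098091384901305106797094714420456091, 1, 0),
   (6687883962993115740899216173310634651, 9, 13445626791503869137),
   (1712098009461742045482289608903350512283, 1, 0),
   (6687882852559620666016075777070033563, 1, 13445626791503869177),
   (26124546730441858362887563194624667, 5, 248028036333484371433734324977943983361),
   (350968542571509036646616969198342466203, 1, 13290221888349548473),
   (1370971979853452249283987932189256347, 5, 13445626791503869217),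
   (5355359296302547848765577877744283, 9, 248028036333484372834965649652841067825),
   (163062437767720220235081548524187, 0, 2370306786063009333612210452238047890074248755368642491713),
   (636962647530157110293288151707, 10, 4575309709348520163288063980735063628728291377995924387153),
   (88824461927880435577796794978639272176283, 0, 0),
   (346970575402485237631000606761099422363, 9, 13445626791503869297),
   (1355353810165957959496096120178174619, 5, 248028036333484374385137344510799517873),
   (5356626946902776078167074580949659, 0, 140442448782283170511776753981886313877),
   (164330088367948449636578251729563, 0, 2590705909771839309534232463950250223337580532011933644193),
   (641914407687298631392884648603, 10, 3384848016924202774094178420801794895236768341149168448864),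
   (2518377396399719407486986907, 10, 62439425096604065593594907062065539590102190977963509181384737111025986319712),
   (42497317828958857688738459, 8, 1156497425756018820130808027232490414250179820783104243994914950164114676040398238572246528439760),
   (347032781552739637304191728265854622363, 5, 0),
   (1433502648661510349201892592965032603, 5, 13445626791503869424),
   (5600730154829099685582155178220187, 1, 13445626791503869445),
   (408433296294272057051658849000091, 1, 248028029995237420455708612753166972432),
   (2785104221238648572713823279771, 4, 4575309615813842740221246864066877909873126792719583229472),
   (6750495047146905943936492328574356123, 5, 0),
   (104355068222326579417457027172633243, 0, 13445626791503869509),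
   (1729455960065392837520572347406663387803, 0, 0),
   (28044125460700520203699310247822330523, 5, 13445626791503869536),
   (347058844449080329700613004715105028763, 5, 0),
   (1459565545002202745623169042215439003, 0, 13445626791503869573),
   (130337549217286872719361981935094427, 1, 248028036333484378738644978166926423696),
   (509131051630026846847100588231323, 4, 4575309709348520325262470635101772241943184022023676704416),
   (88480171087502298623752525265072099527323, 0, 0),
   (345625750233715113623541645242584894107, 5, 13445626791503869633),
   (5343383312776650160167037810816682651, 0, 13445626791503869649),
   (21279032778451840923279073366084251, 0, 248028036333484380798848087759965402849)],
  [(509845344312530409157088049203867, 4, 3252552334827951510497372496257969118615731493511594260208),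
   (1991583376220821910825762130587, 10, 84399567266310589001720580389715660450072635163656903862724787676871667300096),
   (10879313364213470987163372187, 9, 1556897217293465496086134908719318441649671347812175263196743613710837052088951469721770241636112),
   (346981142855129028198061545954134886811, 1, 0),
   (6698775934190564734686938522366675355, 0, 13445626791503869745),
   (347064219604865585440118033895402408347, 0, 0),
   (6781852683927121976743426463634196891, 0, 13445626791503869777),
   (26674470973311232025250739318851995, 10, 248028036333484383092076579562380605248),
   (712986680637093882598257672751515, 5, 248028036333466249499930265304112838512),
   (1714813682924324623608189249712753904027, 1, 13369524163412367536),
   (6755708340707726926797177252511123867, 10, 13445626791503869840),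
   (26390199998572061869534273585449371, 10, 248028036333484384272668200279790925728),
   (428715705897923726881791939348891, 5, 248028036333484383848393086584472221616),
   (2785104221238647978899662342555, 5, 4575309709348520403187132659996680381844370943367308195776),
   (1511752586028011925295703942815713691, 1, 0),
   (182524590243096052391896882535369115, 1, 13445626791503869920),
   (345651914859344112325305514356139264411, 1, 0),
   (5369547938405648861930906924371052955, 0, 13445626791503869953),
   (353679205802638955839013661681113532827, 1, 0),
   (13396838881700492375639054249345321371, 1, 13445626791503869984),
   (52635955265985370315678683249674651, 4, 248028036333484386928999346893967341584),
   (712986680637094030373719957473691, 10, 4575309709348520439257063553616139377435968353131941607488),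
   (368331867537424239406651004449630882203, 0, 0),
   (28049500616485775943276397017862670747, 1, 13445626791503870048),
   (353684398099497490666566474304900991387, 0, 0),
   (13402031178559027203191866873132779931, 1, 13445626791503870080),
   (109751220709868474153796270329334171, 10, 248028036333484388109590967611378645136),
   (3429517797486866099654100934722297956763, 0, 0),
   (26694128277481465020354860404615842203, 10, 13445626791503870128),
   (353678921531664216668710747000994957723, 0, 0),
   (1433502648661510349201876026703645083, 10, 13445626791503870160),
   (104274652876594476298068966423300507, 1, 248028036333484389751351190171528739040),
   (1374531316003386160144815219528885242267, 0, 6599082453027139505),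
   (5369263667430909691627992244252477851, 10, 13445626791503870209),
   (5426480344922811053893947440130328987, 10, 13445626791503870224),
   (21197903140037234241581025155778971, 10, 248028036333484391356217924584259729680),
   (428715705897923727459039838898587, 4, 4575309709348520501188454333226957864904068082124257769776),
   (2785104221238648556147561892251, 5, 84399567266310591138883399649996411151957717278191899444556095254358275471680),
   (1511752586028007129142245933730863771, 0, 0),
   (182524590243091256238438873450519195, 1, 13445626791503870304)],
  [(346981142855129028179398629154198493851, 1, 0),
   (6698775934190564716024021722430282395, 0, 13445626791503870337),
   (347064219604865585421455117095466015387, 1, 0),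
   (6781852683927121958080509663697803931, 1, 13445626791503870368),
   (26674470973311213362333939382459035, 10, 248028036333484394012549071198435162512),
   (712986680637075219681457736358555, 5, 4575309709348520571967186652782140135235614975826011896256),
   (1367827959346969679418030229091787578011, 1, 0),
   (5343079076632595385110676403024140955, 5, 13445626791503870433),
   (345651630588369373155002599736202599067, 5, 0),
   (1350202792419312938770724725853887131, 5, 13445626791503870465),
   (20974796634397065866917665573542555, 0, 248028036333484395266927668210684672529),
   (345625953375051438187162863029891734171, 1, 0),
   (5343586454112974723788255598123522715, 0, 13445626791503870513),
   (345709030124787995429219350971159255707, 1, 0),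
   (5426663203849531965844743539391044251, 0, 13445626791503870545),
   (21482174114776404544496860672924315, 5, 248028036333484397259176028171316247104),
   (88480171107784708227404195686820327561883, 0, 0),
   (345708847265861274517268554932080450203, 5, 13445626791503870592),
   (1350527310972971365497507881874463387, 1, 13445626791503870613),
   (5343403595186253811837459559044717211, 0, 13445626791503870625),
   (21299315188055492593700821594118811, 0, 248028036333484398808702530362918582945),
   (83914742635845330251996748946075, 10, 4575309709348520657378060749937712603152302143507098778144),
   (2785104221238648556207743802011, 4, 81992585519989411794635045257585524072151196364551290316105802884225531132624),
   (1373144871330109342909645457277022013851, 1, 0),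
   (5363848264066734695624798332454078875, 5, 13445626791503870705),
   (1373144870615816660406083149479994362267, 1, 0),
   (5363847549774052192062490535426427291, 1, 13445626791503870741),
   (20952532281510682404784368704457115, 10, 248028036333484400284442056259682712353),
   (88485488019767847890895810915005561997723, 0, 0),
   (345646437577218155823811761386958784923, 10, 13445626791503870789),
   (1350181795717026783537992925688007067, 1, 13445626791503870805),
   (1350182510009709287100300722715658651, 5, 13062172476473097057),
   (5274150429725426902735549916416411, 10, 248028036333484402350477392515152493409),
   (81853571190599274205053587196315, 0, 4575309709348520724406613549749257626278145937024606026625),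
   (88825765194391927819531556991941000989083, 0, 0),
   (346975645290593468045045144499987843483, 5, 13445626791503870890),
   (1355373617206586525580497860753525147, 1, 248028036333484403615309092897617489845),
   (438637367514986112474991642811325718628763, 0, 0),
   (1713427216858204707646465644996791536027, 1, 13445626791503870938),
   (6693075070189992979380272034443069851, 5, 142857453678758443865694684764926131169)],
  [(26145621421670652676690800473180571, 0, 248028036333484404803894354318522858433),
   (90188223788659418570999607108992097749403, 0, 0),
   (352349693535879300795806939945009580443, 0, 13445626791503871002),
   (12067326614940837332432332513241368987, 1, 240954552720133989912971856969116695584),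
   (47137994589612645829813799098157467, 5, 248028036333484405984485975035934161920),
   (47139105023107720713809563845560731, 10, 240954552720133989746567705990698974272),
   (184137128996514534038318827080091, 5, 4575309709348520822415008706592867389972536472219149155328),
   (723932775992592509264582052251, 4, 81992585519989411794504562515660805279151642430116037271687852870632949693328),
   (10879313364213470922686499227, 9, 1556897217293465635036641995224163212176511554178118133951070440115969321687558712737458058968176),
   (42497317828958871043606939, 8, 1556897217293465523876236327400615610670480961913258097933109276440627654574488282391902482939008),
   (350963410407586630270438260314252733083, 5, 0),
   (1370950821904635274493899454353468059, 9, 13445626791503871141),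
   (346970534123373347824098308637082479259, 5, 0),
   (1355353648919427139937884018114521755, 5, 13445626791503871177),
   (5356465700371956519954972517296795, 0, 248028036333484408327222472397047217365),
   (1712092817082865142349367203898501589659, 5, 13436578980617662393),
   (6688106193959542586154215062490278555, 0, 13445626791503871225),
   (10743351048950584738606018838435162779, 5, 13445626791503871232),
   (41966215034963221635179761088555675, 5, 248028036333484410098109903473164172544),
   (164168841837128891424476188076699, 1, 4516995193456381501755024696527072102542723586868022099168),
   (438295761173134248278923739860422644689563, 0, 0),
   (2734331514333015045804242347759334025883, 0, 13445626791503871301),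
   (10681043407420004292799315288957348507, 1, 248028036333484411204905716619653814448),
   (41722828909925192619631508072131227, 9, 237378334971636699828103427109464063329),
   (164171632042919920963590187084443, 9, 4378857393865080096845861147390413307762685146579254394224),
   (641295437667655941264025021083, 10, 54439492666554628418615259924869376910539696643831727616983928323803514486064),
   (345641306048360269436930165147429411483, 5, 0),
   (1350161351751407302488008457825458843, 10, 13445626791503871397),
   (345641306048360269436930165142916131483, 5, 0),
   (1350161351751407302488008457590368923, 10, 13445626791503871429),
   (5274067780278934775343783038380699, 9, 248028036333484413068035699340401982933),
   (88484158751207243767719566261150290713243, 0, 0),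
   (345641245121903295967654555707836635803, 5, 13445626791503871482),
   (1350161113757434749873650608468826779, 9, 13445626791503871493),
   (1350161113757434749873650608250514075, 10, 13445626791503871513),
   (5274066850614979491693947689331355, 10, 248028036333484414820476386342809386533),
   (20601827314012117055342008298139, 1, 2590705909771840050328945255903810251797873640660372831797),
   (1371810511088383652355268205906577812123, 5, 0),
   (5358634808938998642012766429323422363, 10, 13445626791503871573),
   (1371810450161617193876171251402555222683, 5, 0)],
  [(5358634570943817163578793950792084123, 5, 13445626791503871610),
   (20932167222460538606968654575135387, 1, 248028036333484416314662656313283067525),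
   (1371810450161926678885992596471498316443, 5, 0),
   (5358634809259382893205320639959440027, 1, 13445626791503871653),
   (1371810450164716884677022136744886835867, 5, 0),
   (5358634812049588684234860913347959451, 5, 13445626791503871681),
   (20932167234568705797792425661078171, 10, 248028036333484418288464272200205090481),
   (351183475241453229794814104696643167677083, 0, 0),
   (1371810450164716884677022136740373555867, 10, 13445626791503871729),
   (5358634570955925330769617721642936987, 5, 13445626791503871754),
   (5358634809259382893205320639724350107, 1, 13445626791503871765),
   (20932167234568705797792425425988251, 1, 248028036333484419856437518465516977941),
   (81766278260034007022626662738587, 9, 4575309709348521045640241406728499435892017467183516892817),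
   (350161298912615401326036812729698552027803, 0, 0),
   (1367817634806960575699957794503014390427, 1, 13445626791503871829),
   (5343037639064380549678845477109013147, 9, 243501330862114350066350403211565743969),
   (1367817634804170369908928254229625871003, 5, 0),
   (5343037636274174758649305203720493723, 9, 140442448782283217956802511562853072769),
   (20871240777595236522182990363269787, 10, 248028036333484421239943323993733349265),
   (350161314509867614696685633082723821644443, 0, 0),
   (1367817634804170369908928254229390781083, 5, 13445626791503871930),
   (5343037635964689748827960134760622747, 1, 248028036333484422807907521348664176565),
   (20871240777595236522182990128179867, 9, 248028036333484422217620759900339584977),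
   (20871240765487069331359219277327003, 9, 248028036333484422217620759900339584997),
   (81528284287481392664777306106523, 9, 4575309709348521110974455855548684424106569051055894577137),
   (319417710360446631394757012123, 0, 47790088887808005005108662754801133448348415404844130103725619683460352327233),
   (89846633064342177349232121456954536585883, 0, 0),
   (350963411121879312773927089999775754907, 1, 13445626791503872042),
   (2734274399861092007718081679578762799771, 1, 0),
   (10681044200940849310552482568007543451, 0, 248028036333484425169099811693867843633),
   (42027937802987499693495589435566747, 9, 4522839646880116968419545213292858621338305992834763735120),
   (699974230563331711598131716496639656422043, 0, 0),
   (2734274338141114189231052616991391574683, 1, 13445626791503872121),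
   (10686174777821565651151950476965538459, 0, 248028036333484426320940908834812276657),
   (2750297848248940089431397215202500582043, 0, 0),
   (89846617446886782537445895017575559633563, 0, 0),
   (2734331515126535890821995515042897500827, 1, 13445626791503872176),
   (10743351763243267242094848528471464603, 9, 248028036333484426773966546106598834368),
   (41966217825169012664433002064341659, 10, 4575309709348521214017519523606491882405657273257650307216),
   (164171632042919920677717163862683, 5, 4575309709348521175968387937447930950259698577098428989664)],
  [(1712098009379723677176995733278139312795, 9, 0),
   (438297090401130033194796643381610120125083, 0, 0),
   (1712098009382513882968024987636024908443, 9, 13445626791503872273),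
   (6687882849150444855343847607953222299, 10, 248028036333484429282723740131097854209),
   (26125414831053704598372923061267099, 0, 4575309709348521246979817036372868612445164092009166805169),
   (163930538379566455720441415166619, 5, 4575309709348521225201745553432806949608597700042969596224),
   (641295437667655940147333524123, 5, 84399567266310605000273731559592934884904671811619892310350687802836171964752),
   (2505060303389281020581210779, 4, 1556897217293465714664989912119203073162502612280331739722161203518544507497620355677783369728016),
   (9837411704686403987663515, 8, 881571538973224933424112976768652144909787659488305977176254153951505181571807615807264354484593),
   (166005147769370590014107, 8, 16262124562105346056435134381732092422346130214917025652183308685107324475900733928454918573496566816632548812145024),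
   (648457608474103867242, 11, 28719684516483125618583825628941443090549536958816541076277207284430639819233382749510977697912056798225256382808464),
   (438638696742823441065836017942099399449243, 0, 0),
   (1713432409392747730016887187174240983707, 1, 13445626791503872437),
   (6693095669512246688108045256358533787, 4, 121664139244208519231609134119551779265),
   (46955690587667323589009954956810907, 0, 4575309709348521299658183666083225409724651902728575926737),
   (88828444399288522186936134823728953072283, 0, 0),
   (355028999844521686458736891469218093723, 5, 13445626791503872496),
   (14746632923583222995362284037449882267, 1, 175932999994039318092454920536856740352),
   (57604034857746964825919855425919643, 4, 4575309709348521321525381227386552447401733574713144394144),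
   (225018860853874932235487993830043, 9, 84399565540900348254335955145736632741282221658912820653396992129713113678304),
   (878979925210448954044874975899, 10, 84399567266310607003470989826336361136131033503040191142254354320669349069360),
   (14725842739446797529688623705775106715, 9, 7613400386767176256),
   (353632169704778792036292278634206947995, 9, 0),
   (13349802783840328572917671202438736539, 0, 140442448465375416958466329071091466849),
   (57522825991169843879600599635290779, 10, 4561517249480929062619039324067360704521778303351062020720),
   (3417549511869603269649170360429896493723, 0, 0),
   (14725842660218635015424286112214379163, 10, 13445626791503872656),
   (90529835444423370761290823330352683719323, 0, 0),
   (3417549512663124114666923827820021586587, 1, 13445626791503872688),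
   (14725843453739480033177753502339472027, 10, 248028031262959405967941431767551984320),
   (57522825991169843879600599618513563, 9, 4575309709348521388644867263034470623127137340570704560704),
   (224698539028007202654689843178139, 5, 84399567266310607513099029513841921496086618003360044324496276269963589272288),
   (90529856254175624107904678283735298697883, 0, 0),
   (353632250992873531671502649545841928859, 9, 13445626791503872773),
   (438978999960219908408245116756554877987483, 0, 0),
   (3417570301418675175125619243891567323803, 0, 13445626791503872805),
   (13349884071935068208128042114073717403, 1, 4575309709348521420858804817347289810052958876756163445520),
   (52147987446202151217254513586432667, 10, 3245391025009987464710411317967359619638898977591912317761),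
   (225018860853874931949550294231707, 10, 58048405229628512605245102847442565219319588196265290405053715766795926782800),
   (878979925210448952928183478939, 4, 84399567266310607111364518449094352654265125187125851860907602473960571749216)],
  [(3433515332853316226973657755, 4, 1556897217293465853630287682598042651768385849343599238123144555732102656091186742442994917524336),
   (13464189163530291729885851, 8, 1106435232585562305001437291994658670514996783021117939976083845237616712467980312089885690380704),
   (52594488920040203053723, 8, 20410127569641170822437903214366094890859756404033584051697732091176395799800018651867776844844437719973780160332192),
   (648457608474105703067, 11, 27796200051299104108759859438279033894789741329957680077883863694822176453844881132567323260833171746509287913964448),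
   (2533037533101975402, 11, 512749388567946883345847712191201846570972188740244261881565213055116259586248090176241286733090148726826576713332346428151860795884464),
   (9894677863679591, 6, 393535681374230339155128191308311113363089618566876473910883725589205582322748709587102761794291230863903719278575310802507811465020352),
   (38651085405031, 6, 7259451998183333882415838009574769506407814954487299633298384876027414065541233591782320675992440496243557893048122193148555309124847275232432742492881872),
   (150980802407, 3, 180276381518174267108445983700358140593896863322086668890827739903175193011482345818152555683776788551503539416766606274836953926597487383274868801154431316082685228643075040),
   (589768759, 7, 163671020559163095169561028911969783882739271044446996404717791837315336137611979682462568773265513399060456009672119364594559217982073996590141908779633136084349858093286384),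
   (350158635203242059661002395156053044660618, 0, 0),
   (1709491476201073074506797145922396129674, 4, 13445626791503873040),
   (6750413600595841317020301703274727818, 6, 248012177949909043063650606759803896864),
   (26368807155473372138547416139467146, 1, 248028036333484443689629702958211023872),
   (103086718744458939535725724076426, 1, 4575308963982686473747160538376806646224943671838795514880),
   (1674670726200587415989467646346, 5, 4156292254726237698833903450433582515528333175530275750992),
   (10879313401036326525044689290, 5, 76674807460583929025873217909506443467418108794659486010695400506536549762144),
   (42497317972798219442882954, 11, 4575309709348521528500920066034921398620655393537359168624),
   (166005148331243279649162, 11, 84399567266310610701866710739515356705560167059038429927158669537408411845760),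
   (648457610669690882442, 4, 1556897217293465922280630399627714499021054553483745256511076931401078783561174925029840618865808),
   (1350100346685241338446354963813271946, 6, 12213963762464605195),
   (5273829479239223978306156218714506, 4, 141689898082739194569095378415456896182),
   (20600896441131013226910396877194, 1, 248028036333484446438194833823976539140),
   (80472313187794996417818954122, 1, 2613717287762279608066772599440092512076831769460070302724),
   (315695644066623618100660618, 0, 2613714678981856977849581436191318646945972029857714947300),
   (6210634245278549375879562, 0, 48214525495342586966135034550804297654462643908593845673262962249686181758193),
   (166005147205403502348682, 5, 889401012446676840745163096729922089773022916620178784279350189702688910968665949367771346257152),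
   (1369162358722139006459079889780005833098, 4, 0),
   (5348291020836213856597377925464623498, 1, 13445626791503873316),
   (20891764280862223143567458725169546, 11, 225339017343436662751360887689994847537),
   (20891761800141460377333508024732042, 11, 248028036333484448687468531489517421572),
   (81608454222118059154560889031050, 11, 4575309709348521599256963368105331733494512943084069733713),
   (318812057433742058241172081034, 0, 4575309709348521612210361279415250674670925298253375227233),
   (1899407376684707866996279690, 0, 33740528413704403411997366529542780256404965391750539750347527213212734866801),
   (42497317756637454647593354, 6, 33740528144102879960229387188959957933612112367148628777657838282628997858688),
   (345656821854022575403498036036344908170, 4, 0),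
   (1386770945729364321412007423735662986, 0, 13445626791503873444),
   (1375855249259059190352605282220574935434, 4, 0),
   (14725781575305336499106852493502089610, 4, 13445626791503873472),
   (57542949944448448508200363455318410, 1, 248028036333484451326582908214012036528),
   (355008149527449127800805271143741819274, 4, 12216936913561601024)],
  [(1386771976934692159735818642207181194, 1, 13445626791503873524),
   (57543981149776286832011581926836618, 0, 244879862623316578000566546106869106177),
   (224781176366313625787837777086858, 6, 4575309709348521669718102339729641459226855556336693888000),
   (1674670726145251124418012940682, 11, 4575309703502604328795716891734120760919556701428690994720),
   (89168705915892388091741573867917828327818, 0, 0),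
   (2056419984132141445117674365385166195082, 0, 13445626791503873601),
   (8032911955859271524250911026192222602, 4, 248028036333484453631197262657630585856),
   (57543981149776286828068664510155146, 6, 35351557008091341508659318092098192992),
   (224781176366313621844920360405386, 6, 4575309709348521702172533084814340841654317425294761543280),
   (878051470180912600733976267146, 11, 4575309709348521681287702815041549219988336619515390477313),
   (6541682524004887204992813450, 11, 84399567266310613413574660771475922474999802341773491396618744026419539494544),
   (25553447359394091147889034, 5, 84399567266310614147995563817563489103573473442909315038039913985225150187168),
   (166005147486878479059338, 5, 622402887587312283088171095859653257282628299846920978095751279688527836674567743295368024114864),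
   (648457611902346496394, 3, 16406569322822774852083354202400608181825781114904115162761413923524521284778332478743538092123344925228220599584448),
   (2533037547030481290, 9, 302647541734013619201295570719486809170159437402292117971359930565851632664443782559951143754365076355076212750790579001993198949189328),
   (4008576464689072563265748829060303531, 1, 13443342151869154309),
   (15658501815191689710392189695658667, 4, 13445626791503873781),
   (61166040868389126870604221876907, 4, 248028031262959427292377580975793653505),
   (239583894919851261168924068523, 0, 4575309687425997197207126865355554084234265620683723654929),
   (1367807168766692441344078086141777644203, 4, 0),
   (5342996836560685666661383596577229483, 1, 13445626791503873844),
   (20871085730445981782137008716090027, 5, 248017045727905643380550623660562466625),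
   (5342996673457244825359918034049403563, 4, 13445030989581599749),
   (20871080773845159188001564551383723, 1, 248028035145062021009762217868382979940),
   (81527678634555061632145017113259, 3, 4575309709348521778948742120162465800101112347983011137393),
   (398040219948379936356011969195, 0, 4575309709348521794942013366634996019689793501554626545537),
   (1899407377058248388292217515, 0, 84399567266310615616837369876124263454877535365099913724087534224875154589585),
   (42497318130177975943531179, 6, 1556897207844241046563151794308480558653427764575790073880050321940816769474009608554276851828640),
   (345630819725682531412086210269838674603, 5, 0),
   (1350120393891078174498934163216370347, 1, 13445626791503873989),
   (345630861400935219567077317887482497707, 5, 0),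
   (1350121662780884054677869073445522091, 1, 13445626791503874021),
   (5273912745237829932299003374439083, 3, 248028036333484461380058428385717667793),
   (81615886703002303768507045218987, 0, 4575309615813844297353346579310658890892976175033919490049),
   (344301612012307219190852827156809616043, 5, 0),
   (1344928176260705861134741260431100587, 1, 13445626791503874085),
   (1027524801845753977863409656140906728107, 1, 0),
   (4013768761547607262199416373650229931, 5, 13445626791503874113),
   (15700180475789988230934200150756011, 0, 248028036333484463150945859461834623025),
   (348362009548524538899684358956652268203, 5, 13445030993072374784)],
  [(8079642627586075436309751524884056747, 1, 13445626791503874160),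
   (1360790210232404833320865327621966507, 1, 13445626791503874181),
   (31562214447488960417058267341621931, 1, 248028036333484464036389574999893100688),
   (123289900185505345342711163095723, 3, 4575309709348521893283585322698459830301136734999133833312),
   (486248288395622072718040074923, 4, 4575309615813844357243054472366456375488189146749914335248),
   (88821772196413256905915297724821804780203, 0, 0),
   (1709486264653010259291398222289142647467, 0, 13445626791503874257),
   (6677681910962469690780057670490098347, 4, 248028036333484465733489433979249574912),
   (31541932037890326261022369088375467, 5, 247996276764266642815936807646549526768),
   (123210672023009527749191328697003, 5, 4575309709348521925610410504706148174929505234069272938752),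
   (481291687591474681347584920235, 3, 4575309709348521931395242501931319876189471204406377859264),
   (1899407378211169892899064491, 3, 84399565540900359502954256490704607590267242460489526289295343773593390827712),
   (42497319283099480550378155, 6, 1556897185464695454431392622685623314214122859886784959354943671423316634651327523542114075953456),
   (166005161896115817777835, 11, 1556897209833617514425770310030447697201866838241608069826800638801689193365275537864887401269568),
   (5416013986502806767715231452797438635, 4, 0),
   (99102003363143276100003211676060331, 4, 13445626791503874400),
   (344291268458778331943758074379347004075, 4, 0),
   (1345253249411501906947322330688883371, 0, 13445626791503874436),
   (345714059845129398719945040197977737899, 0, 0),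
   (1444008936836187637859011585368492715, 0, 13445626791503874468),
   (5640659909516378786454277750098603, 3, 248028036333484469625753029333887240592),
   (448363050981551157923781420878507, 1, 4575309703502604644601839162773377797521998388724346407360),
   (1047546441619564979908303073205352499883, 0, 0),
   (26699340856749589518179250910047865515, 3, 13445626791503874528),
   (1026268307046176732280615489423784118955, 3, 0),
   (5421206283361341890491667128479484587, 0, 13445626791503874563),
   (104294300221678398876438887358106283, 4, 248028036333484470787897905977588992528),
   (344384831849344483142189138317050219179, 4, 13443606035131679744),
   (1444008936836187933006916764721318571, 3, 13445626791503874608),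
   (5640659909516673934359457102924459, 3, 248028036333484472282084175656009353792),
   (448363050981846305828960773704363, 1, 4575309709348522023611763932435118450108427348708286286416),
   (1751418167899063534079806376619, 5, 84399567266310620130073517641070257408413370722646041907072944432181220231776),
   (344291269093842842819570416958770350763, 1, 13444168984548230148),
   (4008902172904379356195809527002139307, 0, 13445626791503874689),
   (16025888691096909855857849831885483, 4, 247446438255103303705956541535314004624),
   (448998115492426970266360844225195, 3, 4564581114059763374756286504981406062950968369425935256224),
   (88480160642061352729271462830482590894763, 0, 0),
   (345625627508052159523785821748093094571, 3, 13445626791503874756),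
   (1355576599758948441699793135483849387, 0, 248028036333484474938414410113048790019),
   (262704732463985821496896981809597524839083, 0, 0)],
  [(1367874668705081557025283301999538440875, 3, 13445626791503874800),
   (6745201021327703171784872272465595051, 4, 248016721363164825890765980957873818368),
   (26348603974032568795986075203504811, 1, 248028036333484476119006943279649409760),
   (15680056522511790152989821027060395, 3, 140443746599064407105903573673572322081),
   (103165946907307267398332039400107, 3, 2590729850265857346482546485122564832938237700329949907760),
   (1753898889048915278595782970027, 5, 76678893292104358610791492199473674564438882241138930217601125648221625928512),
   (6851167536141381678215563947, 11, 84399567266310621636567205542968316485722715572179591663613244429728038013776),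
   (26186344697203243958089145635146411, 3, 1242133757078445070201466297845858957573157191915556391776),
   (103165946907195792892980481329835, 11, 4564581118443197752746110810171798816493137197197857672048),
   (402991980106236683172406987435, 11, 84399567266310621937868088841528993149840607881077054611293062071972355394432),
   (1574187422294793077704460971, 5, 84399567266310621780951274047767298449854661447739934836531264448085676409857),
   (26762373188067734080555691, 5, 1556897217293466124258219022777250765017319101373127899029042725380433724492016868543375426472864),
   (104540520286849044417195, 6, 1556897217293466063119995905582137722645929694534337257745042085812965171777338302113408732122032),
   (648457663716849715883, 6, 28719684516483137137961910340960861923897494371500030898495828648059572992123917356840499881609877205584828145159104),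
   (2533037817631181483, 9, 297347564483403001406639328281090546991676264946601333531359509451763756763464717785861292538186684669351876782454749095504130632403920),
   (9894678975121802, 10, 9772802224491510510970926138659494243839843100705418307181937329775866745262230868191780296360434838140322303398230956830532985879776244617386917372185568),
   (26084056480130476976336575791725194, 6, 225333823788831048137684551573595833349),
   (122572187456338833684094145624714, 0, 13445626791503875077),
   (877729834428811140410637908618, 0, 248028036333484480878266913265921575957),
   (6220046771903426881654454922, 0, 4575309709348522200111974231221960776655253630825268268069),
   (14725863021856401162768472078412249738, 5, 12215546984750203904),
   (57522902429126567042064344325651082, 11, 13445626791503875141),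
   (407636985243463128228884704230026, 11, 248028029995237525528362856602772982864),
   (1592331973607277844644081793674, 6, 4575309709348522221868777972423319368612172146704618179680),
   (1716137697626548718535125856624982981258, 5, 0),
   (14725863021856401218252819466141923978, 0, 13445626791503875205),
   (104355068222326616310941803058133642, 11, 225328630141978348620963573000070778000),
   (407636985243463344964616771435146, 6, 248028036333484483516151316493582552224),
   (8032890877138621804681642437722602122, 0, 12216971952977429509),
   (31561418136452429116147594394434186, 11, 248028029995237527594398192858242763968),
   (407636985243463344964616419113610, 6, 248028036333484483921979686458789743824),
   (1592331973607278691268035181194, 6, 4575309709348522249218973206087844770485395187282352622816),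
   (6220046771903432435047168650, 3, 84399567266310624291791968202439604061127414782333804302548840523872863603952),
   (24297057702747782986168970, 4, 889401905141924376206185821319918796729652992579614850356526717270327013965086673572208066252032),
   (1026195614728910713614198863034326809226, 11, 0),
   (4008576620034807475055464308729805450, 5, 13445626791503875371),
   (1026195614728910713614198863056070081162, 5, 0),
   (4008576620034807475055464309082126986, 11, 13445626791503875397),
   (15658502422010966699435407458269834, 6, 248028036333484486873458738252318002485),
   (61166025085980338669669613927050, 4, 2221396698882674206436902655204738912457183732020177554789)],
  [(1026221576213203387752341515537716181642, 6, 12215089516407440389),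
   (4008678032082825733407584045338557066, 11, 13445626791503875461),
   (15658898562823538021123375178021514, 6, 248028036333484488047063868969273544085),
   (61167572511029445395013237832330, 4, 4156483866148691248139468631751121782156253414420777029029),
   (238949142491420370096866556554, 0, 4575309709348522336331259137848091419777155052231172574645),
   (1035583348378388861264354844942972582538, 5, 11982769670712282096),
   (4102423649294143891000566165425191562, 11, 225266302296647357018108092959419289040),
   (16025092380055249574220961584609930, 6, 248028036333484489529756387153956326848),
   (62598017109590818649300633483914, 6, 2221396698882674255437589734639022118507537051423749459392),
   (244523504334339135361768848010, 4, 4539389603669160419011159871642657709353898943780656008640),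
   (955169938806012247509924490, 4, 84399567266310626099561347888124302239106438649241299057881242334599874366912),
   (26714909341977041335581322, 3, 755902039037349486148315273205913341650391479380180839981611400409998578257339453247567363591712),
   (118541310455199492045450, 1, 16406569322822778919002670595813405282415247563110990267337136051021740295595951286323232842787597698580978628644400),
   (31541135726848777089098210667494026, 5, 225307862301443523901328430811274363904),
   (123207561433003035504289886337674, 6, 13445626791503875675),
   (1513103811093012960606378621578, 6, 14083916681248944258377565818068160096),
   (5910561762082081877370960522, 6, 2221398452684639096077234544940944703720327128612894756464),
   (14720670724997866317558452686293662346, 6, 12215283101959537664),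
   (57502620019522915302962705806752394, 11, 13445626791503875734),
   (387354575639811389127246185331338, 11, 248027914639034124624226170741720108704),
   (1513103811093013238778307377802, 5, 4575309709348522423337206931357592820724295610826927525552),
   (1716132505329690183634503547417697811082, 0, 0),
   (6745302750288371080207667897174686346, 11, 13445626791503875792),
   (26348838868313949532061202724256394, 6, 248028036333484494252154945104777397248),
   (387354575639811389408721078155914, 5, 14083909075352599100249991227072597744),
   (6745302750288371080207667918649522826, 11, 12214808254569595904),
   (26348838868313949532061202808142474, 11, 248028036333484495044135544368715088896),
   (102925151829351365359614075435658, 5, 248028036333484495432747988453549952774),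
   (1513103811093013239877819005578, 5, 259802266270424750059766643887747628929249228036852698928),
   (5910561762082082976882588298, 4, 48214573888381050890789199909918956678026055431869649249376622256151888023360),
   (23088131883133218252749450, 3, 889401188996464014662337939590281959661557050045590935778584363513517986330322347425487125827408),
   (1344908287201709043721378520173738634, 11, 12213963689516155910),
   (5253547996881675952036634846395018, 5, 13445626791503875963),
   (20521671862819046687643107162762, 5, 141689898082739245629682974443495772038),
   (80186964119204898371318413962, 0, 2613715183199922788023644133541825899178202680398468632469),
   (346986131296358555903314653750182378122, 6, 0),
   (1355414575376400608997322866564889226, 5, 13445626791503876022),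
   (5417392157345425579393820967664266, 0, 225313055948296223217592551844474802117),
   (21161688114630568669507114072714, 11, 248028036333484498587141224027091128277),
   (1355313163328382350645203130308459146, 6, 13443641211448607749)],
  [(5294192044251493557207824728685194, 6, 248028036333484499269668770205081420805),
   (20686319139544982643945850370698, 0, 248028036333484498974522850605783863302),
   (86996885836254869624423283338, 0, 4575309709348522526889384594558871968246623737718965817365),
   (339831585297870640324901514, 3, 84399567266310629411945391856384865717215189694193494505489222117850954616736),
   (344296521523637515321800097563837823626, 6, 0),
   (1344908287201709044225781631194593930, 5, 13445626791503876166),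
   (344296521523637515321800097564106259082, 5, 0),
   (1344908287201709044225781631463029386, 6, 13445626791503876197),
   (5253547996881675954006959498820234, 11, 248028036333484501538620276851411538005),
   (20527862814516455953381579127434, 0, 4156292304115475084291816010556399427542398368529599451269),
   (348315359292143471813111948910284864138, 5, 0),
   (1360606872234935436769968550433094282, 6, 13445626791503876261),
   (346986131296358555940208141850004519562, 5, 0),
   (1355414575376400609141438054103874186, 5, 13445626791503876294),
   (5417392157345425723509008506649226, 0, 248028036333484502719211897568822841557),
   (347058844449080324978463538979236575882, 0, 13443641211448607750),
   (1459565545002198023473703306346986122, 5, 13445626791503876336),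
   (1355698611129220019447123199223495306, 5, 13445626791503876358),
   (5701427910164836029194153626270346, 5, 248028036333484504194951423465586970896),
   (22271202774081390739039664568970, 11, 4156388060531294858070791266771834406583228088332189716704),
   (86996885836256854247239940746, 3, 4575309709348522639522848045389503379917834346788885123216),
   (347058844449080320163863335762786876042, 6, 12337146665856289776),
   (1355698611129220001937411590994885258, 3, 248028036333484505670688946198163899392),
   (5295697699723517001946043736750730, 5, 225307862306085798957643558905552327011),
   (22271202774082691719758402386570, 5, 4156549641183642961864966718665991113174145142736460730736),
   (86996885836260514530307177098, 11, 4575309709348522666745437418079339460669278038681796694336),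
   (339831585297892634885978762, 11, 84399560795923431576341363503252604185049571984597621420742787257193170424128),
   (1327467130069893108038282, 4, 1556897217293466309489376809213072016433056625669169593250838592926265467905648377531301498146864),
   (118541310455263933332106, 1, 16406554497649266897535050801896768318596163524740372525195814851630408221874742706669104554497660472177475424637360),
   (1350222278517865781368792426305194651, 5, 0),
   (5274305775460413208471846002526875, 5, 13445626791503876566),
   (345656903300573640048856745239404776091, 6, 0),
   (1350222278517865781440846661678697115, 5, 13445626791503876598),
   (345656903300573640067303489313114327707, 6, 0),
   (1350222278517865781512904255716625051, 5, 13445626791503876630),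
   (5274305775460413210453165955779227, 3, 248028036333484509507613716693937836549),
   (20602756935392239103346386569883, 4, 4575309358588129767218433627280149182779616637217930236387),
   (346986131296358555903313808225975569051, 6, 0),
   (1355414575376400608997319563969989275, 5, 13445626791503876694),
   (346986131296358555903314089700952279707, 5, 0)],
  [(1355414575376400608997320663481617051, 5, 13445626791503876726),
   (5294588185064064878895793253812891, 4, 248028036333484511278501147770054791781),
   (346986131296358555940207577848371382939, 4, 13445610153370993669),
   (1355414575376400609141435851557472923, 6, 13445626791503876773),
   (5294588185064064879458743207234203, 6, 44449108955704991438536450820302459572),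
   (20681985097906503440939930520219, 3, 4575309709348522775432215905401868254477410587478378697364),
   (82662844197775666618503432859, 0, 84399560795923433585013918826990448721392544825751182886516206051442554979331),
   (1345029981659330953743924403208096411, 5, 0),
   (5254023365856761538062205287303835, 6, 13445626791503876853),
   (346986131296358555902882310385213016731, 6, 0),
   (1355414575376400608995634025529510555, 5, 13445626791503876886),
   (346986131296358555902954367979250944667, 6, 0),
   (1355414575376400608995915500506221211, 5, 13445626791503876918),
   (5294588185064064878910099789875867, 3, 248028036333484514820276009922288702245),
   (21161688114630568683814455511707, 0, 4575309358588129865219755300510426665544165870795526001411),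
   (344327675304788724195193163510716205723, 5, 0),
   (1345029981659330953887473295551007387, 6, 13445626791503876981),
   (344327675304788724176746419437006654107, 6, 0),
   (1345029981659330953815415701513079451, 6, 13445626791503877013),
   (5254023365856761543128754868095643, 3, 248028036333484516000867630639700005797),
   (346986131296358555941000777631276894875, 3, 13443922686473421829),
   (1355414575376400610298022088549239451, 6, 13445626791503877059),
   (5294588185064064883976649370667675, 6, 248028036333484517454634832689408136147),
   (21161688114630573750364036303515, 0, 1611666452748428120972454796741174943579341503327638672307),
   (82662844197775680925039495835, 4, 84399567266310635508972768987677736729395881686819689764558442701305872601824),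
   (89168731978788728774601101106304427657883, 0, 0),
   (348315359292143471775786129561596103323, 4, 13445626791503877142),
   (1360606872234935436701585602336426651, 3, 247996601144112988495593218182030054436),
   (89168731978788728774619475792784099281563, 0, 0),
   (348315359292143471776939051066202950299, 6, 13445626791503877187),
   (1360606872234935437854507106943273627, 4, 9401411777591431342961051705482957907),
   (5314870594667716554979008457640603, 5, 248028036333484520096044815003220464691),
   (89168731978788728779341841697310628285083, 0, 0),
   (348315359292143471794304352886227372699, 5, 13445626791503877252),
   (1360606872234935436696503659592845979, 6, 248028036333484520409639464256282842260),
   (5314870594667716549615590737349275, 3, 248028036333484521310004340869452420212),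
   (5314870594667716554119190364719771, 5, 248028036333484520428086208329992393907),
   (20761213260420767792908730010267, 5, 4575309709348522922637777342625064001673932603619986658483),
   (82662844197775680993758972571, 0, 84399567266310636914624540658542402246885430661328271036570209464607288546307),
   (322901735147561254385257115, 11, 84399560795923436899323635111157892206358450013654559305487046178930141713123)],
  [(1344888004792105392555359930714589851, 5, 0),
   (5253468768719161689669375316626075, 5, 13445626791503877382),
   (345630941816280965929161684554933242523, 5, 0),
   (1350120866469847523160787830879980187, 6, 13445626791503877413),
   (345625749519422431101533154058604022427, 6, 0),
   (1350100584060243871490363883628694171, 5, 13445626791503877446),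
   (5275415290119864030541387109403291, 0, 248028036333484523969861070482226304341),
   (20607090977030720290984484833947, 3, 4575309709348523004305545384635536232430323160661047137552),
   (345630941816280965910354652601228364443, 5, 0),
   (1350120866469847523164450441551055515, 3, 13445626791503877509),
   (345630941816280965911652545813469104795, 3, 0),
   (1350120866469847524462343653791795867, 3, 13445626791503877541),
   (5273909634647841892431120326888091, 6, 248028036333484526312597567843339359635),
   (344291329226778980401938421834239871643, 5, 0),
   (1344888004792105392195072050719263387, 6, 13445626791503877589),
   (344291329226778980383491677760530320027, 5, 0),
   (1344888004792105392123014456681335451, 6, 13445626791503877621),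
   (5253468768719161693331985987701403, 3, 248028036333484527216488027455107388933),
   (345625749519422431102470759390849436315, 5, 13443922686473421827),
   (1350100584060243872791919706540509851, 6, 13445626791503877667),
   (1350100584060243871494026494299769499, 6, 13445626791503877685),
   (5273830406485327628093526782937755, 6, 248028036333484528673780809278161966659),
   (20607090977030723953595155909275, 0, 4575309709348523036972652628060387732764945074251635906067),
   (80496449129026265443966028443, 11, 84399567266310639425884251868966533575264678727069134623326811929412442805488),
   (88480191876972142361992342479260756904603, 0, 0),
   (345625749519422431102325799709123971739, 3, 13445626791503877771),
   (1350100584060243871493460155617151643, 5, 248028036333484530555347000691505775619),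
   (88480191876972142357177742281588841548443, 0, 0),
   (345625749519422431082725555856410839707, 11, 13445626791503877813),
   (1350100584060243871493460245811464859, 3, 225318248246042109689051940523586115269),
   (5273830406485327623021329320151707, 6, 248028036333484531735940325513947535013),
   (88480191876972142357269975996459831167643, 0, 0),
   (345625749519422431194559520146391206555, 5, 13445626791503877875),
   (1350100584060243871853748216001104539, 6, 248028036333484532510703576609748702947),
   (5273830406485327624428704203704987, 11, 248028036333484532815041357258028242661),
   (5273830406485327622739854343441051, 3, 248028036333484533211679851410711664358),
   (20600900025333311045028665789083, 3, 4575309709348523158453457618835419191864457818080772380469),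
   (80496449129026263232057871003, 0, 84399567266310637147295646617851048769658336318813848763337463200906708538995),
   (314439254410258850162313883, 4, 84399567266310639557703388662847222657241007392245899913517080200081362343155),
   (88139909510051203898713435318132361824923, 0, 0)],
  [(344296521523637515229349356780408965787, 11, 13445626791503878005),
   (1344908287201709043864645925158423195, 6, 248028036333484534982567265848695735301),
   (344296521523637515229421980532740885147, 11, 2682855073167529829),
   (1344908287201709043864929612043291291, 6, 225266282019189513634259654554021812133),
   (5253547996881675952597382068865691, 4, 248028036333484535868010998024887097237),
   (88139909510051203898713580272247809673883, 0, 0),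
   (344296521523637515229349923028897270427, 6, 13445626791503878101),
   (1344908287201709043864648137066580635, 11, 248028036333484536652930199530395359173),
   (5253547996881675952596282557237915, 4, 248028036333484537048602618742298400710),
   (5253547996881675952599593977023131, 4, 248028036333484536070925182835692165125),
   (20521671862819046689842935794331, 4, 4575309709348523240121225679860650427206434274216082692101),
   (80162780714136901210330532507, 3, 32357418440655117108336026282720688818387054766290827284701454189601461851380),
   (313230328590644220987607707, 0, 84399567266310637147296321923601416461104418720922611101664379360779076392804),
   (1355313163328382350715851146379561627, 4, 77268969271857723968299282141159771125),
   (5294192044251493557483802952632987, 4, 1425360900997286917333480589688586279457626987028729059413),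
   (20680437672857396708999236848283, 3, 1754099168469040059887242880938241923212375014468531475700),
   (80782959659599205976954800795, 3, 32357418440655117108336025931960295886192980702938643457964049972757545571572),
   (315648180229873479337020059, 0, 84399567266310637147296322274361809447743708443482048026786903161339047336003),
   (1327467130069893913414299, 0, 1556897217293466407717253469364748123772631951261276412240385573979146525214772778132982094387267),
   (118541310455264738708123, 1, 20842557462721887534377634239412613931481542834639117119176585977941635207114816298046316580511496059823318943946912),
   (463051993965877885578, 9, 28719684516483145544539388422960060642620046944038492276549911236726506747194012551986112137202645384050944588994736),
   (2067059101807327349020222367570622773898, 0, 0),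
   (25364900281696568239974722980013505162, 6, 13445626791503878352),
   (1369203917300188726310753087614493489802, 0, 0),
   (5415993624865040711447043766859954826, 0, 13445626791503878390),
   (99081641725377219831815525738576522, 4, 248028036333484541383587476064043030784),
   (387037662989754764968029398334090, 11, 4575309709348523325469599472118928467561740532173900241168),
   (2067059101807327349057188472954908408458, 0, 0),
   (25364900281696568276940828364299139722, 6, 13445626791503878448),
   (2056414791120990232602021322364492020362, 6, 0),
   (14720589595359451821773677773882751626, 0, 13445626791503878486),
   (99081641725377219831800110798961290, 11, 248028036333484543154474907140159986016),
   (1375850057279113305675272119608770394762, 6, 12215089658058589184),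
   (5415993624865040711447040459735136906, 11, 13445626791503878528),
   (5374414286246536350294031717222677130, 0, 509652584476924310),
   (21156225097129065279090001796758154, 11, 248028036333484544630214433036924115360),
   (387037662989754764968016479877770, 4, 4575309709348523359789598219497242132199559327289952983472),
   (1511865871053729550656366803594, 5, 84399567266310643876349382608883588388600162029655153472514242237339081791936),
   (2053714755790801896495060147503883713162, 5, 11904905475773323467),
   (8022323264807819908183828701189339786, 6, 223942247665924507031126185501388724709)],
  [(31337834703512884534546956017040010, 0, 248028036333484546485841595113560627701),
   (438638691550685038856111498258461333486218, 0, 0),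
   (1713473968208481937392694701950389287562, 0, 13445626791503878683),
   (6693257688314382567940213679494625930, 6, 248028036333484547378779300019647306240),
   (26145537844978056906016459687819914, 5, 10935735365184777129969130327321369142),
   (184053552303918763363978041719434, 0, 2025237269515539399484322681320753126460700224594440641093),
   (718959188687182669399149083274, 4, 37216029549785722527245743664649291217968854824252452254478758830900294796288),
   (5905726058803631057253530250, 9, 37359033599291489673168190587914214619894735378714908978751646815963180980832),
   (8074449616434872457038188228812376731, 6, 0),
   (99081641725377219615345867130309275, 6, 13445626791503878784),
   (1367807148481492631938553618235374865051, 6, 0),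
   (5343260505095327384522850951692454555, 0, 13445626791503878822),
   (1709486284221127189773983282981691361947, 6, 0),
   (6745221620649956584206438762569960091, 0, 13445626791503878854),
   (26348521955663892907622710571076251, 4, 248028036333484550533172536623980632752),
   (387037662989754764970228924975771, 5, 4575307464482142347627426851210597978862958531510461815520),
   (1386494367965450422093476811950738016923, 0, 0),
   (25364900281696568239978382223665171099, 4, 13445626791503878912),
   (1369203917300188726310756746858145155739, 0, 0),
   (8074449616434872457258317131072309915, 0, 13445626791503878948),
   (99081641725377219835474769390242459, 6, 248028036333484551676870669193972833072),
   (1367807148481492631938553633705847065243, 4, 13444767106790933510),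
   (5343260505095327384522866422164654747, 0, 13445626791503878998),
   (26348521955663892907638181043276443, 4, 109788210675917580812294688524955835232),
   (387037662989754764985699397175963, 5, 4575309709348523515951985548778627706996786438574936447856),
   (1511865871053729550725623220891, 11, 84399567266310647660996658794364695584372194776198335255083666430511950486400),
   (2067059101807327349020222930520542640778, 0, 0),
   (25364900281696568239975285929933372042, 6, 13445626791503879072),
   (1369203917300188726310753650564413356682, 0, 0),
   (5415993624865040711447606716779821706, 0, 13445626791503879110),
   (99081641725377219832378475658443402, 4, 248028036333484554665243209134920195024),
   (1375850057279113305675127726252809091722, 0, 12216972021428470790),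
   (14720589595359451821629296525736245898, 4, 13445626791503879152),
   (5374414286246536350294049331151993482, 4, 13445626791503879174),
   (57502303106872858678821090030615178, 4, 248028036333484556140982735031684324368),
   (387037662989754764985630409194122, 11, 3422382533612312991731313720410153123767437089067534146592),
   (3768470936412019666318504264052831255178, 0, 0),
   (25364900281696568221383582303380929162, 11, 13445626791503879232),
   (2056414791120990232601804301872066558602, 0, 0),
   (8074449616434872457037621980055566986, 11, 13445626791503879264)],
  [(99081641725377219614779618373499530, 6, 248028036333484557708955981296996211824),
   (1369162337961570221949599230053567789706, 11, 12215089658058589190),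
   (5374414286246536350293186205934254730, 0, 13445626791503879318),
   (21156225097129065278244490508335754, 11, 247607663508187340697494431837826604192),
   (387037662989754764122505191455370, 4, 4567557444291104676701654862508064242055917068884519181488),
   (1709444704882508685412974685208801016458, 4, 11572957069700061382),
   (6703642282031452223197840989679614602, 0, 248028036333484559976675246772985086980),
   (1709486284221127189774128258056344664714, 4, 11987182682306074816),
   (6745221620649956584351413837223262858, 6, 225266282019189513505132446038054952176),
   (26348521955663892907622710302571146, 11, 248028036333484560863349217901329538272),
   (350165276151241038355634100343875388930698, 0, 0),
   (1716132424200051769138502333744740399754, 0, 13445626791503879460),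
   (6703642282031452223197856451595434634, 6, 248028036333484561710669189564780856320),
   (26186102664185360246866626764962442, 11, 248028036333484562043940838618740841748),
   (26348521955663892907638172218391178, 11, 248028036333484561121603634933263261008),
   (102923913889312081670461611145866, 11, 4575309709348523701203832857732268445129705796359580310864),
   (1511865871053729550725354715786, 5, 84399567266310648797594952511913130304010821872947311053142134293377179475312),
   (5905726058803631057521965706, 9, 84399567266310647793260865490172385348803999862485522983963481832196110966144),
   (350162617695249468523888292731953851497098, 0, 0),
   (1367822725372068236421438643544358746762, 5, 13445626791503879595),
   (5343057520984641548521244701346069130, 6, 248028036333484564202119141687522577397),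
   (20953240986443229277485963895470730, 0, 2025237269515539704377245253717719387924969485737428803013),
   (184053552303918763363978578590346, 4, 2017485004458120819730778000632273839402082420977663237584),
   (718959188687182669399685954186, 4, 37216029549785728553263409635862824810664219735508090409046510770330084466144),
   (2808434330809307302343572106, 9, 37359033599291495699185858803994129348385791467091600971220472091313441888884),
   (23069242417201683820542602, 9, 689152531647246417950837267635932337896739697563361081103849895506281108152805455972177470840320),
   (90114228192194298739338, 3, 28719684516483148484296940175470129252912216890752447172959998262007525924314226924827276231485982307512812960112144),
   (352371529523620575882, 1, 16406556112270759531017870274798184827532215312084221274295823138284537568352346111709022852240937622334725873294880),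
   (1671870830057184565885509733019, 5, 62156493599131550568790161021904988989154137175303735957963861355004574195248),
   (878040533086818605106676271771, 5, 62156493949611679992795713149042598552423379343513950504319140561560632708080),
   (6530745429910891577692818075, 11, 1556896453405021090893755188058333807243793922978586040651325780922226649462734835489190603415120),
   (2069743539565599430018585564026565655178, 0, 0),
   (28049338039968649238337919435956386442, 6, 13445626791503879792),
   (1369214403385181976627009095895438949002, 0, 0),
   (5426479709858291027703052047805414026, 0, 13445626791503879830),
   (109567726718627536087823806684035722, 4, 248028036333484567946898942205797359264),
   (2056425277205983482918276779811888790154, 0, 12216972021428470788),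
   (8032911239085872980149520943447374474, 6, 13445626791503879876),
   (57543264376377742726678581765307018, 6, 174935426671548049011430664647845371600),
   (427998932494638812843122143885962, 11, 3423891083841845435499428897920547637135595296936789303008)],
  [(262712718338644846495864019287791160097418, 0, 0),
   (1026221556010331431624469407053339261578, 6, 13445626791503879940),
   (4008677953165357154783083621303024266, 11, 248028036333484570601999270288323331076),
   (262706072198665921916499645212102764362378, 0, 0),
   (1026195594526038757486326739109777341066, 11, 13445626791503879990),
   (4008576541117338896430963885046594186, 4, 248028036333484571580906102100502594566),
   (15659692084849146750164313373768330, 0, 248028036333484570990611714367873376086),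
   (16004889508099121701530835875363466, 4, 3450085101684395131433983398818897760),
   (62519099641012194148877134822026, 4, 63642836903290231666607576140434413191896094290060795744),
   (1671870830057182877035380963978, 3, 84399567266310653214519013013311187495479927067351997669662139115432490065792),
   (262704742970670137000645188149116193569418, 0, 0),
   (1026190402229180222660068162787014703754, 3, 13445626791503880102),
   (5343301466364832269944340491710069386, 0, 227995199650132410112921302244497842099),
   (20872271352987626054470080046660234, 11, 4575309709348523907967485692848108701823349898590690558976),
   (1027550784006116347498598177750348561034, 3, 7755224412244303830),
   (6703683243300957108474355455043926666, 0, 170947758212988078996892204560645382115),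
   (26389483225168778184137175666883210, 11, 4155429452844068685504121669071884839803756665184650813424),
   (103083918848315540348094729779850, 4, 4575309709348523929870435273907507001345770733864110546896),
   (262704742970670137000737276909871735339658, 0, 0),
   (1367885175389397060865578402273748941450, 0, 13445626791503880227),
   (5343301466364832269799380878704081546, 11, 248028036333484575859107286944880680496),
   (20872271352987626053903831558355594, 6, 4575309709348523953242046129613922445030951071296035832832),
   (103083918848315539781846241475210, 4, 4575309709348523937016364979247214734076637489931242987600),
   (81532309972607914275334149208714, 4, 4575309709348523937019513133942623640927870547420065585347),
   (402671558001232579545144064650, 4, 84399567266310655024482064655628625538078089296832534564145205692031453651056),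
   (6530745429910891577424312970, 5, 1272241801566333953445950324779920953800491475674797372906399632228735303016275320171845274067072),
   (25510724335589420225362570, 9, 1556897217293466687470941073191063480091731563839296956964966416487608223431736746083283606331536),
   (351526416105009785459803998612224957053578, 0, 0),
   (1373150062910194474452359371838476352138, 4, 13445626791503880374),
   (12020595226440620598860942111403506314, 0, 206877179575707418077018732619528954052),
   (46955450103283674214300555442485898, 5, 4575309709348524000651895497027269459681235890587090177008),
   (184213557262922216678193976933002, 11, 84399525855835043811350447056857343556238604941535108862012210866086795567328),
   (719584208058289908955584494218, 3, 84399567266310656428002782696214097424961464948446235841418537676306185085088),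
   (2810875812727695039016827530, 3, 755902126566156179643478946972041613128819237700898311409066629159169141558303402433678211899552),
   (25510724335589420493798026, 9, 755902126566156168608568980988305823281561908634377779721254696595897490976411973259397134573840),
   (99651266935896174852746, 9, 13943933073538688721115361147402258734776513995440394717592462206096936944295570661238118256569191506375755355808032),
   (481570795633625365130, 1, 28719684516483145575110702118646767106030107216333133681639481708593804130323687792929820873167147992280534095323440),
   (1883392123139095178, 1, 529784670153243520819319813154533233047179137651331405888619632957938585478678432825801736089098351906173510488590202343193487915442496),
   (9894678152968842, 10, 5582861247432538261549118121808315607502493966271911637934772470247040164076805944147683530629074236100322440052082296031287307875707870469145944559542608),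
   (38651089746570, 8, 5582861419121087084142715824435558925564918398718583715466490648381744154205257196437248596595368185377298490054014704292163486899304597843613176565948768)],
  [(3740577956072152248187258, 1, 25266878508685852375534619584658266126832894649693037580628099018598263951830845038950050847584406437709480914542960),
   (1344989337611961136643139826571901611, 5, 0),
   (5253864600046723190012264949840555, 6, 13445626791503880597),
   (344317270428662050980643795601884674426, 6, 0),
   (1344989337611961136643139826637044090, 5, 13445626791503880630),
   (344317270428662050980643795601902434682, 6, 0),
   (1344989337611961136643139826654804346, 6, 13445626791503880661),
   (5253864600046723190012264947874170, 10, 248028036333484583884885821890849956293),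
   (20522908593932512460985409960314, 11, 4575309709348524072792177516382311566769766181536858661365),
   (344317270428662050980499396739808852346, 11, 10987292369460675590),
   (1344989337611961136642575768582060410, 5, 13445626791503880726),
   (5253864600046723190010061596031354, 5, 248028036333484585150319107886758847014),
   (20522908593932512460976803117434, 10, 1840780943971401437208900740508114635138664988161554276917),
   (80167611695048876800724269434, 4, 84399567266310658137877077913136708986880650975253270668491922100076812460613),
   (344317209422976914996959449711237495467, 11, 11118094948579172725),
   (1344989099308503574206872850771049131, 6, 202648636923837815132589587079774626405),
   (344317209422976914996959449728164723066, 6, 10843445533895319931),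
   (1344989099308503574206872850501630330, 5, 248028036333484586921391097845528945270),
   (5253863669173842086745597073324410, 10, 248028036333484586633450688873573147285),
   (5253863669173842086745597073389946, 6, 248028036333484587498999699582278066853),
   (20522904957710320651349988571514, 6, 4575309709348524165689263704813271099013441005372203754149),
   (80167597491055940044369525114, 4, 41418942401186453782552529377413476557577266886263789062429837170127831982469),
   (313154733833430102585211258, 1, 1369003059477890462111728659538065534616537620007464502911004351765191111090426591455892833722740),
   (263050342209009395920388925879976315157163, 0, 0),
   (1027540399253942952814019241718994008747, 5, 13445626791503880950),
   (4013829923208347547528595950796372651, 1, 197600144967346057661666266278523855621),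
   (15679023147222923449318878958156459, 11, 3738207542220123834797924441787903525957754500347373576977),
   (263050342209009395920388925879993494108538, 0, 0),
   (1027540399253942952814019241718724589946, 11, 13445626791503881014),
   (4013829684595404975271547963720759674, 1, 248028036333484590470332329111489503606),
   (15679023147222923449318878688737658, 5, 4196472821115542976753749939577322160624092169907446244177),
   (61246184168839544723901870930298, 10, 4575309709348524203800888799958379010349195577436401853153),
   (239242906909529471577741687162, 10, 48002550490662945636917983037650919143587524754767887839775641119660594914161),
   (934542605115349498384185722, 4, 1378405985730480257253371469519470579039131232114794705395179526601764549408834779616579671835649),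
   (3669724012085033860430202, 0, 25930743228518259694344214984583410360366217266639497314860014188923141451771347880024768192165799083782363046503137),
   (244212852973860917697725430138, 5, 82559925276263878552192618335955099618205083933951559567046126910839898334112),
   (61250839761080165529121004943738, 0, 76677127790832348896491369241450028590162254586141429002988646428845694804337),
   (239261092816719396598128933242, 5, 84399567266310660949985084901508233235715712740040705893703197478560365306801),
   (957635254283693680047520122, 5, 88406130097924641058515549588304012731603708628520691389402721977962482972482650746749560316880),
   (3740762712045687045454202, 4, 196916719696549680153735660995106156075191461665292091267466139347390182453393410294129310175423001673117647004576)],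
  [(14612354343928465029498, 9, 1630805256463486892020550062939066198453679437171885756172361723363991510181466185312981873033024074489592376484768),
   (3740762712045687314938234, 10, 9960653723654401342291278703322080309867852956247418979269206280959454582156176727391027785843134879991347654255616),
   (14612354343928466078074, 9, 9960653714482646623090120255721765910733380324064362209756881679619648561743599329778791031264705585721818958881792),
   (57079509155970578810, 9, 183741629877905793795368705287463267391996142705166097880944291098933682935328909877922606773161664501042338443302277023705369086616576),
   (1739276934841923962, 3, 439270868041553999080898609515975165919303010625986390421515843641031698924839809959755490993919190223102690109734354083139365811282992),
   (6794050527590778, 3, 9772802224491515046450785580723825458007538979276683966826296600906816001000892302161143230912491430258552118768594212780378480369761680469196427480097856),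
   (38651086535034, 8, 5582861269279443652484310359287867748775878990465426857608906047346747137763537044394873147955477187648766910400114075276953887871717563248951438530929744),
   (150980819322, 8, 102985615797513620677764406256674723642559643923980087470400646838441209609123098069357384907760489504204015851263170762080363200604454034673474213643003768454465932134278240),
   (589768826, 7, 150386599113587771366965389166315553133998948247169432003109576189542645700922842575011703248234861102658638335565587015998645769875684162275649202672185927053353029675869296),
   (2303784, 7, 3058181767461384866022446852970531492236350018107240015797902018137507865002384292881364203661600277066803984215986778315945343857685802068879283845059541394313898669140102939433964503541310592),
   (9000, 2, 163742888007682757987874120613323374274491498213642558253837034033729714365535554916500084316512899345516725547946985082913967236321363048825508849261905016481292347190109328),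
   (35, 2, 3021632674989283242927293834915321053277715531521143208701493665413959859575920835565647317531259408256762107114670200059156469812422771797579588516454668783446621134352832304510344655557190816),
   (0, 3, 55734062166213385969677904787040893451592416403534397917629988956219248182684434204427249605728058343442641906844533907142150464903190704666489316094154557569462829542281402443866042273017231434605863380837295280)]]


end CubicSearch

open CubicSearch in
/-- Any two cospectral cubic graphs on at most 12 vertices are isomorphic. -/
theorem cospectral_cubic_of_order_le_twelve_isomorphic
    (n : ℕ) (hn : n ≤ 12) (G H : SimpleGraph (Fin n))
    (hG : ∀ v, (G.neighborSet v).ncard = 3)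
    (hH : ∀ v, (H.neighborSet v).ncard = 3)
    (hcospec : (adjMat G).charpoly = (adjMat H).charpoly) :
    Nonempty (G ≃g H) := by
  obtain ⟨k, rfl⟩ := (even_of_ncard_neighborSet_eq_three hG).two_dvd
  have hk : k ≤ 6 := by omega
  interval_cases k
  · exact ⟨⟨Equiv.refl _, fun {a} => a.elim0⟩⟩
  · exact nonempty_iso_of_table hn (T := twoTable) (N := 2) (i := 1)
      (by decide +kernel) (by decide +kernel) (by decide) (by decide +kernel) hG hH hcospec
  · exact nonempty_iso_of_table hn (T := fourTable) (N := 7) (i := 6)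
      (by decide +kernel) (by decide +kernel) (by decide) (by decide +kernel) hG hH hcospec
  · exact nonempty_iso_of_table hn (T := sixTable) (N := 24) (i := 23)
      (by decide +kernel) (by decide +kernel) (by decide) (by decide +kernel) hG hH hcospec
  · exact nonempty_iso_of_table hn (T := eightTable) (N := 79) (i := 78)
      (by decide +kernel) (by decide +kernel) (by decide) (by decide +kernel) hG hH hcospec
  · exact nonempty_iso_of_table hn (T := tenTable) (N := 328) (i := 327)
      (by decide +kernel) (by decide +kernel) (by decide) (by decide +kernel) hG hH hcospec
  · exact nonempty_iso_of_table hn (T := twelveTable) (N := 1613) (i := 1612)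
      (by decide +kernel) (by decide +kernel) (by decide) (by decide +kernel) hG hH hcospec
end

section
/- There exist two 3-regular simple graphs on 20 vertices that are cospectral (their adjacency matrices have the same characteristic polynomial) such that one contains a Hamiltonian cycle and has chromatic index 3, while the other is not 3-edge-colorable and hence has chromatic index 4 and contains no Hamiltonian cycle. -/
open Matrix Polynomial

namespace Matrix

/-- Matrices intertwined by a nonsingular matrix have the same characteristic polynomial. -/
theorem charpoly_eq_of_mul_eq_mul {n R : Type*} [Fintype n] [DecidableEq n] [CommRing R]
    [IsDomain R] {A B P : Matrix n n R} (h : A * P = P * B) (hP : P.det ≠ 0) :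
    A.charpoly = B.charpoly := by
  have hmul : A.charmatrix * P.map C = P.map C * B.charmatrix := by
    simp only [charmatrix, sub_mul, mul_sub, RingHom.mapMatrix_apply, ← Matrix.map_mul, h]
    rw [scalar_commute X (fun r => Commute.all _ r) (P.map C)]
  have hdet : (P.map (C : R →+* R[X])).det = C P.det := (RingHom.map_det C P).symm
  have key := congrArg det hmul
  rw [det_mul, det_mul, mul_comm, hdet] at key
  exact mul_left_cancel₀ (C_ne_zero.2 hP) key

end Matrix

namespace SimpleGraph

variable {V : Type*} {G : SimpleGraph V} {k : ℕ}

/-- A function on pairs of vertices which is symmetric and takes distinct values on distinct edges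
at a common vertex is a proper edge coloring. -/
theorem lineGraph_colorable_of_forall_ne (c : V → V → Fin k) (hsymm : ∀ u v, c u v = c v u)
    (hc : ∀ u v w, G.Adj u v → G.Adj u w → v ≠ w → c u v ≠ c u w) : G.lineGraph.Colorable k := by
  refine ⟨Coloring.mk (fun e => Sym2.lift ⟨c, hsymm⟩ e.1) ?_⟩
  rintro ⟨e, he⟩ ⟨f, hf⟩ hef
  obtain ⟨hne, u, hue, huf⟩ := lineGraph_adj_iff_exists.1 hef
  obtain ⟨v, rfl⟩ := Sym2.mem_iff_exists.1 hue
  obtain ⟨w, rfl⟩ := Sym2.mem_iff_exists.1 huf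
  exact hc u v w he hf fun h => hne (by subst h; rfl)

theorem exists_forall_ne_of_lineGraph_colorable [NeZero k] (h : G.lineGraph.Colorable k) :
    ∃ c : V → V → Fin k, (∀ u v, c u v = c v u) ∧
      ∀ u v w, G.Adj u v → G.Adj u w → v ≠ w → c u v ≠ c u w := by
  classical
  obtain ⟨C⟩ := h
  let d : Sym2 V → Fin k := fun e => if h : e ∈ G.edgeSet then C ⟨e, h⟩ else 0
  refine ⟨fun u v => d s(u, v), fun u v => by simp only [Sym2.eq_swap], fun u v w hv hw hvw => ?_⟩
  have hv' : s(u, v) ∈ G.edgeSet := hv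
  have hw' : s(u, w) ∈ G.edgeSet := hw
  simp only [d, dif_pos hv', dif_pos hw']
  refine C.valid (lineGraph_adj_iff_exists.2 ⟨fun h => hvw ?_, u, by simp, by simp⟩)
  exact Sym2.congr_right.1 (congrArg Subtype.val h)

theorem not_lineGraph_colorable_two {u : V} (hu : (G.neighborSet u).ncard = 3) :
    ¬ G.lineGraph.Colorable 2 := by
  intro h
  obtain ⟨c, -, hc⟩ := exists_forall_ne_of_lineGraph_colorable h
  obtain ⟨x, y, z, hxy, hxz, hyz, hs⟩ := Set.ncard_eq_three.1 hu
  have hx : G.Adj u x := by rw [← mem_neighborSet, hs]; simp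
  have hy : G.Adj u y := by rw [← mem_neighborSet, hs]; simp
  have hz : G.Adj u z := by rw [← mem_neighborSet, hs]; simp
  have h1 := hc u x y hx hy hxy
  have h2 := hc u x z hx hz hxz
  have h3 := hc u y z hy hz hyz
  omega

/-- In a Hamiltonian graph of even order and maximum degree three, coloring the edges of a
Hamiltonian cycle alternately and all other edges with a third color is proper. -/
theorem IsHamiltonian.lineGraph_colorable_three [Fintype V] [DecidableEq V]
    (hG : G.IsHamiltonian) (hV : Even (Fintype.card V))
    (hdeg : ∀ v, (G.neighborSet v).ncard ≤ 3) : G.lineGraph.Colorable 3 := by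
  obtain ⟨a, p, hp⟩ := hG (by rintro h; simp [h] at hV)
  have hlen := hp.length_eq
  have hthree := hp.isCycle.three_le_length
  generalize Fintype.card V = N at hV hlen
  have hidx : ∀ v, ∃ i < N, p.getVert i = v := by
    intro v
    obtain ⟨i, hi, hiN⟩ := Walk.mem_support_iff_exists_getVert.1 (hp.mem_support v)
    rcases hiN.lt_or_eq with h | h
    · exact ⟨i, hlen ▸ h, hi⟩
    · refine ⟨0, by omega, ?_⟩
      rw [← hi, h, Walk.getVert_length, Walk.getVert_zero]
  choose e heN he using hidx
  have hadj : ∀ i < N, G.Adj (p.getVert i) (p.getVert (i + 1)) := fun i hi =>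
    p.adj_getVert_succ (hlen ▸ hi)
  have hclose : p.getVert N = p.getVert 0 := by
    rw [← hlen, Walk.getVert_length, Walk.getVert_zero]
  have hinj : ∀ i < N, e (p.getVert i) = i := fun i hi =>
    hp.isCycle.getVert_injOn' (by have := heN (p.getVert i); simp; omega) (by simp; omega)
      (he (p.getVert i))
  have heinj : ∀ v w, e v = e w → v = w := fun v w h => by rw [← he v, ← he w, h]
  obtain ⟨m, hm⟩ := hV
  let color : ℕ → ℕ → Fin 3 := fun i j =>
    if max i j = min i j + 1 then (if min i j % 2 = 0 then 0 else 1)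
    else if min i j = 0 ∧ max i j + 1 = N then 1 else 2
  refine lineGraph_colorable_of_forall_ne (fun u v => color (e u) (e v))
    (fun u v => by simp only [color, max_comm, min_comm]) fun u v w hv hw hvw heq => ?_
  have hu := heN u
  have hjv := heN v
  have hkw := heN w
  have hjk : e v ≠ e w := fun h => hvw (heinj _ _ h)
  have hiv : e u ≠ e v := fun h => hv.ne (heinj _ _ h)
  have hiw : e u ≠ e w := fun h => hw.ne (heinj _ _ h)
  obtain ⟨s, hsN, hs, hus⟩ : ∃ s < N, (s = e u + 1 ∨ e u + 1 = N ∧ s = 0) ∧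
      G.Adj u (p.getVert s) := by
    have h := hadj (e u) hu
    rw [he] at h
    by_cases hl : e u + 1 = N
    · exact ⟨0, by omega, Or.inr ⟨hl, rfl⟩, by rwa [hl, hclose] at h⟩
    · exact ⟨e u + 1, by omega, Or.inl rfl, h⟩
  obtain ⟨t, htN, ht, hut⟩ : ∃ t < N, (e u = t + 1 ∨ t + 1 = N ∧ e u = 0) ∧
      G.Adj u (p.getVert t) := by
    by_cases hl : e u = 0
    · have h := hadj (N - 1) (by omega)
      rw [Nat.sub_add_cancel (by omega), hclose, ← hl, he] at h
      exact ⟨N - 1, by omega, Or.inr ⟨by omega, hl⟩, h.symm⟩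
    · have h := hadj (e u - 1) (by omega)
      rw [Nat.sub_add_cancel (by omega), he] at h
      exact ⟨e u - 1, by omega, Or.inl (by omega), h.symm⟩
  have hfar : e v ≠ s ∧ e v ≠ t ∧ e w ≠ s ∧ e w ≠ t := by
    simp only [color] at heq
    split_ifs at heq <;> omega
  have hcard : ({v, w, p.getVert s, p.getVert t} : Finset V).card = 4 := by
    have hst : s ≠ t := by omega
    have h1 : v ≠ p.getVert s := fun h => hfar.1 (by rw [h, hinj s hsN])
    have h2 : v ≠ p.getVert t := fun h => hfar.2.1 (by rw [h, hinj t htN])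
    have h3 : w ≠ p.getVert s := fun h => hfar.2.2.1 (by rw [h, hinj s hsN])
    have h4 : w ≠ p.getVert t := fun h => hfar.2.2.2 (by rw [h, hinj t htN])
    have h5 : p.getVert s ≠ p.getVert t := fun h => hst (by rw [← hinj s hsN, h, hinj t htN])
    simp [Finset.card_insert_of_notMem, hvw, h1, h2, h3, h4, h5]
  have hsub : (({v, w, p.getVert s, p.getVert t} : Finset V) : Set V) ⊆ G.neighborSet u := by
    intro x hx
    simp only [Finset.coe_insert, Finset.coe_singleton, Set.mem_insert_iff,
      Set.mem_singleton_iff] at hx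
    rcases hx with rfl | rfl | rfl | rfl <;> assumption
  have := Set.ncard_le_ncard hsub (Set.toFinite _)
  rw [Set.ncard_coe_finset, hcard] at this
  exact absurd (hdeg u) (by omega)

/-- Exhaustive search: `noEdgeColoring k es used` holds if the edges `es` cannot be properly colored
with `k` colors when `used` lists the pairs of a vertex and a color already present at it. -/
def noEdgeColoring [DecidableEq V] (k : ℕ) : List (V × V) → List (V × Fin k) → Bool
  | [], _ => false
  | (u, v) :: es, used => (List.finRange k).all fun a =>
      decide ((u, a) ∈ used) || decide ((v, a) ∈ used) ||
        noEdgeColoring k es ((u, a) :: (v, a) :: used)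

theorem noEdgeColoring_eq_false [DecidableEq V] {c : V → V → Fin k}
    (hsymm : ∀ u v, c u v = c v u)
    (hc : ∀ u v w, G.Adj u v → G.Adj u w → v ≠ w → c u v ≠ c u w) (es : List (V × V))
    (used : List (V × Fin k)) (hadj : ∀ e ∈ es, G.Adj e.1 e.2)
    (hnodup : (es.map fun e => s(e.1, e.2)).Nodup)
    (hused : ∀ x ∈ used, ∃ y, G.Adj x.1 y ∧ c x.1 y = x.2 ∧
      s(x.1, y) ∉ es.map fun e => s(e.1, e.2)) :
    noEdgeColoring k es used = false := by
  induction es generalizing used with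
  | nil => rfl
  | cons e es ih =>
    obtain ⟨u, v⟩ := e
    have huv : G.Adj u v := hadj _ List.mem_cons_self
    rw [List.map_cons, List.nodup_cons] at hnodup
    rw [noEdgeColoring, List.all_eq_false]
    refine ⟨c u v, List.mem_finRange _, ?_⟩
    have hu : (u, c u v) ∉ used := by
      intro h
      obtain ⟨y, hy, hcy, hmem⟩ := hused _ h
      exact hc u y v hy huv (fun h => hmem (by simp [h])) hcy
    have hv : (v, c u v) ∉ used := by
      intro h
      obtain ⟨y, hy, hcy, hmem⟩ := hused _ h
      refine hc v y u hy huv.symm (fun h => hmem (by simp [h, Sym2.eq_swap])) ?_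
      rw [hcy, hsymm]
    rw [ih _ (fun e he => hadj e (List.mem_cons_of_mem _ he)) hnodup.2]
    · simp [hu, hv]
    · simp only [List.mem_cons]
      rintro x (rfl | rfl | hx)
      · exact ⟨v, huv, rfl, hnodup.1⟩
      · exact ⟨u, huv.symm, hsymm _ _, by rw [Sym2.eq_swap]; exact hnodup.1⟩
      · obtain ⟨y, hy, hcy, hmem⟩ := hused _ hx
        exact ⟨y, hy, hcy, fun h => hmem (List.mem_cons_of_mem _ h)⟩

theorem not_lineGraph_colorable_of_noEdgeColoring [DecidableEq V] [NeZero k] (es : List (V × V))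
    (hadj : ∀ e ∈ es, G.Adj e.1 e.2) (hnodup : (es.map fun e => s(e.1, e.2)).Nodup)
    (hes : noEdgeColoring k es [] = true) : ¬ G.lineGraph.Colorable k := by
  intro h
  obtain ⟨c, hsymm, hc⟩ := exists_forall_ne_of_lineGraph_colorable h
  simp [noEdgeColoring_eq_false hsymm hc es [] hadj hnodup (by simp)] at hes

/-- The graph whose edges are the pairs in a list. -/
def ofEdgeList (l : List (V × V)) : SimpleGraph V :=
  fromRel fun u v => (u, v) ∈ l

instance [DecidableEq V] (l : List (V × V)) : DecidableRel (ofEdgeList l).Adj :=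
  inferInstanceAs (DecidableRel (fromRel fun u v => (u, v) ∈ l).Adj)

theorem ncard_neighborSet_eq_card_filter [Fintype V] [DecidableRel G.Adj] (v : V) :
    (G.neighborSet v).ncard = (Finset.univ.filter fun w => G.Adj v w).card := by
  rw [← Set.ncard_coe_finset]
  congr 1
  ext w
  simp

end SimpleGraph

namespace CospectralCubic

open SimpleGraph

/-- A cubic graph on 20 vertices containing a Hamiltonian cycle. -/
def hamiltonianGraph : SimpleGraph (Fin 20) := ofEdgeList
  [(0, 7), (0, 8), (0, 19), (1, 4), (1, 9), (1, 12), (2, 5), (2, 11), (2, 12), (3, 6), (3, 10),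
   (3, 19), (4, 8), (4, 14), (5, 11), (5, 13), (6, 10), (6, 13), (7, 9), (7, 14), (8, 15),
   (9, 15), (10, 16), (11, 16), (12, 18), (13, 17), (14, 15), (16, 17), (17, 18), (18, 19)]

/-- The edges of a cubic graph on 20 vertices of chromatic index 4, ordered such that the search for
a 3-edge-coloring fails early. -/
def classTwoEdges : List (Fin 20 × Fin 20) :=
  [(0, 7), (0, 8), (0, 12), (3, 12), (12, 18), (3, 6), (3, 10), (6, 10), (6, 14), (10, 15),
   (14, 15), (5, 14), (11, 15), (5, 11), (2, 5), (2, 11), (2, 19), (18, 19), (1, 19), (17, 18),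
   (1, 4), (1, 9), (4, 8), (4, 13), (7, 9), (7, 13), (13, 17), (8, 16), (9, 16), (16, 17)]

/-- A cubic graph on 20 vertices of chromatic index 4. -/
def classTwoGraph : SimpleGraph (Fin 20) := ofEdgeList classTwoEdges

instance : DecidableRel hamiltonianGraph.Adj := inferInstanceAs (DecidableRel (ofEdgeList _).Adj)

instance : DecidableRel classTwoGraph.Adj := inferInstanceAs (DecidableRel (ofEdgeList _).Adj)

/-- Twice the orthogonal matrix conjugating the two adjacency matrices: three blocks `J - 2I` of
order 4 and the block `2I` of order 8. -/
def switchingMatrix : Matrix (Fin 20) (Fin 20) ℤ := fun i j =>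
  if i = j then (if i < 12 then -1 else 2)
  else if i < 12 ∧ j < 12 ∧ i.val / 4 = j.val / 4 then 1 else 0

theorem det_switchingMatrix_ne_zero : switchingMatrix.det ≠ 0 := by
  have hsq : switchingMatrix * switchingMatrix = (4 : ℤ) • 1 := by
    ext i j
    revert i j
    decide +kernel
  intro h
  have hdet := congrArg det hsq
  rw [det_mul, h, det_smul, det_one] at hdet
  norm_num at hdet

theorem adjMatrix_mul_switchingMatrix :
    hamiltonianGraph.adjMatrix ℤ * switchingMatrix =
      switchingMatrix * classTwoGraph.adjMatrix ℤ := by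
  ext i j
  revert i j
  decide +kernel

theorem adjMat_eq_map (G : SimpleGraph (Fin 20)) [DecidableRel G.Adj] :
    adjMat G = (G.adjMatrix ℤ).map (Int.castRingHom ℝ) := by
  ext i j
  simp [adjMat, adjMatrix_apply]

theorem charpoly_adjMat_eq :
    (adjMat hamiltonianGraph).charpoly = (adjMat classTwoGraph).charpoly := by
  rw [adjMat_eq_map, adjMat_eq_map, charpoly_map, charpoly_map,
    charpoly_eq_of_mul_eq_mul adjMatrix_mul_switchingMatrix det_switchingMatrix_ne_zero]

theorem ncard_neighborSet_hamiltonianGraph (v : Fin 20) :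
    (hamiltonianGraph.neighborSet v).ncard = 3 := by
  rw [ncard_neighborSet_eq_card_filter]
  revert v
  decide +kernel

theorem ncard_neighborSet_classTwoGraph (v : Fin 20) :
    (classTwoGraph.neighborSet v).ncard = 3 := by
  rw [ncard_neighborSet_eq_card_filter]
  revert v
  decide +kernel

/-- The Hamiltonian cycle of `hamiltonianGraph`. -/
def hamiltonianWalk : hamiltonianGraph.Walk 0 0 :=
  .cons (v := 7) (by decide +kernel) <|
  .cons (v := 14) (by decide +kernel) <|
  .cons (v := 4) (by decide +kernel) <|
  .cons (v := 8) (by decide +kernel) <|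
  .cons (v := 15) (by decide +kernel) <|
  .cons (v := 9) (by decide +kernel) <|
  .cons (v := 1) (by decide +kernel) <|
  .cons (v := 12) (by decide +kernel) <|
  .cons (v := 2) (by decide +kernel) <|
  .cons (v := 5) (by decide +kernel) <|
  .cons (v := 11) (by decide +kernel) <|
  .cons (v := 16) (by decide +kernel) <|
  .cons (v := 10) (by decide +kernel) <|
  .cons (v := 3) (by decide +kernel) <|
  .cons (v := 6) (by decide +kernel) <|
  .cons (v := 13) (by decide +kernel) <|
  .cons (v := 17) (by decide +kernel) <|
  .cons (v := 18) (by decide +kernel) <|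
  .cons (v := 19) (by decide +kernel) <|
  .cons (v := 0) (by decide +kernel) <| .nil

theorem isHamiltonian_hamiltonianGraph : hamiltonianGraph.IsHamiltonian := fun _ =>
  ⟨0, hamiltonianWalk, Walk.isHamiltonianCycle_iff_isCycle_and_length_eq.2
    ⟨(Walk.isCycle_def _).2 ⟨(Walk.isTrail_def _).2 (by decide +kernel), by simp [hamiltonianWalk],
      by decide +kernel⟩, by decide +kernel⟩⟩

theorem not_lineGraph_colorable_three_classTwoGraph : ¬ classTwoGraph.lineGraph.Colorable 3 :=
  not_lineGraph_colorable_of_noEdgeColoring classTwoEdges (by decide +kernel) (by decide +kernel)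
    (by decide +kernel)

/-- A proper 4-edge-coloring of `classTwoGraph`; two edges have the color 3. -/
def edgeColor (u v : Fin 20) : Fin 4 :=
  let e := (min u v, max u v)
  let l₀ : List (Fin 20 × Fin 20) :=
    [(0, 8), (2, 19), (3, 12), (4, 13), (5, 11), (6, 10), (9, 16), (14, 15), (17, 18)]
  let l₁ : List (Fin 20 × Fin 20) :=
    [(0, 12), (1, 9), (2, 11), (3, 6), (4, 8), (5, 14), (7, 13),
     (10, 15), (16, 17), (18, 19)]
  let l₂ : List (Fin 20 × Fin 20) :=
    [(1, 19), (2, 5), (3, 10), (6, 14), (7, 9), (8, 16), (11, 15), (12, 18), (13, 17)]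
  if e ∈ l₀ then 0 else if e ∈ l₁ then 1 else if e ∈ l₂ then 2 else 3

theorem lineGraph_colorable_four_classTwoGraph : classTwoGraph.lineGraph.Colorable 4 :=
  lineGraph_colorable_of_forall_ne edgeColor (by decide +kernel) (by decide +kernel)

end CospectralCubic

open CospectralCubic SimpleGraph in
/-- There exist two cospectral cubic graphs on 20 vertices, one Hamiltonian with
chromatic index 3, the other not 3-edge-colorable, hence with chromatic index 4 and
not Hamiltonian. -/
theorem exists_cospectral_cubic_graphs_order_twenty :
    ∃ G H : SimpleGraph (Fin 20),
      (∀ v, (G.neighborSet v).ncard = 3) ∧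
      (∀ v, (H.neighborSet v).ncard = 3) ∧
      (adjMat G).charpoly = (adjMat H).charpoly ∧
      G.IsHamiltonian ∧ chromaticIndex G = 3 ∧
      ¬ chromaticIndex H ≤ 3 ∧ chromaticIndex H = 4 ∧ ¬ H.IsHamiltonian := by
  have hG : hamiltonianGraph.lineGraph.Colorable 3 :=
    isHamiltonian_hamiltonianGraph.lineGraph_colorable_three (by decide)
      fun v => (ncard_neighborSet_hamiltonianGraph v).le
  refine ⟨hamiltonianGraph, classTwoGraph, ncard_neighborSet_hamiltonianGraph,
    ncard_neighborSet_classTwoGraph, charpoly_adjMat_eq, isHamiltonian_hamiltonianGraph,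
    chromaticNumber_eq_iff_colorable_not_colorable.2
      ⟨hG, not_lineGraph_colorable_two (ncard_neighborSet_hamiltonianGraph 0)⟩,
    fun h => not_lineGraph_colorable_three_classTwoGraph (chromaticNumber_le_iff_colorable.1 h),
    chromaticNumber_eq_iff_colorable_not_colorable.2
      ⟨lineGraph_colorable_four_classTwoGraph, not_lineGraph_colorable_three_classTwoGraph⟩,
    fun h => not_lineGraph_colorable_three_classTwoGraph
      (h.lineGraph_colorable_three (by decide) fun v => (ncard_neighborSet_classTwoGraph v).le)⟩
end
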